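/- arXiv:2103.03952 — 3 statements merged into one kernel-verified Lean document; each statement's English description precedes it below -/
import Mathlib

section
/- For every integer n ≥ 1, every 6^n-conic simplicial complex is n-connected (i.e., its geometric realization is non-empty and has vanishing homotopy groups π_k for all 0 ≤ k ≤ n). -/
open Finset
open scoped Classical

/-- An abstract simplicial complex on vertex type `V`: a downward-closed family of
nonempty finite subsets of `V`. -/
structure SComplex (V : Type*) where
  faces : Set (Finset V)
  not_empty_mem : ∅ ∉ faces
  down_closed : ∀ {s t : Finset V}, s ∈ faces → t ⊆ s → t.Nonempty → t ∈ faces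

namespace SComplex

variable {V W : Type*}

/-- The vertex set of a simplicial complex. -/
def vertexSet (K : SComplex V) : Set V := {v | {v} ∈ K.faces}

/-- The geometric realization of a simplicial complex, as the set of convex-combination
coordinate functions supported on a simplex. -/
def realization (K : SComplex V) : Set (V → ℝ) :=
  {x | ∃ σ ∈ K.faces, (∀ v, 0 ≤ x v) ∧ (∀ v, v ∉ σ → x v = 0) ∧ (∑ v ∈ σ, x v) = 1}

/-- The geometric realization as a topological space. -/
abbrev space (K : SComplex V) : Type _ := ↥(K.realization)

/-- `L` is a subcomplex of `K`. -/
def IsSubcomplex (L K : SComplex V) : Prop := L.faces ⊆ K.faces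

/-- A complex is `r`-conic (`r` an integer, possibly `-1`) if every subcomplex with at
most `r` vertices is contained in the closed star of some vertex. -/
def IsConic (K : SComplex V) (r : ℤ) : Prop :=
  ∀ L : SComplex V, L.IsSubcomplex K → L.vertexSet.Finite →
    (L.vertexSet.ncard : ℤ) ≤ r →
    ∃ v ∈ K.vertexSet, ∀ σ ∈ L.faces, insert v σ ∈ K.faces

/-- The link of a vertex `v` in `K`. -/
def vertexLink (K : SComplex V) (v : V) : Set (Finset V) :=
  {τ ∈ K.faces | v ∉ τ ∧ insert v τ ∈ K.faces}

/-- A nonempty complex is `r`-ample if for every set `U` of at most `r` vertices and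
every subcomplex `L` with vertices in `U`, some vertex `v` has a link whose simplices
contained in `U` are exactly those of `L`. -/
def IsAmple (K : SComplex V) (r : ℕ) : Prop :=
  K.faces.Nonempty ∧
  ∀ U : Finset V, ↑U ⊆ K.vertexSet → U.card ≤ r →
    ∀ L : SComplex V, L.IsSubcomplex K → L.vertexSet ⊆ ↑U →
      ∃ v ∈ K.vertexSet, {τ ∈ K.vertexLink v | ↑τ ⊆ (U : Set V)} = L.faces

end SComplex

/-- A topological space is `n`-connected if it is nonempty and every continuous map
from the `k`-sphere, `0 ≤ k ≤ n`, is null-homotopic. -/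
def NConnected (n : ℕ) (X : Type*) [TopologicalSpace X] : Prop :=
  Nonempty X ∧ ∀ k : ℕ, k ≤ n →
    ∀ f : C(Metric.sphere (0 : EuclideanSpace ℝ (Fin (k + 1))) 1, X),
      f.Nullhomotopic

namespace SComplex

/-- The closed simplex spanned by a finite set of vertices. -/
def simplex {V : Type*} (σ : Finset V) : Set (V → ℝ) :=
  {x | (∀ v, 0 ≤ x v) ∧ (∀ v, v ∉ σ → x v = 0) ∧ (∑ v ∈ σ, x v) = 1}

theorem convex_simplex {V : Type*} (σ : Finset V) : Convex ℝ (simplex σ) := by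
  rintro x ⟨hx0, hxσ, hx1⟩ y ⟨hy0, hyσ, hy1⟩ a b ha hb hab
  refine ⟨fun v => ?_, fun v hv => ?_, ?_⟩
  · have := mul_nonneg ha (hx0 v)
    have := mul_nonneg hb (hy0 v)
    simp only [Pi.add_apply, Pi.smul_apply, smul_eq_mul]
    linarith
  · simp [hxσ v hv, hyσ v hv]
  · simp [Finset.sum_add_distrib, ← Finset.mul_sum, hx1, hy1, hab]

theorem single_mem_simplex {V : Type*} {σ : Finset V} {v : V} (hv : v ∈ σ) :
    Pi.single v (1 : ℝ) ∈ simplex σ := by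
  refine ⟨fun u => ?_, fun u hu => ?_, ?_⟩
  · by_cases h : u = v
    · subst h; simp
    · simp [h]
  · have : u ≠ v := fun h => hu (h ▸ hv)
    simp [this]
  · simp [hv, Pi.single_apply]

theorem simplex_mono {V : Type*} {σ τ : Finset V} (h : σ ⊆ τ) : simplex σ ⊆ simplex τ := by
  rintro x ⟨hx0, hxσ, hx1⟩
  exact ⟨hx0, fun v hv => hxσ v fun hv' => hv (h hv'),
    by rw [← hx1]; exact (Finset.sum_subset h fun v _ hv => hxσ v hv).symm⟩

theorem mem_realization_of_mem_simplex {V : Type*} {K : SComplex V} {σ : Finset V}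
    (hσ : σ ∈ K.faces) {x : V → ℝ} (hx : x ∈ simplex σ) : x ∈ K.realization :=
  ⟨σ, hσ, hx⟩

/-- Two maps into a simplicial complex which are contiguous, in the sense that the two images of
each point share a closed simplex, are homotopic. -/
theorem homotopic_of_contiguous {V X : Type*} [TopologicalSpace X] {K : SComplex V}
    (f g : C(X, K.space))
    (h : ∀ x, ∃ σ ∈ K.faces, (f x : V → ℝ) ∈ simplex σ ∧ (g x : V → ℝ) ∈ simplex σ) :
    f.Homotopic g := by
  refine ⟨⟨⟨fun p => ⟨(1 - (p.1 : ℝ)) • (f p.2 : V → ℝ) + (p.1 : ℝ) • (g p.2 : V → ℝ), ?_⟩, ?_⟩,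
    ?_, ?_⟩⟩
  · obtain ⟨σ, hσ, hf, hg⟩ := h p.2
    exact mem_realization_of_mem_simplex hσ (convex_simplex σ hf hg
      (by linarith [p.1.2.2]) p.1.2.1 (by ring))
  · fun_prop
  · intro x; simp
  · intro x; simp

/-- A labelling of the members of a cover by vertices such that the labels at each point span a
simplex is realized by a continuous map. -/
theorem exists_map_of_labelling {V X I : Type*} [TopologicalSpace X] [CompactSpace X] [T2Space X]
    (K : SComplex V) (A : I → Set X) (hA : ∀ i, IsOpen (A i)) (hcov : ∀ x, ∃ i, x ∈ A i)
    (v : I → V) (h : ∀ x, ∃ σ ∈ K.faces, ∀ i, x ∈ A i → v i ∈ σ) :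
    ∃ g : C(X, K.space), ∀ x (σ : Finset V), (∀ i, x ∈ A i → v i ∈ σ) →
      (g x : V → ℝ) ∈ simplex σ := by
  obtain ⟨φ, hφ⟩ := PartitionOfUnity.exists_isSubordinate isClosed_univ A hA
    (fun x _ => Set.mem_iUnion.2 (hcov x))
  have key : ∀ x (σ : Finset V), (∀ i, x ∈ A i → v i ∈ σ) →
      (∑ᶠ i, φ i x • (Pi.single (v i) (1 : ℝ) : V → ℝ)) ∈ simplex σ := fun x σ hσ =>
    φ.finsum_smul_mem_convex (g := fun i _ => (Pi.single (v i) (1 : ℝ) : V → ℝ))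
      (Set.mem_univ x)
      (fun i hi => single_mem_simplex (hσ i (hφ i (subset_tsupport _ hi)))) (convex_simplex σ)
  have hcont : Continuous fun x => ∑ᶠ i, φ i x • (Pi.single (v i) (1 : ℝ) : V → ℝ) :=
    φ.continuous_finsum_smul (g := fun i _ => (Pi.single (v i) (1 : ℝ) : V → ℝ))
      (fun i x _ => continuousAt_const)
  have hmem : ∀ x, ∑ᶠ i, φ i x • (Pi.single (v i) (1 : ℝ) : V → ℝ) ∈ K.realization := fun x => by
    obtain ⟨σ, hσ, hx⟩ := h x
    exact mem_realization_of_mem_simplex hσ (key x σ hx)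
  exact ⟨⟨fun x => ⟨_, hmem x⟩, hcont.subtype_mk hmem⟩, key⟩

/-- In an `r`-conic complex, all the simplices spanned by a given set of at most `r` vertices lie
in a common closed star. -/
theorem IsConic.exists_apex {V : Type*} {K : SComplex V} {r : ℤ} (hK : K.IsConic r)
    (S : Finset V) (hS : (S.card : ℤ) ≤ r) :
    ∃ u ∈ K.vertexSet, ∀ σ ∈ K.faces, σ ⊆ S → insert u σ ∈ K.faces := by
  let L : SComplex V :=
    { faces := {σ | σ ∈ K.faces ∧ σ ⊆ S}
      not_empty_mem := fun h => K.not_empty_mem h.1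
      down_closed := fun hs hts ht => ⟨K.down_closed hs.1 hts ht, hts.trans hs.2⟩ }
  have hL : L.vertexSet ⊆ (S : Set V) := fun v hv => by
    have : ({v} : Finset V) ⊆ S := hv.2
    simpa using this
  obtain ⟨u, hu, h⟩ := hK L (fun σ hσ => hσ.1) (S.finite_toSet.subset hL) (by
    have := Set.ncard_le_ncard hL S.finite_toSet
    rw [Set.ncard_coe_finset] at this
    exact le_trans (by exact_mod_cast this) hS)
  exact ⟨u, hu, fun σ hσ hσS => h σ ⟨hσ, hσS⟩⟩

/-- A function may be defined by a greedy choice along an enumeration. -/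
theorem exists_greedy {V J : Type*} (c : Finset V → V) (e : J → ℕ) (S : J → Finset V)
    (M : J → Finset J) :
    ∃ w : J → V, ∀ j, w j = c (S j ∪ ((M j).filter (fun i => e i < e j)).image w) := by
  let wf : WellFounded (fun i j : J => e i < e j) := (measure e).wf
  let F : ∀ j : J, (∀ i : J, e i < e j → V) → V := fun j w =>
    c (S j ∪ ((M j).filter (fun i => e i < e j)).attach.image
      (fun i => w i.1 (by simpa using (Finset.mem_filter.1 i.2).2)))
  refine ⟨wf.fix F, fun j => ?_⟩
  rw [wf.fix_eq F j]
  change c (S j ∪ _) = c (S j ∪ _)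
  congr 2
  ext y
  simp

/-- Given a labelled cover `(A, v)` and a second family `B` each of whose members meets few members
of `A` and `B`, one can label `B` so that at each point the labels of `A` and `B` jointly span a
simplex. -/
theorem IsConic.exists_labelling {V X I J : Type*} {K : SComplex V} {r : ℕ}
    (hK : K.IsConic r) [Countable J] (A : I → Set X) (B : J → Set X) (v : I → V)
    (hv : ∀ x, ∃ σ ∈ K.faces, (σ : Set V) = v '' {i | x ∈ A i})
    (N : J → Finset I) (hN : ∀ j i x, x ∈ B j → x ∈ A i → i ∈ N j)
    (M : J → Finset J) (hM : ∀ j i x, x ∈ B j → x ∈ B i → i ≠ j → i ∈ M j)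
    (hfin : ∀ x, {j | x ∈ B j}.Finite)
    (hcard : ∀ j, (N j).card + (M j).card ≤ r) :
    ∃ w : J → V, ∀ x, ∃ σ ∈ K.faces,
      (σ : Set V) = v '' {i | x ∈ A i} ∪ w '' {j | x ∈ B j} := by
  obtain ⟨e, he⟩ := exists_injective_nat J
  have hapex : ∀ S : Finset V, ∃ u, S.card ≤ r →
      ∀ σ ∈ K.faces, σ ⊆ S → insert u σ ∈ K.faces := by
    intro S
    by_cases hS : S.card ≤ r
    · obtain ⟨u, -, hu⟩ := hK.exists_apex S (by exact_mod_cast hS)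
      exact ⟨u, fun _ => hu⟩
    · obtain ⟨u, -, -⟩ := hK.exists_apex ∅ (by simp)
      exact ⟨u, fun h => absurd h hS⟩
  choose c hc using hapex
  obtain ⟨w, hw⟩ := exists_greedy c e (fun j => (N j).image v) M
  refine ⟨w, fun x => ?_⟩
  suffices H : ∀ F : Finset J, (∀ j ∈ F, x ∈ B j) →
      ∃ σ ∈ K.faces, (σ : Set V) = v '' {i | x ∈ A i} ∪ w '' (F : Set J) by
    have := H (hfin x).toFinset (by simp)
    simpa using this
  intro F
  induction F using Finset.induction_on_max_value e with
  | empty => simpa using hv x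
  | insert j F hj hmax ih =>
    intro hF
    obtain ⟨σ, hσ, hσe⟩ := ih fun i hi => hF i (Finset.mem_insert_of_mem hi)
    have hxj : x ∈ B j := hF j (Finset.mem_insert_self _ _)
    refine ⟨insert (w j) σ, ?_, ?_⟩
    · rw [hw j]
      refine hc _ ?_ σ hσ ?_
      · refine (Finset.card_union_le _ _).trans ((add_le_add Finset.card_image_le
          (Finset.card_image_le.trans (Finset.card_filter_le _ _))).trans (hcard j))
      · rw [← Finset.coe_subset, hσe]
        rintro y (⟨i, hi, rfl⟩ | ⟨i, hi, rfl⟩)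
        · simp only [Finset.coe_union, Set.mem_union, Finset.mem_coe]
          exact Or.inl (Finset.mem_image_of_mem _ (hN j i x hxj hi))
        · have hij : i ≠ j := fun h => hj (h ▸ hi)
          simp only [Finset.coe_union, Set.mem_union, Finset.mem_coe]
          refine Or.inr (Finset.mem_image_of_mem _ (Finset.mem_filter.2
            ⟨hM j i x hxj (hF i (Finset.mem_insert_of_mem hi)) hij, ?_⟩))
          exact lt_of_le_of_ne (hmax i hi) fun h => hij (he h)
    · rw [Finset.coe_insert, hσe, Finset.coe_insert, Set.image_insert_eq, Set.union_insert]

/-- Any nonempty subset of a face is a face. -/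
theorem exists_face_coe_eq {V : Type*} {K : SComplex V} {σ : Finset V} (hσ : σ ∈ K.faces)
    {S : Set V} (hS : S ⊆ σ) (hne : S.Nonempty) : ∃ τ ∈ K.faces, (τ : Set V) = S := by
  have hfin : S.Finite := σ.finite_toSet.subset hS
  refine ⟨hfin.toFinset, K.down_closed hσ ?_ ?_, hfin.coe_toFinset⟩
  · intro y hy
    exact hS (hfin.mem_toFinset.1 hy)
  · simpa using hne

/-- `f` is homotopic to a map carried by some labelling of the members of `A` by vertices. -/
def IsApproximable {V X I : Type*} [TopologicalSpace X] {K : SComplex V} (f : C(X, K.space))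
    (A : I → Set X) : Prop :=
  ∃ (v : I → V) (g : C(X, K.space)), f.Homotopic g ∧
    ∀ x, ∃ σ ∈ K.faces, (σ : Set V) = v '' {i | x ∈ A i} ∧ (g x : V → ℝ) ∈ simplex σ

/-- A map homotopic to `f` all of whose values share simplices with the labels of `A` witnesses
that `f` is approximable on `A`. -/
theorem isApproximable_of_labelling {V X I : Type*} [TopologicalSpace X] [CompactSpace X]
    [T2Space X] {K : SComplex V} {f g : C(X, K.space)} (hfg : f.Homotopic g) {A : I → Set X}
    (hA : ∀ i, IsOpen (A i)) (hcov : ∀ x, ∃ i, x ∈ A i) (v : I → V)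
    (h : ∀ x, ∃ σ ∈ K.faces, v '' {i | x ∈ A i} ⊆ σ ∧ (g x : V → ℝ) ∈ simplex σ) :
    IsApproximable f A := by
  obtain ⟨g', hg'⟩ := exists_map_of_labelling K A hA hcov v fun x =>
    (h x).imp fun σ hσ => ⟨hσ.1, fun i hi => hσ.2.1 (Set.mem_image_of_mem v hi)⟩
  refine ⟨v, g', hfg.trans (homotopic_of_contiguous g g' fun x => ?_), fun x => ?_⟩
  · obtain ⟨σ, hσ, hvσ, hgσ⟩ := h x
    exact ⟨σ, hσ, hgσ, hg' x σ fun i hi => hvσ (Set.mem_image_of_mem v hi)⟩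
  · obtain ⟨σ, hσ, hvσ, -⟩ := h x
    obtain ⟨i, hi⟩ := hcov x
    obtain ⟨τ, hτ, hτe⟩ := exists_face_coe_eq hσ hvσ ⟨_, Set.mem_image_of_mem v hi⟩
    refine ⟨τ, hτ, hτe, hg' x τ fun i hi => ?_⟩
    rw [← Finset.mem_coe, hτe]
    exact Set.mem_image_of_mem v hi

/-- The family consisting of `C` and of the parts of `D` lying, in the coordinates `Q`, in the open
cubes of radius `s / 3` centred at the points of the lattice of mesh `s / 2`. -/
def gridCover {X : Type*} {k : ℕ} (C D : Set X) (Q : X → Fin k → ℝ) (s : ℝ) :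
    Option (Fin k → ℤ) → Set X
  | none => C
  | some m => {x | x ∈ D ∧ ∀ i, |Q x i - s * m i / 2| < s / 3}

theorem isOpen_gridCover {X : Type*} [TopologicalSpace X] {k : ℕ} {C D : Set X}
    {Q : X → Fin k → ℝ} (hC : IsOpen C) (hD : IsOpen D) (hQ : ContinuousOn Q D) (s : ℝ)
    (o : Option (Fin k → ℤ)) : IsOpen (gridCover C D Q s o) := by
  cases o with
  | none => exact hC
  | some m =>
    have hU : IsOpen {y : Fin k → ℝ | ∀ i, |y i - s * m i / 2| < s / 3} := by
      simp only [Set.ofPred_forall]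
      exact isOpen_iInter_of_finite fun i => isOpen_lt (by fun_prop) continuous_const
    exact hQ.isOpen_inter_preimage hD hU

theorem exists_mem_gridCover {X : Type*} {k : ℕ} {C D : Set X} (hCD : ∀ x, x ∉ C → x ∈ D)
    (Q : X → Fin k → ℝ) {s : ℝ} (hs : 0 < s) (x : X) : ∃ o, x ∈ gridCover C D Q s o := by
  by_cases hx : x ∈ C
  · exact ⟨none, hx⟩
  · refine ⟨some fun i => round (2 * Q x i / s), hCD x hx, fun i => ?_⟩
    have h := abs_sub_round (2 * Q x i / s)
    have e : Q x i - s * (round (2 * Q x i / s) : ℤ) / 2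
        = s / 2 * (2 * Q x i / s - (round (2 * Q x i / s) : ℤ)) := by
      field_simp
    rw [e, abs_mul, abs_of_pos (half_pos hs)]
    nlinarith

/-- The lattice points at sup-distance at most one from a given one. -/
noncomputable def latticeBox {k : ℕ} (m : Fin k → ℤ) : Finset (Fin k → ℤ) :=
  Fintype.piFinset fun i => Finset.Icc (m i - 1) (m i + 1)

theorem card_latticeBox {k : ℕ} (m : Fin k → ℤ) : (latticeBox m).card = 3 ^ k := by
  have h : ∀ a : ℤ, a + 1 + 1 - (a - 1) = 3 := fun a => by ring
  simp [latticeBox, Fintype.card_piFinset, h]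

theorem mem_latticeBox_of_gridCover {X : Type*} {k : ℕ} {C D : Set X} {Q : X → Fin k → ℝ} {s : ℝ}
    {x : X} {m m' : Fin k → ℤ} (h : x ∈ gridCover C D Q s (some m))
    (h' : x ∈ gridCover C D Q s (some m')) : m' ∈ latticeBox m := by
  refine Fintype.mem_piFinset.2 fun i => Finset.mem_Icc.2 ?_
  obtain ⟨h1, h2⟩ := abs_lt.1 (h.2 i)
  obtain ⟨h3, h4⟩ := abs_lt.1 (h'.2 i)
  have hs : 0 < s := by linarith
  have h5 : (m i : ℝ) < m' i + 2 := by nlinarith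
  have h6 : (m' i : ℝ) < m i + 2 := by nlinarith
  have h5' : m i < m' i + 2 := by exact_mod_cast h5
  have h6' : m' i < m i + 2 := by exact_mod_cast h6
  omega

theorem mem_latticeBox_of_gridCover_double {X : Type*} {k : ℕ} {C D : Set X} {Q : X → Fin k → ℝ}
    {s : ℝ} {x : X} {m m' : Fin k → ℤ} (h : x ∈ gridCover C D Q (2 * s) (some m))
    (h' : x ∈ gridCover C D Q s (some m')) : m' ∈ latticeBox (2 * m) := by
  refine Fintype.mem_piFinset.2 fun i => Finset.mem_Icc.2 ?_
  obtain ⟨h1, h2⟩ := abs_lt.1 (h.2 i)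
  obtain ⟨h3, h4⟩ := abs_lt.1 (h'.2 i)
  have hs : 0 < s := by linarith
  have h5 : (2 * m i : ℝ) < m' i + 2 := by nlinarith
  have h6 : (m' i : ℝ) < 2 * m i + 2 := by nlinarith
  have h5' : 2 * m i < m' i + 2 := by exact_mod_cast h5
  have h6' : m' i < 2 * m i + 2 := by exact_mod_cast h6
  have e : (2 * m) i = 2 * m i := rfl
  rw [e]
  omega

/-- Approximability passes from a grid to the grid of twice the mesh. -/
theorem IsApproximable.gridCover_double {V X : Type*} [TopologicalSpace X] [CompactSpace X]
    [T2Space X] {K : SComplex V} {k r : ℕ} (hr : 2 * 3 ^ k ≤ r) (hK : K.IsConic r)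
    {f : C(X, K.space)} {C D : Set X} (hC : IsOpen C) (hD : IsOpen D)
    (hCD : ∀ x, x ∉ C → x ∈ D) {Q : X → Fin k → ℝ} (hQ : ContinuousOn Q D) {s : ℝ} (hs : 0 < s)
    (hf : IsApproximable f (gridCover C D Q s)) :
    IsApproximable f (gridCover C D Q (2 * s)) := by
  obtain ⟨v, g, hfg, hg⟩ := hf
  obtain ⟨w, hw⟩ := hK.exists_labelling (gridCover C D Q s)
    (fun m => gridCover C D Q (2 * s) (some m)) v
    (fun x => (hg x).imp fun σ hσ => ⟨hσ.1, hσ.2.1⟩)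
    (fun m => insert none ((latticeBox (2 * m)).image some))
    (fun m o x hm ho => by
      cases o with
      | none => simp
      | some m' => simpa using mem_latticeBox_of_gridCover_double hm ho)
    (fun m => (latticeBox m).erase m)
    (fun m m' x hm hm' hne => Finset.mem_erase.2 ⟨hne, mem_latticeBox_of_gridCover hm hm'⟩)
    (fun x => by
      by_cases h : ∃ m, x ∈ gridCover C D Q (2 * s) (some m)
      · obtain ⟨m, hm⟩ := h
        exact (latticeBox m).finite_toSet.subset fun m' hm' => mem_latticeBox_of_gridCover hm hm'
      · push Not at h
        convert Set.finite_empty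
        ext m
        simpa using h m)
    (fun m => by
      have hm : m ∈ latticeBox m := Fintype.mem_piFinset.2 fun i => by simp
      have h1 := Finset.card_insert_le (none : Option (Fin k → ℤ)) ((latticeBox (2 * m)).image some)
      have h2 := Finset.card_image_le (s := latticeBox (2 * m)) (f := some)
      have h3 := Finset.card_erase_add_one hm
      rw [card_latticeBox] at h2 h3
      omega)
  refine isApproximable_of_labelling hfg (isOpen_gridCover hC hD hQ _)
    (exists_mem_gridCover hCD Q (by linarith)) (fun o => o.elim (v none) w) fun x => ?_
  obtain ⟨σ, hσ, hσe⟩ := hw x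
  obtain ⟨τ, hτ, hτe, hgτ⟩ := hg x
  refine ⟨σ, hσ, ?_, simplex_mono ?_ hgτ⟩
  · rw [hσe]
    rintro _ ⟨o, ho, rfl⟩
    cases o with
    | none => exact Or.inl ⟨none, ho, rfl⟩
    | some m => exact Or.inr ⟨m, ho, rfl⟩
  · rw [← Finset.coe_subset, hτe, hσe]
    exact Set.subset_union_left

/-- A map approximable on a family with few nonempty members is null-homotopic. -/
theorem IsApproximable.nullhomotopic {V X I : Type*} [TopologicalSpace X] {K : SComplex V} {r : ℕ}
    (hK : K.IsConic r) {f : C(X, K.space)} {A : I → Set X} (hf : IsApproximable f A)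
    (N : Finset I) (hN : ∀ i x, x ∈ A i → i ∈ N) (hr : N.card ≤ r) : f.Nullhomotopic := by
  obtain ⟨v, g, hfg, hg⟩ := hf
  obtain ⟨u, hu, hstar⟩ := hK.exists_apex (N.image v)
    (by exact_mod_cast Finset.card_image_le.trans hr)
  refine ⟨⟨Pi.single u 1, mem_realization_of_mem_simplex hu
    (single_mem_simplex (Finset.mem_singleton_self u))⟩,
    hfg.trans (homotopic_of_contiguous _ _ fun x => ?_)⟩
  obtain ⟨σ, hσ, hσe, hgσ⟩ := hg x
  refine ⟨insert u σ, hstar σ hσ ?_, simplex_mono (Finset.subset_insert _ _) hgσ,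
    single_mem_simplex (Finset.mem_insert_self _ _)⟩
  rw [← Finset.coe_subset, hσe]
  rintro _ ⟨i, hi, rfl⟩
  exact Finset.mem_coe.2 (Finset.mem_image_of_mem v (hN i x hi))

theorem exists_pos_of_mem_realization {V : Type*} {K : SComplex V} {x : V → ℝ}
    (hx : x ∈ K.realization) : ∃ v, 0 < x v := by
  obtain ⟨σ, -, -, -, h1⟩ := hx
  obtain ⟨v, -, hv⟩ := Finset.exists_lt_of_sum_lt (s := σ) (f := fun _ => (0 : ℝ)) (g := x)
    (by simp [h1])
  exact ⟨v, hv⟩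

theorem isOpen_pos_coord {V X : Type*} [TopologicalSpace X] {K : SComplex V} {F : X → K.space}
    (hF : Continuous F) (v : V) : IsOpen {x | 0 < (F x : V → ℝ) v} :=
  isOpen_lt continuous_const ((continuous_apply v).comp (continuous_subtype_val.comp hF))

/-- A map on a compact space is approximable on all sufficiently fine grids. -/
theorem exists_isApproximable_gridCover {V X : Type*} [TopologicalSpace X] [CompactSpace X]
    [T2Space X] {K : SComplex V} {k : ℕ} (f : C(X, K.space)) {C D : Set X} (hC : IsOpen C)
    (hD : IsOpen D) (hCD : ∀ x, x ∉ C → x ∈ D) {Q : X → Fin k → ℝ}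
    (hQ : ContinuousOn Q (closure D)) {R : (Fin k → ℝ) → X} (hR : Continuous R)
    (hRQ : ∀ x ∈ D, R (Q x) = x) {v₀ : V} (hv₀ : ∀ x ∈ C, 0 < (f x : V → ℝ) v₀) :
    ∃ s > 0, IsApproximable f (gridCover C D Q s) := by
  obtain ⟨δ, hδ, hball⟩ := lebesgue_number_lemma_of_metric
    (isClosed_closure.isCompact.image_of_continuousOn hQ)
    (fun v => isOpen_pos_coord (f.continuous.comp hR) v)
    (fun y _ => Set.mem_iUnion.2 (exists_pos_of_mem_realization (f (R y)).2))
  have hlabel : ∀ o, ∃ u, ∀ x ∈ gridCover C D Q δ o, 0 < (f x : V → ℝ) u := by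
    intro o
    cases o with
    | none => exact ⟨v₀, hv₀⟩
    | some m =>
      by_cases hm : (gridCover C D Q δ (some m)).Nonempty
      · obtain ⟨x₀, hx₀⟩ := hm
        obtain ⟨u, hu⟩ := hball (Q x₀) ⟨x₀, subset_closure hx₀.1, rfl⟩
        refine ⟨u, fun x hx => ?_⟩
        have hmem : Q x ∈ Metric.ball (Q x₀) δ := by
          rw [Metric.mem_ball, dist_pi_lt_iff hδ]
          intro i
          have h1 := abs_lt.1 (hx.2 i)
          have h2 := abs_lt.1 (hx₀.2 i)
          rw [Real.dist_eq, abs_lt]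
          constructor <;> linarith [h1.1, h1.2, h2.1, h2.2]
        have := hu hmem
        simpa [hRQ x hx.1] using this
      · exact ⟨v₀, fun x hx => absurd ⟨x, hx⟩ hm⟩
  choose v hv using hlabel
  refine ⟨δ, hδ, isApproximable_of_labelling (.refl f)
    (isOpen_gridCover hC hD (hQ.mono subset_closure) δ) (exists_mem_gridCover hCD Q hδ) v
    fun x => ?_⟩
  obtain ⟨σ, hσ, hx⟩ := (f x).2
  refine ⟨σ, hσ, ?_, hx⟩
  rintro _ ⟨o, ho, rfl⟩
  by_contra hvσ
  exact (hv o x ho).ne' (hx.2.1 _ hvσ)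

/-- If the complement of a point of a compact space `X` embeds in `ℝᵏ` with a globally defined
inverse, then maps from `X` to sufficiently conic complexes are null-homotopic. -/
theorem IsConic.nullhomotopic_of_chart {V X : Type*} [TopologicalSpace X] [CompactSpace X]
    [T2Space X] {K : SComplex V} {k r : ℕ} (hr : 2 * 3 ^ k ≤ r) (hK : K.IsConic r) (p : X)
    {Q : X → Fin k → ℝ} (hQ : ContinuousOn Q {p}ᶜ) {R : (Fin k → ℝ) → X} (hR : Continuous R)
    (hRQ : ∀ x, x ≠ p → R (Q x) = x) (f : C(X, K.space)) : f.Nullhomotopic := by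
  obtain ⟨v₀, hv₀⟩ := exists_pos_of_mem_realization (f p).2
  let C : Set X := {x | 0 < (f x : V → ℝ) v₀}
  have hC : IsOpen C := isOpen_pos_coord f.continuous v₀
  obtain ⟨D, hD, hCD, hDp⟩ := normal_exists_closure_subset (s := Cᶜ) (t := {p}ᶜ)
    hC.isClosed_compl isOpen_compl_singleton
    (Set.compl_subset_compl.2 (Set.singleton_subset_iff.2 hv₀))
  have hQD : ContinuousOn Q (closure D) := hQ.mono hDp
  obtain ⟨s₀, hs₀, happ⟩ := exists_isApproximable_gridCover f hC hD (fun x hx => hCD hx) hQD hR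
    (fun x hx => hRQ x (hDp (subset_closure hx))) (v₀ := v₀) fun x hx => hx
  obtain ⟨ρ, hρ⟩ := (isClosed_closure.isCompact.image_of_continuousOn hQD).isBounded.exists_norm_le
  have happ' : ∀ j : ℕ, IsApproximable f (gridCover C D Q (2 ^ j * s₀)) := by
    intro j
    induction j with
    | zero => simpa using happ
    | succ j ih =>
      rw [pow_succ', mul_assoc]
      exact ih.gridCover_double hr hK hC hD (fun x hx => hCD hx) (hQD.mono subset_closure)
        (by positivity)
  obtain ⟨j, hj⟩ := pow_unbounded_of_one_lt (6 * ρ / s₀) (one_lt_two : (1 : ℝ) < 2)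
  rw [div_lt_iff₀ hs₀] at hj
  refine (happ' j).nullhomotopic hK {none, some 0} (fun o x hx => ?_) ?_
  · cases o with
    | none => simp
    | some m =>
      suffices m = 0 by simp [this]
      funext i
      have h1 := abs_lt.1 (hx.2 i)
      have h2 := abs_le.1 ((norm_le_pi_norm (Q x) i).trans
        (hρ _ ⟨x, subset_closure hx.1, rfl⟩))
      generalize 2 ^ j * s₀ = s at hj h1
      have hs : 0 < s := by linarith [h1.1, h1.2]
      have h3 : (m i : ℝ) < 1 := by nlinarith [h1.1, h1.2, h2.1, h2.2]
      have h4 : (-1 : ℝ) < m i := by nlinarith [h1.1, h1.2, h2.1, h2.2]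
      have h3' : m i < 1 := by exact_mod_cast h3
      have h4' : -1 < m i := by exact_mod_cast h4
      simp only [Pi.zero_apply]
      omega
  · have : 0 < 3 ^ k := by positivity
    exact Finset.card_le_two.trans (by omega)

/-- Maps from the `k`-sphere to sufficiently conic complexes are null-homotopic. -/
theorem IsConic.nullhomotopic_of_sphere {V : Type*} {K : SComplex V} {k r : ℕ}
    (hr : 2 * 3 ^ k ≤ r) (hK : K.IsConic r)
    (f : C(Metric.sphere (0 : EuclideanSpace ℝ (Fin (k + 1))) 1, K.space)) :
    f.Nullhomotopic := by
  have : Fact (Module.finrank ℝ (EuclideanSpace ℝ (Fin (k + 1))) = k + 1) :=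
    ⟨finrank_euclideanSpace_fin⟩
  let p : Metric.sphere (0 : EuclideanSpace ℝ (Fin (k + 1))) 1 :=
    ⟨EuclideanSpace.single 0 1, by simp⟩
  let T := stereographic' k p
  let E := EuclideanSpace.equiv (Fin k) ℝ
  have hT : ContinuousOn T {p}ᶜ := by
    simpa [T] using T.continuousOn
  have hTs : Continuous T.symm := by
    have h := T.continuousOn_symm
    simp only [T, stereographic'_target] at h
    exact continuousOn_univ.1 h
  refine hK.nullhomotopic_of_chart hr p (Q := fun x => E (T x)) (E.continuous.comp_continuousOn hT)
    (R := fun y => T.symm (E.symm y)) (hTs.comp E.symm.continuous) (fun x hx => ?_) f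
  rw [E.symm_apply_apply]
  exact T.left_inv (by simpa [T] using hx)

end SComplex

/-- For every integer `n ≥ 1`, every `6^n`-conic simplicial complex is
`n`-connected. -/
theorem conic_implies_nconnected {V : Type*} (n : ℕ) (hn : 1 ≤ n)
    (K : SComplex V) (hK : K.IsConic ((6 : ℤ) ^ n)) :
    NConnected n K.space := by
  have hK' : K.IsConic ((6 ^ n : ℕ) : ℤ) := by exact_mod_cast hK
  refine ⟨?_, fun k hk f => hK'.nullhomotopic_of_sphere ?_ f⟩
  · obtain ⟨u, hu, -⟩ := hK'.exists_apex ∅ (by simp)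
    exact ⟨⟨Pi.single u 1, SComplex.mem_realization_of_mem_simplex hu
      (SComplex.single_mem_simplex (Finset.mem_singleton_self u))⟩⟩
  · calc 2 * 3 ^ k ≤ 2 ^ n * 3 ^ n := Nat.mul_le_mul (Nat.le_self_pow (by omega) 2)
          (Nat.pow_le_pow_right (by norm_num) hk)
      _ = 6 ^ n := by rw [← Nat.mul_pow]
end

section
/- Every 8-conic simplicial complex is 2-connected. -/
open Finset
open scoped Classical

namespace SComplex

variable {V : Type*} {K : SComplex V}

/-- The closed star of a set of vertices: points carried by a face containing the set. -/
def InStar (K : SComplex V) (S : Set V) (a : V → ℝ) : Prop :=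
  ∃ σ ∈ K.faces, S ⊆ σ ∧ ∀ v ∉ σ, a v = 0

/-- The total mass shared by two points of a realization. -/
noncomputable def overlap (a b : V → ℝ) : ℝ := ∑ᶠ v, min (a v) (b v)

/-- A path from `a` (at `s = 0`) to `b` (at `s = 1`) which fixes the common part of `a` and `b`
and passes through `c` with the remaining mass. -/
noncomputable def blend (a b c : V → ℝ) (s : ℝ) : V → ℝ := fun v =>
  min (a v) (b v) + (a v - min (a v) (b v)) * max 0 (1 - 2 * s)
    + (b v - min (a v) (b v)) * max 0 (2 * s - 1)
    + (1 - |1 - 2 * s|) * ((1 - overlap a b) * c v)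

theorem realization_nonneg {a : V → ℝ} (ha : a ∈ K.realization) (v : V) : 0 ≤ a v := by
  obtain ⟨σ, -, h, -⟩ := ha
  exact h v

theorem sum_eq_one_of_mem {a : V → ℝ} (ha : a ∈ K.realization) {σ : Finset V}
    (hσ : ∀ v ∉ σ, a v = 0) : ∑ v ∈ σ, a v = 1 := by
  obtain ⟨τ, -, -, h0, h1⟩ := ha
  have e1 : ∑ v ∈ σ, a v = ∑ v ∈ σ ∪ τ, a v :=
    Finset.sum_subset subset_union_left fun v _ hv => hσ v hv
  have e2 : ∑ v ∈ τ, a v = ∑ v ∈ σ ∪ τ, a v :=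
    Finset.sum_subset subset_union_right fun v _ hv => h0 v hv
  rw [e1, ← e2, h1]

theorem mem_realization_of_carrier {a : V → ℝ} {σ : Finset V} (hσ : σ ∈ K.faces)
    (h0 : ∀ v, 0 ≤ a v) (h : ∀ v ∉ σ, a v = 0) (h1 : ∑ v ∈ σ, a v = 1) : a ∈ K.realization :=
  ⟨σ, hσ, h0, h, h1⟩

theorem overlap_eq_sum {a b : V → ℝ} (ha : a ∈ K.realization) (hb : b ∈ K.realization)
    {σ : Finset V} (hσ : ∀ v ∉ σ, a v = 0 ∨ b v = 0) :
    overlap a b = ∑ v ∈ σ, min (a v) (b v) := by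
  refine finsum_eq_sum_of_support_subset _ fun v hv => ?_
  by_contra hvσ
  refine hv ?_
  have h1 := realization_nonneg ha v
  have h2 := realization_nonneg hb v
  rcases hσ v hvσ with h | h <;> simp [h, h1, h2]

theorem overlap_self {a : V → ℝ} (ha : a ∈ K.realization) : overlap a a = 1 := by
  obtain ⟨σ, -, -, h0, h1⟩ := id ha
  rw [overlap_eq_sum ha ha (σ := σ) fun v hv => Or.inl (h0 v hv)]
  simpa using h1

theorem overlap_le_one {a b : V → ℝ} (ha : a ∈ K.realization) (hb : b ∈ K.realization) :
    overlap a b ≤ 1 := by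
  obtain ⟨σ, -, -, h0, h1⟩ := id ha
  rw [overlap_eq_sum ha hb (σ := σ) fun v hv => Or.inl (h0 v hv), ← h1]
  exact Finset.sum_le_sum fun v _ => min_le_left _ _

theorem continuous_overlap :
    Continuous fun z : K.space × K.space => overlap (z.1 : V → ℝ) (z.2 : V → ℝ) := by
  rw [continuous_iff_continuousAt]
  rintro ⟨a, b⟩
  obtain ⟨σ, hσ, -, h0, h1⟩ := id a.2
  have c1 : ∀ v, Continuous fun z : K.space × K.space => (z.1 : V → ℝ) v := fun v =>
    (continuous_apply v).comp (continuous_subtype_val.comp continuous_fst)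
  have c2 : ∀ v, Continuous fun z : K.space × K.space => (z.2 : V → ℝ) v := fun v =>
    (continuous_apply v).comp (continuous_subtype_val.comp continuous_snd)
  have cmin : Continuous fun z : K.space × K.space =>
      ∑ v ∈ σ, min ((z.1 : V → ℝ) v) ((z.2 : V → ℝ) v) :=
    continuous_finsetSum _ fun v _ => Continuous.min (c1 v) (c2 v)
  have csum : Continuous fun z : K.space × K.space => ∑ v ∈ σ, ((z.1 : V → ℝ) v) :=
    continuous_finsetSum _ fun v _ => c1 v
  have e0 : overlap (a : V → ℝ) (b : V → ℝ)
      = ∑ v ∈ σ, min ((a : V → ℝ) v) ((b : V → ℝ) v) :=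
    overlap_eq_sum a.2 b.2 fun v hv => Or.inl (h0 v hv)
  have key : ∀ z : K.space × K.space,
      ∑ v ∈ σ, min ((z.1 : V → ℝ) v) ((z.2 : V → ℝ) v) ≤ overlap (z.1 : V → ℝ) (z.2 : V → ℝ) ∧
      overlap (z.1 : V → ℝ) (z.2 : V → ℝ) ≤
        ∑ v ∈ σ, min ((z.1 : V → ℝ) v) ((z.2 : V → ℝ) v) + (1 - ∑ v ∈ σ, ((z.1 : V → ℝ) v)) := by
    rintro ⟨p, q⟩
    obtain ⟨τ, -, -, k0, -⟩ := id p.2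
    have k1 : ∑ v ∈ σ ∪ τ, ((p : V → ℝ) v) = 1 :=
      sum_eq_one_of_mem p.2 fun v hv => k0 v fun h => hv (mem_union_right _ h)
    rw [overlap_eq_sum p.2 q.2 (σ := σ ∪ τ)
      fun v hv => Or.inl (k0 v fun h => hv (mem_union_right _ h)), ← k1,
      ← Finset.sum_sdiff (subset_union_left : σ ⊆ σ ∪ τ),
      ← Finset.sum_sdiff (subset_union_left : σ ⊆ σ ∪ τ)]
    have p1 : 0 ≤ ∑ v ∈ (σ ∪ τ) \ σ, min ((p : V → ℝ) v) ((q : V → ℝ) v) :=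
      Finset.sum_nonneg fun v _ => le_min (realization_nonneg p.2 v) (realization_nonneg q.2 v)
    have p2 : ∑ v ∈ (σ ∪ τ) \ σ, min ((p : V → ℝ) v) ((q : V → ℝ) v)
        ≤ ∑ v ∈ (σ ∪ τ) \ σ, (p : V → ℝ) v := Finset.sum_le_sum fun v _ => min_le_left _ _
    constructor <;> linarith
  refine tendsto_of_tendsto_of_tendsto_of_le_of_le
    (g := fun z : K.space × K.space => ∑ v ∈ σ, min ((z.1 : V → ℝ) v) ((z.2 : V → ℝ) v))
    (h := fun z : K.space × K.space => ∑ v ∈ σ, min ((z.1 : V → ℝ) v) ((z.2 : V → ℝ) v)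
      + (1 - ∑ v ∈ σ, ((z.1 : V → ℝ) v))) ?_ ?_ (fun z => (key z).1) (fun z => (key z).2)
  · simpa [e0] using cmin.tendsto (a, b)
  · have := (cmin.add (continuous_const.sub csum)).tendsto (a, b) (f := fun z =>
      ∑ v ∈ σ, min ((z.1 : V → ℝ) v) ((z.2 : V → ℝ) v) + (1 - ∑ v ∈ σ, ((z.1 : V → ℝ) v)))
    simpa [e0, h1] using this

theorem blend_zero (a b c : V → ℝ) : blend a b c 0 = a := by
  ext v; simp [blend]

theorem blend_one (a b c : V → ℝ) : blend a b c 1 = b := by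
  ext v; norm_num [blend]

theorem blend_self {a : V → ℝ} (ha : a ∈ K.realization) (c : V → ℝ) (s : ℝ) :
    blend a a c s = a := by
  ext v; simp [blend, overlap_self ha]

theorem blend_apply_eq_zero {a b c : V → ℝ} {s : ℝ} {v : V} (ha : a v = 0 ∨ 1 / 2 ≤ s)
    (hb : b v = 0 ∨ s ≤ 1 / 2) (hc : c v = 0) (hab : a v = 0 ∨ b v = 0)
    (a0 : 0 ≤ a v) (b0 : 0 ≤ b v) : blend a b c s v = 0 := by
  have hm : min (a v) (b v) = 0 := by rcases hab with h | h <;> simp [h, a0, b0]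
  have h1 : a v * max 0 (1 - 2 * s) = 0 := by
    rcases ha with h | h
    · simp [h]
    · rw [max_eq_left (by linarith), mul_zero]
  have h2 : b v * max 0 (2 * s - 1) = 0 := by
    rcases hb with h | h
    · simp [h]
    · rw [max_eq_left (by linarith), mul_zero]
  simp [blend, hm, h1, h2, hc]

theorem blend_nonneg {a b c : V → ℝ} (ha : a ∈ K.realization) (hb : b ∈ K.realization)
    (hc : c ∈ K.realization) {s : ℝ} (hs : s ∈ Set.Icc (0 : ℝ) 1) (v : V) :
    0 ≤ blend a b c s v := by
  have h1 := sub_nonneg.2 (overlap_le_one ha hb)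
  have h2 : 0 ≤ 1 - |1 - 2 * s| := by
    rw [sub_nonneg, abs_le]; constructor <;> linarith [hs.1, hs.2]
  have h3 : 0 ≤ min (a v) (b v) := le_min (realization_nonneg ha v) (realization_nonneg hb v)
  have h4 := sub_nonneg.2 (min_le_left (a v) (b v))
  have h5 := sub_nonneg.2 (min_le_right (a v) (b v))
  have h6 := realization_nonneg hc v
  unfold blend
  positivity

theorem sum_blend {a b c : V → ℝ} {σ : Finset V} {s : ℝ} (ho : overlap a b = ∑ v ∈ σ, min (a v) (b v))
    (ha : ∑ v ∈ σ, a v = 1 ∨ 1 / 2 ≤ s) (hb : ∑ v ∈ σ, b v = 1 ∨ s ≤ 1 / 2)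
    (hc : ∑ v ∈ σ, c v = 1) : ∑ v ∈ σ, blend a b c s v = 1 := by
  simp only [blend, Finset.sum_add_distrib, ← Finset.mul_sum, ← Finset.sum_mul,
    Finset.sum_sub_distrib, ← ho, hc]
  rcases le_total s (1 / 2) with h | h
  · rw [max_eq_right (by linarith : (0 : ℝ) ≤ 1 - 2 * s),
      max_eq_left (by linarith : 2 * s - 1 ≤ (0 : ℝ)), abs_of_nonneg (by linarith)]
    rcases ha with ha | ha
    · rw [ha]; ring
    · have : s = 1 / 2 := le_antisymm h ha
      subst this; ring
  · rw [max_eq_left (by linarith : 1 - 2 * s ≤ (0 : ℝ)),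
      max_eq_right (by linarith : (0 : ℝ) ≤ 2 * s - 1), abs_of_nonpos (by linarith)]
    rcases hb with hb | hb
    · rw [hb]; ring
    · have : s = 1 / 2 := le_antisymm hb h
      subst this; ring

theorem blend_carrier {a b c : V → ℝ} (ha : a ∈ K.realization) (hb : b ∈ K.realization)
    {S : Set V} (hcS : Function.support c ⊆ S) (hsa : K.InStar S a) (hsb : K.InStar S b)
    (s : ℝ) : ∃ σ ∈ K.faces, S ⊆ σ ∧ (∀ v ∉ σ, blend a b c s v = 0) ∧
      ((∀ v ∉ σ, a v = 0) ∧ s ≤ 1 / 2 ∨ (∀ v ∉ σ, b v = 0) ∧ 1 / 2 ≤ s) := by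
  have hc : ∀ {σ : Finset V}, S ⊆ σ → ∀ v ∉ σ, c v = 0 := fun hσ v hv => by
    by_contra h
    exact hv (hσ (hcS h))
  rcases le_total s (1 / 2) with h | h
  · obtain ⟨σ, hσ, hS, h0⟩ := hsa
    exact ⟨σ, hσ, hS, fun v hv => blend_apply_eq_zero (Or.inl (h0 v hv)) (Or.inr h) (hc hS v hv)
      (Or.inl (h0 v hv)) (realization_nonneg ha v) (realization_nonneg hb v), Or.inl ⟨h0, h⟩⟩
  · obtain ⟨σ, hσ, hS, h0⟩ := hsb
    exact ⟨σ, hσ, hS, fun v hv => blend_apply_eq_zero (Or.inr h) (Or.inl (h0 v hv)) (hc hS v hv)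
      (Or.inr (h0 v hv)) (realization_nonneg ha v) (realization_nonneg hb v), Or.inr ⟨h0, h⟩⟩

theorem InStar.blend {a b c : V → ℝ} (ha : a ∈ K.realization) (hb : b ∈ K.realization)
    {S : Set V} (hcS : Function.support c ⊆ S) (hsa : K.InStar S a) (hsb : K.InStar S b)
    (s : ℝ) : K.InStar S (blend a b c s) := by
  obtain ⟨σ, hσ, hS, h, -⟩ := blend_carrier ha hb hcS hsa hsb s
  exact ⟨σ, hσ, hS, h⟩

theorem blend_mem {a b c : V → ℝ} (ha : a ∈ K.realization) (hb : b ∈ K.realization)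
    (hc : c ∈ K.realization) {s : ℝ} (hs : s ∈ Set.Icc (0 : ℝ) 1)
    (h : a = b ∨ K.InStar (Function.support c) a ∧ K.InStar (Function.support c) b) :
    blend a b c s ∈ K.realization := by
  rcases h with rfl | ⟨h1, h2⟩
  · rwa [blend_self ha]
  obtain ⟨σ, hσ, hS, h0, h⟩ := blend_carrier ha hb subset_rfl h1 h2 s
  have hcσ : ∑ v ∈ σ, c v = 1 := sum_eq_one_of_mem hc fun v hv => by
    by_contra h
    exact hv (hS h)
  refine mem_realization_of_carrier hσ (blend_nonneg ha hb hc hs) h0 ?_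
  rcases h with ⟨h, hs⟩ | ⟨h, hs⟩
  · exact sum_blend (overlap_eq_sum ha hb fun v hv => Or.inl (h v hv))
      (Or.inl (sum_eq_one_of_mem ha h)) (Or.inr hs) hcσ
  · exact sum_blend (overlap_eq_sum ha hb fun v hv => Or.inr (h v hv))
      (Or.inr hs) (Or.inl (sum_eq_one_of_mem hb h)) hcσ

end SComplex

/-- If a subset deforms to a point in the ambient space, two paths in the subset with common
endpoints are homotopic in the ambient space. -/
theorem Path.Homotopic.of_contraction {Y : Type*} [TopologicalSpace Y] {Z : Set Y} {p₀ : Y}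
    (H : ContinuousMap.Homotopy (⟨Subtype.val, continuous_subtype_val⟩ : C(Z, Y))
      (ContinuousMap.const Z p₀)) {p q : Y} (γ δ : Path p q)
    (hγ : ∀ s, γ s ∈ Z) (hδ : ∀ s, δ s ∈ Z) : γ.Homotopic δ := by
  have hp : p ∈ Z := by simpa using hγ 0
  have hq : q ∈ Z := by simpa using hγ 1
  have key : ∀ α : Path p q, (∀ s, α s ∈ Z) →
      (Path.Homotopic.Quotient.mk α).trans (.mk (H.evalAt ⟨q, hq⟩)) =
        .mk (H.evalAt ⟨p, hp⟩) := by
    intro α hα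
    let α' : Path (⟨p, hp⟩ : Z) ⟨q, hq⟩ :=
      { toFun := fun s => ⟨α s, hα s⟩
        continuous_toFun := by fun_prop
        source' := by simp
        target' := by simp }
    have h := Path.Homotopic.Quotient.eq.2 (Path.Homotopic.map_trans_evalAt H α')
    rw [Path.Homotopic.Quotient.mk_trans, Path.Homotopic.Quotient.mk_trans] at h
    refine Eq.trans h ?_
    have h2 : α'.map (map_continuous (ContinuousMap.const Z p₀)) = Path.refl p₀ := by
      ext s; rfl
    rw [h2]
    exact Path.Homotopic.Quotient.trans_refl _
  have h := (key γ hγ).trans (key δ hδ).symm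
  have h2 := congrArg (fun z => Path.Homotopic.Quotient.trans z
    (Path.Homotopic.Quotient.mk (H.evalAt ⟨q, hq⟩)).symm) h
  refine Path.Homotopic.Quotient.eq.1 ?_
  rw [Path.Homotopic.Quotient.trans_assoc, Path.Homotopic.Quotient.trans_assoc] at h2
  simpa using h2

namespace SComplex

variable {V : Type*} {K : SComplex V} {x y : K.space}

/-- Two points are linked by a set of vertices if they are equal or both lie in its closed
star. -/
def Linked (K : SComplex V) (S : Set V) (a b : V → ℝ) : Prop :=
  a = b ∨ K.InStar S a ∧ K.InStar S b

theorem Linked.refl (S : Set V) (a : V → ℝ) : K.Linked S a a := Or.inl rfl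

theorem Linked.symm {S : Set V} {a b : V → ℝ} (h : K.Linked S a b) : K.Linked S b a :=
  h.imp Eq.symm And.symm

theorem Linked.trans {S : Set V} {a b c : V → ℝ} (h : K.Linked S a b) (h' : K.Linked S b c) :
    K.Linked S a c := by
  rcases h with rfl | h
  · exact h'
  rcases h' with rfl | h'
  · exact Or.inr h
  · exact Or.inr ⟨h.1, h'.2⟩

theorem Linked.blend_left {S : Set V} {a b c : V → ℝ} (h : K.Linked S a b)
    (ha : a ∈ K.realization) (hb : b ∈ K.realization)
    (hc : a = b ∨ Function.support c ⊆ S) (s : ℝ) : K.Linked S (blend a b c s) a := by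
  rcases h with rfl | h
  · rw [blend_self ha]
    exact Linked.refl _ _
  rcases hc with rfl | hc
  · rw [blend_self ha]
    exact Linked.refl _ _
  · exact Or.inr ⟨InStar.blend ha hb hc h.1 h.2 s, h.1⟩

theorem inStar_of_support_subset {S : Set V} {a b : V → ℝ} (hb : b ∈ K.realization)
    (hS : S ⊆ Function.support b) (ha : Function.support a ⊆ Function.support b) :
    K.InStar S a := by
  obtain ⟨σ, hσ, -, h, -⟩ := hb
  have hb' : Function.support b ⊆ σ := fun v hv => by
    by_contra h'
    exact hv (h v h')
  refine ⟨σ, hσ, hS.trans hb', fun v hv => ?_⟩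
  by_contra h'
  exact hv (hb' (ha h'))

theorem continuous_coord (v : V) : Continuous fun a : K.space => (a : V → ℝ) v :=
  (continuous_apply v).comp continuous_subtype_val

/-- The pointwise blend of two paths. -/
noncomputable def blendPath (p q : Path x y) (c : unitInterval → K.space)
    (h : ∀ t, K.Linked (Function.support (c t : V → ℝ)) (p t) (q t))
    (hc : ∀ v, Continuous fun t => (1 - overlap (p t : V → ℝ) (q t)) * (c t : V → ℝ) v)
    (s : unitInterval) : Path x y where
  toFun t := ⟨blend (p t) (q t) (c t) s, blend_mem (p t).2 (q t).2 (c t).2 s.2 (h t)⟩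
  continuous_toFun := by
    refine Continuous.subtype_mk (continuous_pi fun v => ?_) _
    have h1 := (continuous_coord v).comp p.continuous
    have h2 := (continuous_coord v).comp q.continuous
    have h3 := hc v
    simp only [Function.comp_def] at h1 h2
    unfold blend
    fun_prop
  source' := Subtype.ext (by simpa using blend_self x.2 _ _)
  target' := Subtype.ext (by simpa using blend_self y.2 _ _)

theorem continuous_blendPath {T : Type*} [TopologicalSpace T] {P Q : T → Path x y}
    {S : T → unitInterval} (hP : Continuous P) (hQ : Continuous Q) (hS : Continuous S)
    (c : unitInterval → K.space) (h : ∀ τ t, K.Linked (Function.support (c t : V → ℝ)) (P τ t) (Q τ t))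
    (hc : ∀ τ v, Continuous fun t => (1 - overlap (P τ t : V → ℝ) (Q τ t)) * (c t : V → ℝ) v)
    (hcT : ∀ v, Continuous fun z : T × unitInterval =>
      (1 - overlap (P z.1 z.2 : V → ℝ) (Q z.1 z.2)) * (c z.2 : V → ℝ) v) :
    Continuous fun τ => blendPath (P τ) (Q τ) c (h τ) (hc τ) (S τ) := by
  refine Path.continuous_uncurry_iff.1 ?_
  refine Continuous.subtype_mk (continuous_pi fun v => ?_) _
  have h1 : Continuous fun z : T × unitInterval => P z.1 z.2 := by fun_prop
  have h2 : Continuous fun z : T × unitInterval => Q z.1 z.2 := by fun_prop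
  have h1' := (continuous_coord v).comp h1
  have h2' := (continuous_coord v).comp h2
  have h3 := hcT v
  simp only [Function.comp_def] at h1' h2'
  unfold blend
  fun_prop

theorem continuous_mass {T : Type*} [TopologicalSpace T] {a b c : T → K.space}
    (ha : Continuous a) (hb : Continuous b) (hc : Continuous c) (v : V) :
    Continuous fun τ => (1 - overlap (a τ : V → ℝ) (b τ)) * (c τ : V → ℝ) v :=
  (continuous_const.sub (continuous_overlap.comp (ha.prodMk hb))).mul
    ((continuous_coord v).comp hc)

/-- The path of paths from `p` to `q` obtained by pushing through `c`. -/
noncomputable def cell (c : C(unitInterval, K.space)) (p q : Path x y)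
    (h : ∀ t, K.Linked (Function.support (c t : V → ℝ)) (p t) (q t)) : Path p q where
  toFun := blendPath p q c h (continuous_mass p.continuous q.continuous c.continuous)
  continuous_toFun := continuous_blendPath continuous_const continuous_const continuous_id c
    (fun _ => h) (fun _ => continuous_mass p.continuous q.continuous c.continuous)
    (continuous_mass (by fun_prop) (by fun_prop) (by fun_prop))
  source' := by
    exact Path.ext (funext fun t => Subtype.ext (blend_zero _ _ _))
  target' := by
    exact Path.ext (funext fun t => Subtype.ext (blend_one _ _ _))

theorem cell_coe (c : C(unitInterval, K.space)) (p q : Path x y)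
    (h : ∀ t, K.Linked (Function.support (c t : V → ℝ)) (p t) (q t)) (s t : unitInterval) :
    (cell c p q h s t : V → ℝ) = blend (p t) (q t) (c t) s := rfl

/-- Two paths with common endpoints in a family of paths linked to a fixed path are homotopic. -/
theorem homotopic_of_linked {Z : Set (Path x y)} (p₀ : Path x y) (c : unitInterval → K.space)
    (h : ∀ z ∈ Z, ∀ t, K.Linked (Function.support (c t : V → ℝ)) (z t) (p₀ t))
    (hc : ∀ v, Continuous fun z : Z × unitInterval =>
      (1 - overlap (z.1.1 z.2 : V → ℝ) (p₀ z.2)) * (c z.2 : V → ℝ) v)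
    {p q : Path x y} (γ δ : Path p q) (hγ : ∀ s, γ s ∈ Z) (hδ : ∀ s, δ s ∈ Z) :
    γ.Homotopic δ := by
  have hc' : ∀ (z : Z) (v : V), Continuous fun t : unitInterval =>
      (1 - overlap (z.1 t : V → ℝ) (p₀ t)) * (c t : V → ℝ) v := fun z v =>
    (hc v).comp (Continuous.prodMk_right z)
  refine Path.Homotopic.of_contraction (Z := Z) (p₀ := p₀) ?_ γ δ hγ hδ
  refine
    { toFun := fun w => blendPath w.2.1 p₀ c (h w.2.1 w.2.2) (hc' w.2) w.1
      continuous_toFun := ?_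
      map_zero_left := fun z => ?_
      map_one_left := fun z => ?_ }
  · refine continuous_blendPath (P := fun w : unitInterval × Z => w.2.1) (by fun_prop)
      continuous_const continuous_fst c _ (fun w => hc' w.2) fun v => ?_
    exact (hc v).comp ((continuous_snd.comp continuous_fst).prodMk continuous_snd)
  · exact Path.ext (funext fun t => Subtype.ext (blend_zero _ _ _))
  · exact Path.ext (funext fun t => Subtype.ext (blend_one _ _ _))


/-- The paths linked to `p₀` at every time through the carrier of `c`. -/
def linkedFamily (c : C(unitInterval, K.space)) (p₀ : Path x y) : Set (Path x y) :=
  {z | ∀ t, K.Linked (Function.support (c t : V → ℝ)) (z t) (p₀ t)}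

theorem homotopic_of_mem_linkedFamily (c : C(unitInterval, K.space)) (p₀ : Path x y)
    {p q : Path x y} (γ δ : Path p q) (hγ : ∀ s, γ s ∈ linkedFamily c p₀)
    (hδ : ∀ s, δ s ∈ linkedFamily c p₀) : γ.Homotopic δ :=
  homotopic_of_linked p₀ c (fun _ hz => hz)
    (continuous_mass (by fun_prop) (by fun_prop) (by fun_prop)) γ δ hγ hδ

theorem cell_mem_linkedFamily {c c' : C(unitInterval, K.space)} {p₀ p q : Path x y}
    (h : ∀ t, K.Linked (Function.support (c' t : V → ℝ)) (p t) (q t))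
    (hp : p ∈ linkedFamily c p₀) (hq : q ∈ linkedFamily c p₀)
    (hc : ∀ t, p t = q t ∨
      Function.support (c' t : V → ℝ) ⊆ Function.support (c t : V → ℝ)) (s : unitInterval) :
    cell c' p q h s ∈ linkedFamily c p₀ := fun t =>
  (((hp t).trans (hq t).symm).blend_left (p t).2 (q t).2
    ((hc t).imp_left (congrArg Subtype.val)) s).trans (hp t)

theorem trans_mem {Y : Type*} [TopologicalSpace Y] {Z : Set Y} {p q r : Y} {γ : Path p q}
    {δ : Path q r} (hγ : ∀ s, γ s ∈ Z) (hδ : ∀ s, δ s ∈ Z) (s : unitInterval) :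
    γ.trans δ s ∈ Z := by
  rw [Path.trans_apply]
  split_ifs
  · exact hγ _
  · exact hδ _

/-- The homotopy class of a cell. -/
noncomputable def cellClass (c : C(unitInterval, K.space)) (p q : Path x y)
    (h : ∀ t, K.Linked (Function.support (c t : V → ℝ)) (p t) (q t)) :
    Path.Homotopic.Quotient p q :=
  .mk (cell c p q h)

theorem cellClass_trans (c : C(unitInterval, K.space)) {p q r : Path x y}
    (h : ∀ t, K.Linked (Function.support (c t : V → ℝ)) (p t) (q t))
    (h' : ∀ t, K.Linked (Function.support (c t : V → ℝ)) (q t) (r t)) :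
    (cellClass c p q h).trans (cellClass c q r h') =
      cellClass c p r fun t => (h t).trans (h' t) := by
  rw [cellClass, cellClass, cellClass, ← Path.Homotopic.Quotient.mk_trans,
    Path.Homotopic.Quotient.eq]
  have hp : p ∈ linkedFamily c p := fun t => Linked.refl _ _
  have hq : q ∈ linkedFamily c p := fun t => (h t).symm
  have hr : r ∈ linkedFamily c p := fun t => ((h t).trans (h' t)).symm
  exact homotopic_of_mem_linkedFamily c p _ _
    (trans_mem (cell_mem_linkedFamily h hp hq fun _ => Or.inr subset_rfl)
      (cell_mem_linkedFamily h' hq hr fun _ => Or.inr subset_rfl))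
    (cell_mem_linkedFamily _ hp hr fun _ => Or.inr subset_rfl)

theorem cellClass_eq_of_eq (c c' : C(unitInterval, K.space)) {p q : Path x y} (hpq : p = q)
    (h : ∀ t, K.Linked (Function.support (c t : V → ℝ)) (p t) (q t))
    (h' : ∀ t, K.Linked (Function.support (c' t : V → ℝ)) (p t) (q t)) :
    cellClass c p q h = cellClass c' p q h' := by
  subst hpq
  rw [cellClass, cellClass]
  congr 1
  exact Path.ext (funext fun s => Path.ext (funext fun t =>
    Subtype.ext ((blend_self (p t).2 _ _).trans (blend_self (p t).2 _ _).symm)))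

theorem cellClass_congr (c c' d : C(unitInterval, K.space)) {p q : Path x y}
    (h : ∀ t, K.Linked (Function.support (c t : V → ℝ)) (p t) (q t))
    (h' : ∀ t, K.Linked (Function.support (c' t : V → ℝ)) (p t) (q t))
    (hd : ∀ t, K.Linked (Function.support (d t : V → ℝ)) (p t) (q t))
    (hc : ∀ t, Function.support (c t : V → ℝ) ⊆ Function.support (d t : V → ℝ))
    (hc' : ∀ t, Function.support (c' t : V → ℝ) ⊆ Function.support (d t : V → ℝ)) :
    cellClass c p q h = cellClass c' p q h' := by
  rw [cellClass, cellClass, Path.Homotopic.Quotient.eq]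
  have hp : p ∈ linkedFamily d p := fun t => Linked.refl _ _
  have hq : q ∈ linkedFamily d p := fun t => (hd t).symm
  exact homotopic_of_mem_linkedFamily d p _ _
    (cell_mem_linkedFamily h hp hq fun t => Or.inr (hc t))
    (cell_mem_linkedFamily h' hp hq fun t => Or.inr (hc' t))

/-- Cells supported before and after a given time commute. -/
theorem cellClass_interchange (c c' : C(unitInterval, K.space)) (t₀ : unitInterval)
    {p₀₀ p₁₀ p₀₁ p₁₁ : Path x y}
    (h₀ : ∀ t, K.Linked (Function.support (c t : V → ℝ)) (p₀₀ t) (p₁₀ t))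
    (h₁ : ∀ t, K.Linked (Function.support (c t : V → ℝ)) (p₀₁ t) (p₁₁ t))
    (k₀ : ∀ t, K.Linked (Function.support (c' t : V → ℝ)) (p₀₀ t) (p₀₁ t))
    (k₁ : ∀ t, K.Linked (Function.support (c' t : V → ℝ)) (p₁₀ t) (p₁₁ t))
    (hl : ∀ t ≤ t₀, p₀₀ t = p₀₁ t ∧ p₁₀ t = p₁₁ t)
    (hr : ∀ t, t₀ ≤ t → p₀₀ t = p₁₀ t ∧ p₀₁ t = p₁₁ t) :
    (cellClass c p₀₀ p₁₀ h₀).trans (cellClass c' p₁₀ p₁₁ k₁) =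
      (cellClass c' p₀₀ p₀₁ k₀).trans (cellClass c p₀₁ p₁₁ h₁) := by
  let d : unitInterval → K.space := fun t => if t ≤ t₀ then c t else c' t
  let Z : Set (Path x y) :=
    {z | z t₀ = p₀₀ t₀ ∧ ∀ t, K.Linked (Function.support (d t : V → ℝ)) (z t) (p₀₀ t)}
  have dl : ∀ t ≤ t₀, d t = c t := fun t ht => if_pos ht
  have dr : ∀ t, ¬ t ≤ t₀ → d t = c' t := fun t ht => if_neg ht
  have m₀₀ : p₀₀ ∈ Z := ⟨rfl, fun t => Linked.refl _ _⟩
  have m₁₀ : p₁₀ ∈ Z := by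
    refine ⟨(hr t₀ le_rfl).1.symm, fun t => ?_⟩
    by_cases ht : t ≤ t₀
    · rw [dl t ht]; exact (h₀ t).symm
    · rw [(hr t (not_le.1 ht).le).1]; exact Linked.refl _ _
  have m₀₁ : p₀₁ ∈ Z := by
    refine ⟨(hl t₀ le_rfl).1.symm, fun t => ?_⟩
    by_cases ht : t ≤ t₀
    · rw [(hl t ht).1]; exact Linked.refl _ _
    · rw [dr t ht]; exact (k₀ t).symm
  have m₁₁ : p₁₁ ∈ Z := by
    refine ⟨(hl t₀ le_rfl).2 ▸ m₁₀.1, fun t => ?_⟩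
    by_cases ht : t ≤ t₀
    · rw [← (hl t ht).2]; exact m₁₀.2 t
    · rw [← (hr t (not_le.1 ht).le).2]; exact m₀₁.2 t
  have mem : ∀ (e : C(unitInterval, K.space)) (p q : Path x y)
      (h : ∀ t, K.Linked (Function.support (e t : V → ℝ)) (p t) (q t)), p ∈ Z → q ∈ Z →
      (∀ t, p t = q t ∨ e t = d t) → ∀ s, cell e p q h s ∈ Z := by
    intro e p q h hp hq he s
    refine ⟨?_, fun t => ?_⟩
    · refine Subtype.ext ?_
      rw [cell_coe]
      rw [hp.1, hq.1, blend_self (p₀₀ t₀).2]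
    · refine (((hp.2 t).trans (hq.2 t).symm).blend_left (p t).2 (q t).2 ?_ s).trans (hp.2 t)
      exact (he t).imp (congrArg Subtype.val) fun h => by rw [h]
  simp only [cellClass]
  rw [← Path.Homotopic.Quotient.mk_trans, ← Path.Homotopic.Quotient.mk_trans,
    Path.Homotopic.Quotient.eq]
  have el : ∀ p q : Path x y, (∀ t, t₀ ≤ t → p t = q t) → ∀ t, p t = q t ∨ c t = d t := by
    intro p q h t
    by_cases ht : t ≤ t₀
    · exact Or.inr (dl t ht).symm
    · exact Or.inl (h t (not_le.1 ht).le)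
  have er : ∀ p q : Path x y, (∀ t ≤ t₀, p t = q t) → ∀ t, p t = q t ∨ c' t = d t := by
    intro p q h t
    by_cases ht : t ≤ t₀
    · exact Or.inl (h t ht)
    · exact Or.inr (dr t ht).symm
  refine homotopic_of_linked (Z := Z) p₀₀ d (fun z hz => hz.2) (fun v => ?_) _ _
    (trans_mem (mem _ _ _ h₀ m₀₀ m₁₀ (el _ _ fun t ht => (hr t ht).1))
      (mem _ _ _ k₁ m₁₀ m₁₁ (er _ _ fun t ht => (hl t ht).2)))
    (trans_mem (mem _ _ _ k₀ m₀₀ m₀₁ (er _ _ fun t ht => (hl t ht).1))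
      (mem _ _ _ h₁ m₀₁ m₁₁ (el _ _ fun t ht => (hr t ht).2)))
  have key : (fun z : Z × unitInterval =>
      (1 - overlap (z.1.1 z.2 : V → ℝ) (p₀₀ z.2)) * (d z.2 : V → ℝ) v) = fun z =>
      if z.2 ≤ t₀ then (1 - overlap (z.1.1 z.2 : V → ℝ) (p₀₀ z.2)) * (c z.2 : V → ℝ) v
      else (1 - overlap (z.1.1 z.2 : V → ℝ) (p₀₀ z.2)) * (c' z.2 : V → ℝ) v := by
    funext z
    split_ifs with hz
    · rw [dl _ hz]
    · rw [dr _ hz]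
  rw [key]
  refine Continuous.if_le (continuous_mass (by fun_prop) (by fun_prop) (by fun_prop) v)
    (continuous_mass (by fun_prop) (by fun_prop) (by fun_prop) v) continuous_snd
    continuous_const fun z hz => ?_
  rw [hz, z.1.2.1, overlap_self (p₀₀ t₀).2]
  simp

/-- `p` has smaller carriers than `q` at every time. -/
def Subordinate (p q : Path x y) : Prop :=
  ∀ t, Function.support (p t : V → ℝ) ⊆ Function.support (q t : V → ℝ)

theorem Subordinate.linked {p q : Path x y} (h : Subordinate p q) (t : unitInterval) :
    K.Linked (Function.support (p t : V → ℝ)) (q t) (p t) :=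
  Or.inr ⟨inStar_of_support_subset (q t).2 (h t) subset_rfl,
    inStar_of_support_subset (q t).2 (h t) (h t)⟩

theorem Subordinate.mem_linkedFamily {p q : Path x y} (h : Subordinate p q) :
    p ∈ linkedFamily (q : C(unitInterval, K.space)) q := fun t =>
  Or.inr ⟨inStar_of_support_subset (q t).2 subset_rfl (h t),
    inStar_of_support_subset (q t).2 subset_rfl subset_rfl⟩

/-- The straight deformation of `q` to a path with smaller carriers. -/
noncomputable def shrink (q p : Path x y) (h : Subordinate p q) : Path.Homotopic.Quotient q p :=
  cellClass (p : C(unitInterval, K.space)) q p h.linked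

theorem shrink_trans_cellClass {q p p' : Path x y} (h : Subordinate p q) (h' : Subordinate p' q)
    (c : C(unitInterval, K.space))
    (hc : ∀ t, K.Linked (Function.support (c t : V → ℝ)) (p t) (p' t))
    (hcq : ∀ t, p t = p' t ∨
      Function.support (c t : V → ℝ) ⊆ Function.support (q t : V → ℝ)) :
    (shrink q p h).trans (cellClass c p p' hc) = shrink q p' h' := by
  simp only [shrink, cellClass]
  rw [← Path.Homotopic.Quotient.mk_trans, Path.Homotopic.Quotient.eq]
  have hq : q ∈ linkedFamily (q : C(unitInterval, K.space)) q := fun t => Linked.refl _ _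
  exact homotopic_of_mem_linkedFamily (q : C(unitInterval, K.space)) q _ _
    (trans_mem (cell_mem_linkedFamily _ hq h.mem_linkedFamily fun t => Or.inr (h t))
      (cell_mem_linkedFamily _ h.mem_linkedFamily h'.mem_linkedFamily hcq))
    (cell_mem_linkedFamily _ hq h'.mem_linkedFamily fun t => Or.inr (h' t))

theorem trans_shrink {q q' p : Path x y} (γ : Path q q') (h : ∀ s, Subordinate p (γ s))
    (hq : Subordinate p q) (hq' : Subordinate p q') :
    (Path.Homotopic.Quotient.mk γ).trans (shrink q' p hq') = shrink q p hq := by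
  simp only [shrink, cellClass]
  rw [← Path.Homotopic.Quotient.mk_trans, Path.Homotopic.Quotient.eq]
  have hp : p ∈ linkedFamily (p : C(unitInterval, K.space)) p := fun t => Linked.refl _ _
  exact homotopic_of_mem_linkedFamily (p : C(unitInterval, K.space)) p _ _
    (trans_mem (fun s => (h s).linked)
      (cell_mem_linkedFamily _ hq'.linked hp fun t => Or.inr subset_rfl))
    (cell_mem_linkedFamily _ hq.linked hp fun t => Or.inr subset_rfl)

end SComplex

namespace SComplex

variable {V : Type*} {K : SComplex V}

/-- The point of the realization at a vertex. -/
noncomputable def pt (v : K.vertexSet) : K.space :=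
  ⟨Pi.single v.1 1, {v.1}, v.2, fun w => by by_cases h : w = v.1 <;> simp [h],
    fun w hw => Pi.single_eq_of_ne (by simpa using hw) _, by simp⟩

theorem pt_coe (v : K.vertexSet) : (pt v : V → ℝ) = Pi.single v.1 1 := rfl

theorem support_pt (v : K.vertexSet) : Function.support (pt v : V → ℝ) = {v.1} := by
  ext w
  by_cases h : w = v.1 <;> simp [pt_coe, h]

/-- An edge walk with `n` steps from `x` to `y`; consecutive vertices may coincide. -/
@[ext]
structure Word (K : SComplex V) (n : ℕ) (x y : K.vertexSet) where
  toFun : ℕ → V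
  adj : ∀ i < n, {toFun i, toFun (i + 1)} ∈ K.faces
  map_zero : toFun 0 = x
  map_of_le : ∀ i, n ≤ i → toFun i = y

/-- The piecewise linear interpolation of a sequence of vertices. -/
noncomputable def interp (n : ℕ) (f : ℕ → V) (t : ℝ) (v : V) : ℝ :=
  ∑ i ∈ range (n + 1), max 0 (1 - |n * t - i|) * (Pi.single (f i) 1 : V → ℝ) v

theorem interp_eq {n i : ℕ} (hi : i < n) (f : ℕ → V) {t : ℝ} (h0 : (i : ℝ) ≤ n * t)
    (h1 : n * t ≤ i + 1) :
    interp n f t = fun v => (i + 1 - n * t) * (Pi.single (f i) 1 : V → ℝ) v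
      + (n * t - i) * (Pi.single (f (i + 1)) 1 : V → ℝ) v := by
  funext v
  have hsub : ({i, i + 1} : Finset ℕ) ⊆ range (n + 1) := by
    intro j hj
    simp only [mem_insert, mem_singleton] at hj
    simp only [mem_range]
    omega
  rw [interp, ← Finset.sum_subset hsub, Finset.sum_pair (by omega)]
  · congr 2
    · rw [abs_of_nonneg (by linarith), max_eq_right (by linarith)]
      ring
    · push_cast
      rw [abs_of_nonpos (by linarith), max_eq_right (by linarith)]
      ring
  · intro j _ hj
    simp only [mem_insert, mem_singleton, not_or] at hj
    have : 1 - |(n : ℝ) * t - j| ≤ 0 := by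
      rcases lt_or_gt_of_ne hj.1 with h | h
      · have h' : (j : ℝ) + 1 ≤ i := by exact_mod_cast h
        rw [abs_of_nonneg (by linarith)]
        linarith
      · have h2 : i + 2 ≤ j := by omega
        have h' : (i : ℝ) + 2 ≤ j := by exact_mod_cast h2
        rw [abs_of_nonpos (by linarith)]
        linarith
    rw [max_eq_left this, zero_mul]

theorem exists_index {n : ℕ} (hn : 0 < n) (t : unitInterval) :
    ∃ i < n, (i : ℝ) ≤ n * t ∧ (n : ℝ) * t ≤ i + 1 := by
  have h0 : 0 ≤ (n : ℝ) * t := mul_nonneg (Nat.cast_nonneg n) t.2.1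
  have h1 : (n : ℝ) * t ≤ n := mul_le_of_le_one_right (Nat.cast_nonneg n) t.2.2
  by_cases h : ⌊(n : ℝ) * t⌋₊ < n
  · exact ⟨_, h, Nat.floor_le h0, (Nat.lt_floor_add_one _).le⟩
  · have h2 : (n : ℝ) ≤ n * t := (Nat.le_floor_iff h0).1 (not_lt.1 h)
    refine ⟨n - 1, by omega, ?_, ?_⟩ <;> rw [Nat.cast_sub (by omega)] <;> push_cast <;> linarith

theorem interp_congr {n i : ℕ} (hi : i < n) {f g : ℕ → V} {t : ℝ} (h0 : (i : ℝ) ≤ n * t)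
    (h1 : n * t ≤ i + 1) (hf : f i = g i ∨ i + 1 ≤ n * t)
    (hf' : f (i + 1) = g (i + 1) ∨ n * t ≤ i) : interp n f t = interp n g t := by
  rw [interp_eq hi f h0 h1, interp_eq hi g h0 h1]
  funext v
  congr 1
  · rcases hf with h | h
    · rw [h]
    · rw [show (i : ℝ) + 1 - n * t = 0 by linarith, zero_mul, zero_mul]
  · rcases hf' with h | h
    · rw [h]
    · rw [show (n : ℝ) * t - i = 0 by linarith, zero_mul, zero_mul]

theorem interp_apply_eq_zero {n i : ℕ} (hi : i < n) (f : ℕ → V) {t : ℝ} (h0 : (i : ℝ) ≤ n * t)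
    (h1 : n * t ≤ i + 1) {σ : Finset V} (hσ : {f i, f (i + 1)} ⊆ σ) {v : V} (hv : v ∉ σ) :
    interp n f t v = 0 := by
  have hv1 : v ≠ f i := fun h => hv (hσ (by simp [h]))
  have hv2 : v ≠ f (i + 1) := fun h => hv (hσ (by simp [h]))
  rw [interp_eq hi f h0 h1]
  simp [hv1, hv2]

namespace Word

variable {n : ℕ} {x y : K.vertexSet}

theorem map_last (ω : K.Word n x y) : ω.toFun n = y := ω.map_of_le n le_rfl

theorem interp_mem (hn : 0 < n) (ω : K.Word n x y) (t : unitInterval) :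
    interp n ω.toFun t ∈ K.realization := by
  obtain ⟨i, hi, h0, h1⟩ := exists_index hn t
  refine ⟨_, ω.adj i hi, fun v => ?_, fun v hv => interp_apply_eq_zero hi _ h0 h1 subset_rfl hv, ?_⟩
  · exact Finset.sum_nonneg fun j _ => mul_nonneg (le_max_left _ _)
      (by rw [Pi.single_apply]; split_ifs <;> norm_num)
  · rw [interp_eq hi _ h0 h1]
    simp only [Finset.sum_add_distrib, ← Finset.mul_sum, Finset.sum_pi_single']
    simp

/-- The path in the realization traced by a word. -/
noncomputable def path [NeZero n] (ω : K.Word n x y) : Path (pt x) (pt y) where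
  toFun t := ⟨interp n ω.toFun t, ω.interp_mem (NeZero.pos n) t⟩
  continuous_toFun := by
    refine Continuous.subtype_mk (continuous_pi fun v => ?_) _
    unfold interp
    fun_prop
  source' := by
    refine Subtype.ext ?_
    have hn := NeZero.pos n
    change interp n ω.toFun ((0 : unitInterval) : ℝ) = _
    rw [interp_eq (i := 0) hn _ (by simp) (by simp)]
    simp [ω.map_zero, pt_coe]
  target' := by
    refine Subtype.ext ?_
    have hn := NeZero.pos n
    have hn' : ((n - 1 : ℕ) : ℝ) = n - 1 := by rw [Nat.cast_sub (by omega)]; simp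
    change interp n ω.toFun ((1 : unitInterval) : ℝ) = _
    rw [interp_eq (i := n - 1) (by omega) _ (by simp) (by simp [hn'])]
    simp [hn', Nat.sub_add_cancel hn, ω.map_last, pt_coe]

/-- Two words have every edge in common except where both edges span a face with `S`. -/
def Linked (S : Finset V) (ω ω' : K.Word n x y) : Prop :=
  ∀ i < n, (ω.toFun i = ω'.toFun i ∧ ω.toFun (i + 1) = ω'.toFun (i + 1)) ∨
    (S ∪ {ω.toFun i, ω.toFun (i + 1)} ∈ K.faces ∧ S ∪ {ω'.toFun i, ω'.toFun (i + 1)} ∈ K.faces)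

theorem Linked.of_agree {S : Finset V} {ω ω' : K.Word n x y}
    (h : ∀ i ≤ n, ω.toFun i = ω'.toFun i) : Linked S ω ω' :=
  fun i hi => Or.inl ⟨h i hi.le, h (i + 1) hi⟩

theorem Linked.trans {S : Finset V} {ω ω' ω'' : K.Word n x y} (h : Linked S ω ω')
    (h' : Linked S ω' ω'') : Linked S ω ω'' := by
  intro i hi
  rcases h i hi with h | h
  · rw [h.1, h.2]
    exact h' i hi
  · rcases h' i hi with h' | h'
    · rw [← h'.1, ← h'.2]
      exact Or.inr h
    · exact Or.inr ⟨h.1, h'.2⟩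

theorem Linked.mono {S T : Finset V} (hST : S ⊆ T) {ω ω' : K.Word n x y} (h : Linked T ω ω') :
    Linked S ω ω' := fun i hi => (h i hi).imp_right fun h =>
  ⟨K.down_closed h.1 (union_subset_union_left hST) ⟨ω.toFun i, by simp⟩,
    K.down_closed h.2 (union_subset_union_left hST) ⟨ω'.toFun i, by simp⟩⟩

variable [NeZero n]

theorem Linked.path {S : Finset V} {ω ω' : K.Word n x y} (h : Linked S ω ω')
    (t : unitInterval) : K.Linked S (ω.path t) (ω'.path t) := by
  obtain ⟨i, hi, h0, h1⟩ := exists_index (NeZero.pos n) t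
  rcases h i hi with h | h
  · exact Or.inl (interp_congr hi h0 h1 (Or.inl h.1) (Or.inl h.2))
  · exact Or.inr ⟨⟨_, h.1, coe_subset.2 subset_union_left, fun v hv =>
      interp_apply_eq_zero hi _ h0 h1 subset_union_right hv⟩, _, h.2,
      coe_subset.2 subset_union_left, fun v hv =>
      interp_apply_eq_zero hi _ h0 h1 subset_union_right hv⟩

theorem path_eq_of_agree {ω ω' : K.Word n x y} (h : ∀ i ≤ n, ω.toFun i = ω'.toFun i) :
    ω.path = ω'.path := by
  refine Path.ext (funext fun t => Subtype.ext ?_)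
  obtain ⟨i, hi, h0, h1⟩ := exists_index (NeZero.pos n) t
  exact interp_congr hi h0 h1 (Or.inl (h i hi.le)) (Or.inl (h (i + 1) hi))

theorem linked_pt {u : K.vertexSet} {ω ω' : K.Word n x y} (h : Linked {u.1} ω ω')
    (t : unitInterval) :
    K.Linked (Function.support ((ContinuousMap.const unitInterval (pt u)) t : V → ℝ))
      (ω.path t) (ω'.path t) := by
  have := h.path t
  rwa [coe_singleton, ← support_pt] at this

/-- The class of the deformation of one word to another by coning off with the vertex `u`. -/
noncomputable def cone (u : K.vertexSet) (ω ω' : K.Word n x y) (h : Linked {u.1} ω ω') :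
    Path.Homotopic.Quotient ω.path ω'.path :=
  cellClass (ContinuousMap.const _ (pt u)) ω.path ω'.path (linked_pt h)

theorem cone_trans {u : K.vertexSet} {ω ω' ω'' : K.Word n x y} (h : Linked {u.1} ω ω')
    (h' : Linked {u.1} ω' ω'') : (cone u ω ω' h).trans (cone u ω' ω'' h') =
      cone u ω ω'' (h.trans h') :=
  cellClass_trans _ _ _

theorem cone_eq_of_agree {u u' : K.vertexSet} {ω ω' : K.Word n x y}
    (ha : ∀ i ≤ n, ω.toFun i = ω'.toFun i) (h : Linked {u.1} ω ω') (h' : Linked {u'.1} ω ω') :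
    cone u ω ω' h = cone u' ω ω' h' :=
  cellClass_eq_of_eq _ _ (path_eq_of_agree ha) _ _

theorem cone_congr {u u' : K.vertexSet} {ω ω' : K.Word n x y} (hu : Linked {u.1} ω ω')
    (hu' : Linked {u'.1} ω ω') (h : Linked {u.1, u'.1} ω ω') :
    cone u ω ω' hu = cone u' ω ω' hu' := by
  by_cases hf : {u.1, u'.1} ∈ K.faces
  · have hmem : (fun v => ((pt u : V → ℝ) v + (pt u' : V → ℝ) v) / 2) ∈ K.realization := by
      refine ⟨_, hf, fun v => ?_, fun v hv => ?_, ?_⟩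
      · linarith [realization_nonneg (pt u).2 v, realization_nonneg (pt u').2 v]
      · simp only [mem_insert, mem_singleton, not_or] at hv
        simp [pt_coe, hv.1, hv.2]
      · rw [← Finset.sum_div, Finset.sum_add_distrib]
        simp [pt_coe, Pi.single_apply]
    let d : K.space := ⟨_, hmem⟩
    have hd : Function.support (d : V → ℝ) = {u.1, u'.1} := by
      ext v
      by_cases h1 : v = u.1 <;> by_cases h2 : v = u'.1 <;>
        simp [d, pt_coe, Pi.single_apply, h1, h2]
      all_goals split_ifs <;> norm_num
    refine cellClass_congr _ _ (ContinuousMap.const _ d) _ _ (fun t => ?_) (fun t => ?_)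
      (fun t => ?_)
    · have := h.path t
      simpa [hd] using this
    · simp [support_pt, hd]
    · simp [support_pt, hd]
  · refine cone_eq_of_agree (fun i hi => ?_) hu hu'
    have key : ∀ i < n, ω.toFun i = ω'.toFun i ∧ ω.toFun (i + 1) = ω'.toFun (i + 1) := by
      intro i hi
      rcases h i hi with h | h
      · exact h
      · exact absurd (K.down_closed h.1 subset_union_left ⟨u.1, by simp⟩) hf
    rcases hi.lt_or_eq with h | rfl
    · exact (key i h).1
    · rw [ω.map_last, ω'.map_last]

theorem path_eq_of_le {ω ω' : K.Word n x y} {m : ℕ} (h : ∀ i ≤ m, ω.toFun i = ω'.toFun i)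
    {t : unitInterval} (ht : (n : ℝ) * t ≤ m) : ω.path t = ω'.path t := by
  obtain ⟨i, hi, h0, h1⟩ := exists_index (NeZero.pos n) t
  have him : i ≤ m := by exact_mod_cast h0.trans ht
  refine Subtype.ext (interp_congr hi h0 h1 (Or.inl (h i him)) ?_)
  rcases him.lt_or_eq with h' | rfl
  · exact Or.inl (h _ h')
  · exact Or.inr ht

theorem path_eq_of_ge {ω ω' : K.Word n x y} {m : ℕ}
    (h : ∀ i, m ≤ i → i ≤ n → ω.toFun i = ω'.toFun i)
    {t : unitInterval} (ht : (m : ℝ) ≤ n * t) : ω.path t = ω'.path t := by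
  obtain ⟨i, hi, h0, h1⟩ := exists_index (NeZero.pos n) t
  have him : m ≤ i + 1 := by exact_mod_cast ht.trans h1
  refine Subtype.ext (interp_congr hi h0 h1 ?_ (Or.inl (h (i + 1) him hi)))
  rcases him.lt_or_eq with h' | rfl
  · exact Or.inl (h _ (by omega) hi.le)
  · exact Or.inr (by exact_mod_cast ht)

theorem cone_interchange {u u' : K.vertexSet} {m : ℕ} (hm : m ≤ n)
    {ω₀₀ ω₁₀ ω₀₁ ω₁₁ : K.Word n x y} (h₀ : Linked {u.1} ω₀₀ ω₁₀) (h₁ : Linked {u.1} ω₀₁ ω₁₁)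
    (k₀ : Linked {u'.1} ω₀₀ ω₀₁) (k₁ : Linked {u'.1} ω₁₀ ω₁₁)
    (hl : ∀ i ≤ m, ω₀₀.toFun i = ω₀₁.toFun i ∧ ω₁₀.toFun i = ω₁₁.toFun i)
    (hr : ∀ i, m ≤ i → i ≤ n → ω₀₀.toFun i = ω₁₀.toFun i ∧ ω₀₁.toFun i = ω₁₁.toFun i) :
    (cone u ω₀₀ ω₁₀ h₀).trans (cone u' ω₁₀ ω₁₁ k₁) =
      (cone u' ω₀₀ ω₀₁ k₀).trans (cone u ω₀₁ ω₁₁ h₁) := by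
  have hn : (0 : ℝ) < n := by exact_mod_cast NeZero.pos n
  have hmn : (m : ℝ) ≤ n := by exact_mod_cast hm
  refine cellClass_interchange _ _ ⟨m / n, by positivity, (div_le_one hn).2 hmn⟩ _ _ _ _
    (fun t ht => ?_) (fun t ht => ?_)
  · have ht' : (n : ℝ) * t ≤ m := by
      have := (le_div_iff₀ hn).1 (show (t : ℝ) ≤ m / n from ht)
      linarith
    exact ⟨path_eq_of_le (fun i hi => (hl i hi).1) ht', path_eq_of_le (fun i hi => (hl i hi).2) ht'⟩
  · have ht' : (m : ℝ) ≤ n * t := by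
      have := (div_le_iff₀ hn).1 (show (m / n : ℝ) ≤ t from ht)
      linarith
    exact ⟨path_eq_of_ge (fun i hi hi' => (hr i hi hi').1) ht',
      path_eq_of_ge (fun i hi hi' => (hr i hi hi').2) ht'⟩

end Word

end SComplex

namespace SComplex

variable {V : Type*} {K : SComplex V}

/-- `u` cones off every set of the family `F`. -/
def Cones (K : SComplex V) (u : V) (F : Set (Finset V)) : Prop := ∀ σ ∈ F, insert u σ ∈ K.faces

theorem Cones.mono {u : V} {F G : Set (Finset V)} (h : K.Cones u G) (hFG : F ⊆ G) :
    K.Cones u F := fun σ hσ => h σ (hFG hσ)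

theorem IsConic.exists_cones {r : ℕ} (hK : K.IsConic r) (l : List V) (hl : l.length ≤ r)
    (F : Set (Finset V)) (hF : F ⊆ K.faces) (hFl : ∀ σ ∈ F, ∀ v ∈ σ, v ∈ l) :
    ∃ u : K.vertexSet, K.Cones u F := by
  let L : SComplex V :=
    { faces := {τ | τ.Nonempty ∧ ∃ σ ∈ F, τ ⊆ σ}
      not_empty_mem := by simp
      down_closed := fun {s t} hs hts ht => ⟨ht, hs.2.imp fun σ hσ => ⟨hσ.1, hts.trans hσ.2⟩⟩ }
  have hsub : L.vertexSet ⊆ (l.toFinset : Set V) := by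
    rintro v ⟨-, σ, hσ, hv⟩
    simpa using hFl σ hσ v (by simpa using hv)
  have hfin : L.vertexSet.Finite := (Finset.finite_toSet _).subset hsub
  have hcard : L.vertexSet.ncard ≤ r :=
    (Set.ncard_le_ncard hsub (Finset.finite_toSet _)).trans
      ((Set.ncard_coe_finset _).le.trans ((List.toFinset_card_le l).trans hl))
  obtain ⟨u, hu, h⟩ := hK L (fun τ hτ => by
    obtain ⟨h1, σ, hσ, h2⟩ := hτ
    exact K.down_closed (hF hσ) h2 h1) hfin (by exact_mod_cast hcard)
  refine ⟨⟨u, hu⟩, fun σ hσ => h σ ⟨?_, σ, hσ, subset_rfl⟩⟩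
  by_contra h0
  exact K.not_empty_mem (Finset.not_nonempty_iff_eq_empty.1 h0 ▸ hF hσ)

namespace Word

variable {n : ℕ} {x y : K.vertexSet}

/-- Where two words differ, their edges lie in members of `F`. -/
def Carried (F : Set (Finset V)) (ω ω' : K.Word n x y) : Prop :=
  ∀ i < n, (ω.toFun i = ω'.toFun i ∧ ω.toFun (i + 1) = ω'.toFun (i + 1)) ∨
    ((∃ σ ∈ F, {ω.toFun i, ω.toFun (i + 1)} ⊆ σ) ∧
      ∃ σ ∈ F, {ω'.toFun i, ω'.toFun (i + 1)} ⊆ σ)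

theorem Carried.linked {F : Set (Finset V)} {ω ω' : K.Word n x y} (h : Carried F ω ω')
    {S : Finset V} (hS : ∀ σ ∈ F, S ∪ σ ∈ K.faces) : Linked S ω ω' := fun i hi =>
  (h i hi).imp_right fun ⟨⟨σ, hσ, h⟩, τ, hτ, h'⟩ =>
    ⟨K.down_closed (hS σ hσ) (union_subset_union_right h) ⟨ω.toFun i, by simp⟩,
      K.down_closed (hS τ hτ) (union_subset_union_right h') ⟨ω'.toFun i, by simp⟩⟩

theorem Carried.linked_singleton {F : Set (Finset V)} {ω ω' : K.Word n x y}
    (h : Carried F ω ω') {u : V} (hu : K.Cones u F) : Linked {u} ω ω' :=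
  h.linked fun σ hσ => by simpa only [← insert_eq] using hu σ hσ

theorem Carried.linked_pair {F : Set (Finset V)} {ω ω' : K.Word n x y}
    (h : Carried F ω ω') {u w : V} (hu : ∀ σ ∈ F, insert w (insert u σ) ∈ K.faces) :
    Linked {u, w} ω ω' :=
  h.linked fun σ hσ => by
    have := hu σ hσ
    rwa [insert_comm, insert_eq, insert_eq, ← union_assoc] at this

variable [NeZero n]

/-- The class of a coning deformation does not depend on the apex, if few vertices are
involved. -/
theorem Carried.cone_eq (hK : K.IsConic 8) {F : Set (Finset V)} (l : List V)
    (hl : l.length ≤ 6) (hFl : ∀ σ ∈ F, ∀ v ∈ σ, v ∈ l) {ω ω' : K.Word n x y}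
    (h : Carried F ω ω') {u u' : K.vertexSet} (hu : K.Cones u F) (hu' : K.Cones u' F)
    (k : Linked {u.1} ω ω') (k' : Linked {u'.1} ω ω') : cone u ω ω' k = cone u' ω ω' k' := by
  obtain ⟨w, hw⟩ := hK.exists_cones (r := 8) (u.1 :: u'.1 :: l)
    (by simp only [List.length_cons]; omega)
    ((fun σ => insert u.1 σ) '' F ∪ (fun σ => insert u'.1 σ) '' F)
    (by rintro _ (⟨σ, hσ, rfl⟩ | ⟨σ, hσ, rfl⟩); exacts [hu σ hσ, hu' σ hσ])
    (by
      rintro _ (⟨σ, hσ, rfl⟩ | ⟨σ, hσ, rfl⟩) v hv <;> rcases mem_insert.1 hv with rfl | hv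
      · simp
      · simp [hFl σ hσ v hv]
      · simp
      · simp [hFl σ hσ v hv])
  have hl1 : Linked {u.1, w.1} ω ω' := h.linked_pair fun σ hσ => hw _ (Or.inl ⟨σ, hσ, rfl⟩)
  have hl2 : Linked {u'.1, w.1} ω ω' := h.linked_pair fun σ hσ => hw _ (Or.inr ⟨σ, hσ, rfl⟩)
  have hlw : Linked {w.1} ω ω' := hl1.mono (by simp)
  rw [cone_congr k hlw hl1, cone_congr k' hlw hl2]

end Word

/-- The two edges from `x` to `v` through `w`. -/
def legs (x w v : V) : Set (Finset V) := {{x, w}, {w, v}}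

/-- A choice of two-edge paths from `x` to all vertices, and of vertices coning off the
resulting loops over edges. -/
structure Fan (K : SComplex V) (x : K.vertexSet) where
  mid : V → V
  apex : V → V → K.vertexSet
  legs_subset : ∀ v, {v} ∈ K.faces → legs x.1 (mid v) v ⊆ K.faces
  mid_eq : ∀ v, {x.1, v} ∈ K.faces → mid v = v
  cones : ∀ v w, {v, w} ∈ K.faces →
    K.Cones (apex v w) (legs x.1 (mid v) v ∪ legs x.1 (mid w) w ∪ {{v, w}})

theorem left_mem_faces {v w : V} (h : {v, w} ∈ K.faces) : {v} ∈ K.faces :=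
  K.down_closed h (by simp) (by simp)

theorem right_mem_faces {v w : V} (h : {v, w} ∈ K.faces) : {w} ∈ K.faces :=
  K.down_closed h (by simp) (by simp)

theorem IsConic.nonempty_fan (hK : K.IsConic 8) (x : K.vertexSet) : Nonempty (K.Fan x) := by
  have h1 : ∀ v, ∃ w, {v} ∈ K.faces →
      legs x.1 w v ⊆ K.faces ∧ ({x.1, v} ∈ K.faces → w = v) := by
    intro v
    by_cases hv : {v} ∈ K.faces
    · by_cases hxv : {x.1, v} ∈ K.faces
      · refine ⟨v, fun _ => ⟨?_, fun _ => rfl⟩⟩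
        rintro _ (rfl | rfl)
        · exact hxv
        · simpa using hv
      · obtain ⟨w, hw⟩ := hK.exists_cones (r := 8) [x.1, v] (by simp) {{x.1}, {v}}
          (by rintro _ (rfl | rfl); exacts [x.2, hv])
          (by rintro _ (rfl | rfl) <;> simp)
        refine ⟨w, fun _ => ⟨?_, fun h => absurd h hxv⟩⟩
        rintro _ (rfl | rfl)
        · rw [pair_comm]
          exact hw _ (Or.inl rfl)
        · exact hw _ (Or.inr rfl)
    · exact ⟨v, fun h => absurd h hv⟩
  choose mid hmid using h1
  have h2 : ∀ v w, ∃ u : K.vertexSet, {v, w} ∈ K.faces →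
      K.Cones u (legs x.1 (mid v) v ∪ legs x.1 (mid w) w ∪ {{v, w}}) := by
    intro v w
    by_cases h : {v, w} ∈ K.faces
    · obtain ⟨u, hu⟩ := hK.exists_cones (r := 8) [x.1, mid v, v, mid w, w] (by simp)
        (legs x.1 (mid v) v ∪ legs x.1 (mid w) w ∪ {{v, w}})
        (by
          rintro σ ((hσ | hσ) | rfl)
          · exact (hmid v (left_mem_faces h)).1 hσ
          · exact (hmid w (right_mem_faces h)).1 hσ
          · exact h)
        (by rintro _ (((rfl | rfl) | (rfl | rfl)) | rfl) <;> simp)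
      exact ⟨u, fun _ => hu⟩
    · exact ⟨x, fun h' => absurd h' h⟩
  choose apex hapex using h2
  refine ⟨⟨mid, apex, fun v hv => (hmid v hv).1, fun v hv => ?_, hapex⟩⟩
  exact (hmid v (right_mem_faces hv)).2 hv

namespace Fan

variable {n : ℕ} {x y : K.vertexSet} (A : K.Fan x)

/-- The first `j` steps of the word replaced by the chosen path from `x`. -/
def replace (ω : K.Word n x y) (j i : ℕ) : V :=
  if i = 0 then x.1 else if i < j then A.mid (ω.toFun j) else ω.toFun i

theorem replace_of_le (ω : K.Word n x y) {j i : ℕ} (h : j ≤ i) :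
    A.replace ω j i = ω.toFun i := by
  unfold replace
  split_ifs with h1 h2
  · rw [h1, ω.map_zero]
  · omega
  · rfl

theorem replace_edge (ω : K.Word n x y) {j i : ℕ} (h : i < j) (hj : j ≤ n) :
    ∃ σ ∈ legs x.1 (A.mid (ω.toFun j)) (ω.toFun j),
      {A.replace ω j i, A.replace ω j (i + 1)} ⊆ σ := by
  rcases Nat.eq_zero_or_pos i with rfl | hi
  · refine ⟨_, Or.inl rfl, ?_⟩
    have h1 : A.replace ω j 1 = A.mid (ω.toFun j) := by
      by_cases hj1 : j = 1
      · subst hj1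
        have := ω.adj 0 (by omega)
        rw [ω.map_zero] at this
        rw [A.replace_of_le ω le_rfl, A.mid_eq _ this]
      · simp [replace, show 1 < j by omega]
    rw [zero_add, h1]
    simp [replace]
  · refine ⟨_, Or.inr rfl, ?_⟩
    have h1 : A.replace ω j i = A.mid (ω.toFun j) := by
      simp [replace, h, hi.ne']
    rw [h1]
    rcases Nat.lt_or_ge (i + 1) j with h2 | h2
    · rw [show A.replace ω j (i + 1) = A.mid (ω.toFun j) by simp [replace, h2]]
      simp
    · rw [A.replace_of_le ω h2, show i + 1 = j by omega]

theorem singleton_mem (ω : K.Word n x y) {j : ℕ} (hj : j ≤ n) : {ω.toFun j} ∈ K.faces := by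
  rcases hj.lt_or_eq with h | rfl
  · exact left_mem_faces (ω.adj j h)
  · rw [ω.map_last]
    exact y.2

/-- The word following the chosen path from `x` to the `j`-th vertex of a given word, and the
given word from then on. -/
def word (ω : K.Word n x y) (j : ℕ) (hj : j ≤ n) : K.Word n x y where
  toFun := A.replace ω j
  adj i hi := by
    rcases Nat.lt_or_ge i j with h | h
    · obtain ⟨σ, hσ, hs⟩ := A.replace_edge ω h hj
      exact K.down_closed (A.legs_subset _ (singleton_mem ω hj) hσ) hs (by simp)
    · rw [A.replace_of_le ω h, A.replace_of_le ω (by omega)]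
      exact ω.adj i hi
  map_zero := by simp [replace]
  map_of_le i hi := by rw [A.replace_of_le ω (hj.trans hi), ω.map_of_le i hi]

theorem word_apply_of_le (ω : K.Word n x y) {j i : ℕ} (hj : j ≤ n) (h : j ≤ i) :
    (A.word ω j hj).toFun i = ω.toFun i := A.replace_of_le ω h

theorem word_edge (ω : K.Word n x y) {j i : ℕ} (hj : j ≤ n) (h : i < j) :
    ∃ σ ∈ legs x.1 (A.mid (ω.toFun j)) (ω.toFun j),
      {(A.word ω j hj).toFun i, (A.word ω j hj).toFun (i + 1)} ⊆ σ := A.replace_edge ω h hj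

theorem word_congr {ω ω' : K.Word n x y} {j : ℕ} (hj : j ≤ n) (hjj : ω.toFun j = ω'.toFun j)
    {i : ℕ} (h : ω.toFun i = ω'.toFun i) :
    (A.word ω j hj).toFun i = (A.word ω' j hj).toFun i := by
  simp [word, replace, h, hjj]

/-- The faces involved in moving along an edge. -/
def edgeFaces (v w : V) : Set (Finset V) :=
  legs x.1 (A.mid v) v ∪ legs x.1 (A.mid w) w ∪ {{v, w}}

theorem carried_word_succ (ω : K.Word n x y) (j : ℕ) (hj : j + 1 ≤ n) :
    Word.Carried (A.edgeFaces (ω.toFun j) (ω.toFun (j + 1))) (A.word ω j (by omega))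
      (A.word ω (j + 1) hj) := by
  intro i hi
  rcases lt_trichotomy i j with h | rfl | h
  · obtain ⟨σ, hσ, hs⟩ := A.word_edge ω (j := j) (by omega) h
    obtain ⟨τ, hτ, ht⟩ := A.word_edge ω (j := j + 1) hj (i := i) (by omega)
    exact Or.inr ⟨⟨σ, Or.inl (Or.inl hσ), hs⟩, τ, Or.inl (Or.inr hτ), ht⟩
  · obtain ⟨τ, hτ, ht⟩ := A.word_edge ω (j := i + 1) hj (i := i) (by omega)
    refine Or.inr ⟨⟨_, Or.inr rfl, ?_⟩, τ, Or.inl (Or.inr hτ), ht⟩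
    rw [A.word_apply_of_le _ _ le_rfl, A.word_apply_of_le _ _ (by omega)]
  · refine Or.inl ⟨?_, ?_⟩ <;>
      rw [A.word_apply_of_le _ _ (by omega), A.word_apply_of_le _ _ (by omega)]

theorem cones_edgeFaces (ω : K.Word n x y) (j : ℕ) (hj : j + 1 ≤ n) :
    K.Cones (A.apex (ω.toFun j) (ω.toFun (j + 1)))
      (A.edgeFaces (ω.toFun j) (ω.toFun (j + 1))) :=
  A.cones _ _ (ω.adj j hj)

theorem linked_word_succ (ω : K.Word n x y) (j : ℕ) (hj : j + 1 ≤ n) :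
    Word.Linked {(A.apex (ω.toFun j) (ω.toFun (j + 1))).1} (A.word ω j (by omega))
      (A.word ω (j + 1) hj) :=
  (A.carried_word_succ ω j hj).linked_singleton (A.cones_edgeFaces ω j hj)

theorem linked_word_zero (u : V) (ω : K.Word n x y) :
    Word.Linked {u} ω (A.word ω 0 (Nat.zero_le n)) :=
  Word.Linked.of_agree fun i _ => (A.word_apply_of_le ω _ (Nat.zero_le i)).symm

theorem linked_word_last (u : V) (ω ω₀ : K.Word n x y) :
    Word.Linked {u} (A.word ω n le_rfl) (A.word ω₀ n le_rfl) := by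
  refine Word.Linked.of_agree fun i _ => ?_
  by_cases hi : n ≤ i
  · rw [A.word_apply_of_le _ _ hi, A.word_apply_of_le _ _ hi, ω.map_of_le i hi, ω₀.map_of_le i hi]
  · simp [word, replace, ω.map_last, ω₀.map_last, not_le.1 hi]

variable [NeZero n]

/-- The class of the elementary move from the `j`-th to the `j + 1`-st word. -/
noncomputable def step (ω : K.Word n x y) (j : ℕ) (hj : j + 1 ≤ n) :
    Path.Homotopic.Quotient (A.word ω j (by omega)).path (A.word ω (j + 1) hj).path :=
  Word.cone (A.apex (ω.toFun j) (ω.toFun (j + 1))) _ _ (A.linked_word_succ ω j hj)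

/-- The composite of the first `j` elementary moves. -/
noncomputable def moves (ω : K.Word n x y) :
    ∀ (j : ℕ) (hj : j ≤ n), Path.Homotopic.Quotient ω.path (A.word ω j hj).path
  | 0, _ => Word.cone x _ _ (A.linked_word_zero x.1 ω)
  | j + 1, hj => (moves ω j (by omega)).trans (A.step ω j hj)

theorem moves_succ (ω : K.Word n x y) (j : ℕ) (hj : j + 1 ≤ n) :
    A.moves ω (j + 1) hj = (A.moves ω j (by omega)).trans (A.step ω j hj) := rfl

/-- The canonical deformation class of a word to a word which depends only on `x` and `y`. -/
noncomputable def normalize (ω₀ ω : K.Word n x y) :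
    Path.Homotopic.Quotient ω.path (A.word ω₀ n le_rfl).path :=
  (A.moves ω n le_rfl).trans (Word.cone x _ _ (A.linked_word_last x.1 ω ω₀))

end Fan

end SComplex

namespace SComplex

variable {V : Type*} {K : SComplex V}

namespace Fan

variable {n : ℕ} {x y : K.vertexSet} (A : K.Fan x) {ω ω' : K.Word n x y} {k : ℕ}

/-- Two words differing at most in the letter with index `k + 1`, whose discrepancy spans
faces with the two neighbouring letters. -/
structure Differ (ω ω' : K.Word n x y) (k : ℕ) : Prop where
  lt : k + 1 < n
  eq : ∀ i ≠ k + 1, ω.toFun i = ω'.toFun i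
  left_mem : {ω.toFun k, ω.toFun (k + 1), ω'.toFun (k + 1)} ∈ K.faces
  right_mem : {ω.toFun (k + 1), ω'.toFun (k + 1), ω.toFun (k + 2)} ∈ K.faces

/-- The two faces spanned by differing words. -/
def discrepancy (ω ω' : K.Word n x y) (k : ℕ) : Set (Finset V) :=
  {{ω.toFun k, ω.toFun (k + 1), ω'.toFun (k + 1)},
    {ω.toFun (k + 1), ω'.toFun (k + 1), ω.toFun (k + 2)}}

/-- The common letter changed by a difference, as a vertex. -/
def pivot (ω : K.Word n x y) {k : ℕ} (hk : k + 1 < n) : K.vertexSet :=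
  ⟨ω.toFun (k + 1), singleton_mem ω hk.le⟩

theorem cones_pivot (h : Differ ω ω' k) :
    K.Cones (pivot ω h.lt).1 (discrepancy ω ω' k) := by
  rintro _ (rfl | rfl)
  · rw [insert_eq_of_mem (by simp [pivot])]
    exact h.left_mem
  · rw [insert_eq_of_mem (by simp [pivot])]
    exact h.right_mem

theorem carried_of_differ (h : Differ ω ω' k) : Word.Carried (discrepancy ω ω' k) ω ω' := by
  intro i hi
  by_cases h1 : i = k
  · subst h1
    refine Or.inr ⟨⟨_, Or.inl rfl, ?_⟩, _, Or.inl rfl, ?_⟩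
    · intro v; simp; tauto
    · rw [← h.eq i (by omega)]
      intro v; simp; tauto
  · by_cases h2 : i = k + 1
    · subst h2
      refine Or.inr ⟨⟨_, Or.inr rfl, ?_⟩, _, Or.inr rfl, ?_⟩
      · intro v; simp; tauto
      · rw [← h.eq (k + 1 + 1) (by omega)]
        intro v; simp; tauto
    · exact Or.inl ⟨h.eq i h2, h.eq (i + 1) (by omega)⟩

theorem carried_word_of_differ (h : Differ ω ω' k) {j : ℕ} (hj : j ≤ k) :
    Word.Carried (discrepancy ω ω' k) (A.word ω j (by have := h.lt; omega))
      (A.word ω' j (by have := h.lt; omega)) := by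
  intro i hi
  by_cases hij : j ≤ i
  · rw [A.word_apply_of_le _ _ hij, A.word_apply_of_le _ _ hij,
      A.word_apply_of_le _ _ (show j ≤ i + 1 by omega),
      A.word_apply_of_le _ _ (show j ≤ i + 1 by omega)]
    exact carried_of_differ h i hi
  · exact Or.inl ⟨A.word_congr _ (h.eq j (by omega)) (h.eq i (by omega)),
      A.word_congr _ (h.eq j (by omega)) (h.eq (i + 1) (by omega))⟩

theorem linked_pivot_word (h : Differ ω ω' k) {j : ℕ} (hj : j ≤ k) :
    Word.Linked {(pivot ω h.lt).1} (A.word ω j (by have := h.lt; omega))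
      (A.word ω' j (by have := h.lt; omega)) :=
  (A.carried_word_of_differ h hj).linked_singleton (cones_pivot h)

/-- The faces involved in changing a letter of a partially replaced word. -/
def changeFaces (ω ω' : K.Word n x y) (k : ℕ) : Set (Finset V) :=
  legs x.1 (A.mid (ω.toFun (k + 1))) (ω.toFun (k + 1)) ∪
    legs x.1 (A.mid (ω'.toFun (k + 1))) (ω'.toFun (k + 1)) ∪
    {{ω.toFun (k + 1), ω'.toFun (k + 1), ω.toFun (k + 2)}}

theorem carried_changeFaces (h : Differ ω ω' k) :
    Word.Carried (A.changeFaces ω ω' k) (A.word ω (k + 1) h.lt.le)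
      (A.word ω' (k + 1) h.lt.le) := by
  intro i hi
  have hlt := h.lt
  rcases lt_trichotomy i (k + 1) with hik | rfl | hik
  · obtain ⟨σ, hσ, hs⟩ := A.word_edge ω (j := k + 1) (by omega) hik
    obtain ⟨τ, hτ, ht⟩ := A.word_edge ω' (j := k + 1) (by omega) hik
    exact Or.inr ⟨⟨σ, Or.inl (Or.inl hσ), hs⟩, τ, Or.inl (Or.inr hτ), ht⟩
  · rw [A.word_apply_of_le _ _ le_rfl, A.word_apply_of_le _ _ (show k + 1 ≤ k + 1 + 1 by omega),
      A.word_apply_of_le _ _ le_rfl, A.word_apply_of_le _ _ (show k + 1 ≤ k + 1 + 1 by omega)]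
    refine Or.inr ⟨⟨_, Or.inr rfl, ?_⟩, _, Or.inr rfl, ?_⟩
    · intro v; simp; tauto
    · rw [← h.eq (k + 1 + 1) (by omega)]
      intro v; simp; tauto
  · refine Or.inl ⟨?_, ?_⟩
    · rw [A.word_apply_of_le _ _ hik.le, A.word_apply_of_le _ _ hik.le, h.eq i (by omega)]
    · rw [A.word_apply_of_le _ _ (by omega), A.word_apply_of_le _ _ (by omega),
        h.eq (i + 1) (by omega)]

theorem word_eq_of_differ (h : Differ ω ω' k) {j : ℕ} (hj : j ≤ n) (hkj : k + 2 ≤ j) :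
    A.word ω j hj = A.word ω' j hj := by
  ext i
  by_cases hi : i = k + 1
  · simp [word, replace, hi, show k + 1 < j by omega, h.eq j (by omega)]
  · exact A.word_congr hj (h.eq j (by omega)) (h.eq i hi)

variable [NeZero n]

/-- The deformation changing one letter of a word. -/
noncomputable def change (h : Differ ω ω' k) : Path.Homotopic.Quotient ω.path ω'.path :=
  Word.cone (pivot ω h.lt) ω ω' ((carried_of_differ h).linked_singleton (cones_pivot h))

theorem moves_trans_change_of_le (h : Differ ω ω' k) : ∀ (j : ℕ) (hj : j ≤ k),
    (A.moves ω j (by have := h.lt; omega)).trans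
      (Word.cone (pivot ω h.lt) _ _ (A.linked_pivot_word h hj)) =
    (change h).trans (A.moves ω' j (by have := h.lt; omega)) := by
  intro j
  induction j with
  | zero =>
    intro hj
    simp only [moves, change]
    rw [Word.cone_eq_of_agree (u' := pivot ω h.lt) _ _ (A.linked_word_zero _ ω),
      Word.cone_eq_of_agree (u' := pivot ω h.lt) (ω := ω') _ _ (A.linked_word_zero _ ω'),
      Word.cone_trans, Word.cone_trans]
    all_goals exact fun i _ => (A.word_apply_of_le _ _ (Nat.zero_le i)).symm
  | succ j ih =>
    intro hj
    have hlt := h.lt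
    rw [moves_succ, moves_succ, ← Path.Homotopic.Quotient.trans_assoc, ← ih (by omega),
      Path.Homotopic.Quotient.trans_assoc, Path.Homotopic.Quotient.trans_assoc]
    congr 1
    have ha : A.apex (ω'.toFun j) (ω'.toFun (j + 1)) = A.apex (ω.toFun j) (ω.toFun (j + 1)) := by
      rw [h.eq j (by omega), h.eq (j + 1) (by omega)]
    have hl' := A.linked_word_succ ω' j (by omega)
    rw [ha] at hl'
    have hs : A.step ω' j (by omega) =
        Word.cone (A.apex (ω.toFun j) (ω.toFun (j + 1))) _ _ hl' := by
      unfold step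
      congr 1
    rw [hs]
    refine Word.cone_interchange (m := j + 1) (by omega) _ _ _ _ (fun i hi => ?_)
      (fun i hi hi' => ?_)
    · exact ⟨A.word_congr _ (h.eq j (by omega)) (h.eq i (by omega)),
        A.word_congr _ (h.eq (j + 1) (by omega)) (h.eq i (by omega))⟩
    · simp only [A.word_apply_of_le _ _ hi, A.word_apply_of_le _ _ (show j ≤ i by omega),
        and_self]

/-- The faces involved in moving along an edge have few vertices, so all cones over them give
the same class. -/
theorem step_eq_cone (hK : K.IsConic 8) (ω : K.Word n x y) (j : ℕ) (hj : j + 1 ≤ n)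
    {u : K.vertexSet} (hu : K.Cones u (A.edgeFaces (ω.toFun j) (ω.toFun (j + 1)))) :
    A.step ω j hj = Word.cone u _ _ ((A.carried_word_succ ω j hj).linked_singleton hu) :=
  (A.carried_word_succ ω j hj).cone_eq hK
    [x.1, A.mid (ω.toFun j), ω.toFun j, A.mid (ω.toFun (j + 1)), ω.toFun (j + 1)] (by simp)
    (by rintro _ (((rfl | rfl) | (rfl | rfl)) | rfl) <;> simp) (A.cones_edgeFaces ω j hj) hu _ _

theorem cone_changeFaces_eq (hK : K.IsConic 8) (h : Differ ω ω' k) {u u' : K.vertexSet}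
    (hu : K.Cones u (A.changeFaces ω ω' k)) (hu' : K.Cones u' (A.changeFaces ω ω' k)) :
    Word.cone u _ _ ((A.carried_changeFaces h).linked_singleton hu) =
      Word.cone u' _ _ ((A.carried_changeFaces h).linked_singleton hu') :=
  (A.carried_changeFaces h).cone_eq hK
    [x.1, A.mid (ω.toFun (k + 1)), ω.toFun (k + 1), A.mid (ω'.toFun (k + 1)),
      ω'.toFun (k + 1), ω.toFun (k + 2)] (by simp)
    (by rintro _ (((rfl | rfl) | (rfl | rfl)) | rfl) <;> simp) hu hu' _ _

theorem moves_trans_change_pivot (hK : K.IsConic 8) (h : Differ ω ω' k) {u : K.vertexSet}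
    (hu : K.Cones u (A.changeFaces ω ω' k)) :
    (A.moves ω (k + 1) h.lt.le).trans
      (Word.cone u _ _ ((A.carried_changeFaces h).linked_singleton hu)) =
    (change h).trans (A.moves ω' (k + 1) h.lt.le) := by
  have hlt := h.lt
  have hω : {ω.toFun k} ∈ K.faces := singleton_mem ω (by omega)
  have hω1 : {ω.toFun (k + 1)} ∈ K.faces := singleton_mem ω (by omega)
  have hω1' : {ω'.toFun (k + 1)} ∈ K.faces := singleton_mem ω' (by omega)
  obtain ⟨w, hw⟩ := hK.exists_cones (r := 8)
    [x.1, A.mid (ω.toFun k), ω.toFun k, A.mid (ω.toFun (k + 1)), ω.toFun (k + 1),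
      A.mid (ω'.toFun (k + 1)), ω'.toFun (k + 1), ω.toFun (k + 2)] (by simp)
    (legs x.1 (A.mid (ω.toFun k)) (ω.toFun k) ∪ A.changeFaces ω ω' k ∪ discrepancy ω ω' k)
    (by
      rintro σ ((hσ | ((hσ | hσ) | rfl)) | (rfl | rfl))
      · exact A.legs_subset _ hω hσ
      · exact A.legs_subset _ hω1 hσ
      · exact A.legs_subset _ hω1' hσ
      · exact h.right_mem
      · exact h.left_mem
      · exact h.right_mem)
    (by rintro _ (((rfl | rfl) | (((rfl | rfl) | (rfl | rfl)) | rfl)) | (rfl | rfl)) <;> simp)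
  have hwc : K.Cones w (A.changeFaces ω ω' k) := hw.mono fun σ hσ => Or.inl (Or.inr hσ)
  have hwd : K.Cones w (discrepancy ω ω' k) := hw.mono fun σ hσ => Or.inr hσ
  have hw1 : K.Cones w (A.edgeFaces (ω.toFun k) (ω.toFun (k + 1))) := by
    rintro σ ((hσ | hσ) | rfl)
    · exact hw σ (Or.inl (Or.inl hσ))
    · exact hwc σ (Or.inl (Or.inl hσ))
    · exact K.down_closed (hwd _ (Or.inl rfl)) (insert_subset_insert _ (by simp [insert_subset_iff]))
        (by simp)
  have hw2 : K.Cones w (A.edgeFaces (ω'.toFun k) (ω'.toFun (k + 1))) := by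
    rw [← h.eq k (by omega)]
    rintro σ ((hσ | hσ) | rfl)
    · exact hw σ (Or.inl (Or.inl hσ))
    · exact hwc σ (Or.inl (Or.inr hσ))
    · exact K.down_closed (hwd _ (Or.inl rfl)) (insert_subset_insert _ (by simp [insert_subset_iff]))
        (by simp)
  have hpair : Word.Linked {(pivot ω h.lt).1, w.1} (A.word ω k (by omega))
      (A.word ω' k (by omega)) := by
    refine (A.carried_word_of_differ h le_rfl).linked_pair fun σ hσ => ?_
    rw [insert_eq_of_mem (a := (pivot ω h.lt).1)]
    · exact hwd σ hσ
    · rcases hσ with rfl | rfl <;> simp [pivot]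
  rw [A.cone_changeFaces_eq hK h hu hwc, moves_succ, moves_succ,
    ← Path.Homotopic.Quotient.trans_assoc, ← A.moves_trans_change_of_le h k le_rfl,
    Path.Homotopic.Quotient.trans_assoc, Path.Homotopic.Quotient.trans_assoc,
    A.step_eq_cone hK ω k (by omega) hw1, A.step_eq_cone hK ω' k (by omega) hw2,
    Word.cone_congr _ (hpair.mono (by simp)) hpair, Word.cone_trans, Word.cone_trans]

theorem moves_trans_change_of_ge (hK : K.IsConic 8) (h : Differ ω ω' k) (u : K.vertexSet) (j : ℕ)
    (hkj : k + 2 ≤ j) : ∀ hj : j ≤ n,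
    (A.moves ω j hj).trans (Word.cone u _ _ (Word.Linked.of_agree
      fun i _ => by rw [A.word_eq_of_differ h hj hkj])) =
    (change h).trans (A.moves ω' j hj) := by
  induction j, hkj using Nat.le_induction with
  | base =>
    intro hj
    have hω1 : {ω.toFun (k + 1)} ∈ K.faces := singleton_mem ω (by omega)
    have hω1' : {ω'.toFun (k + 1)} ∈ K.faces := singleton_mem ω' (by omega)
    have hω2 : {ω.toFun (k + 2)} ∈ K.faces := singleton_mem ω (by omega)
    obtain ⟨w, hw⟩ := hK.exists_cones (r := 8)
      [x.1, A.mid (ω.toFun (k + 2)), ω.toFun (k + 2), A.mid (ω.toFun (k + 1)), ω.toFun (k + 1),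
        A.mid (ω'.toFun (k + 1)), ω'.toFun (k + 1)] (by simp)
      (legs x.1 (A.mid (ω.toFun (k + 2))) (ω.toFun (k + 2)) ∪ A.changeFaces ω ω' k)
      (by
        rintro σ (hσ | ((hσ | hσ) | rfl))
        · exact A.legs_subset _ hω2 hσ
        · exact A.legs_subset _ hω1 hσ
        · exact A.legs_subset _ hω1' hσ
        · exact h.right_mem)
      (by rintro _ ((rfl | rfl) | (((rfl | rfl) | (rfl | rfl)) | rfl)) <;> simp)
    have hwc : K.Cones w (A.changeFaces ω ω' k) := hw.mono fun σ hσ => Or.inr hσ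
    have hw1 : K.Cones w (A.edgeFaces (ω.toFun (k + 1)) (ω.toFun (k + 1 + 1))) := by
      rintro σ ((hσ | hσ) | rfl)
      · exact hwc σ (Or.inl (Or.inl hσ))
      · exact hw σ (Or.inl hσ)
      · exact K.down_closed (hwc _ (Or.inr rfl))
          (insert_subset_insert _ (by simp [insert_subset_iff])) (by simp)
    have hw2 : K.Cones w (A.edgeFaces (ω'.toFun (k + 1)) (ω'.toFun (k + 1 + 1))) := by
      rw [← h.eq (k + 1 + 1) (by omega)]
      rintro σ ((hσ | hσ) | rfl)
      · exact hwc σ (Or.inl (Or.inr hσ))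
      · exact hw σ (Or.inl hσ)
      · exact K.down_closed (hwc _ (Or.inr rfl))
          (insert_subset_insert _ (by simp)) (by simp)
    have hag : ∀ i ≤ n, (A.word ω (k + 2) hj).toFun i = (A.word ω' (k + 2) hj).toFun i :=
      fun i _ => by rw [A.word_eq_of_differ h hj le_rfl]
    rw [Word.cone_eq_of_agree hag _ (Word.Linked.of_agree (S := {w.1}) hag),
      A.moves_succ ω (k + 1), A.moves_succ ω' (k + 1), ← Path.Homotopic.Quotient.trans_assoc,
      ← A.moves_trans_change_pivot hK h hwc, Path.Homotopic.Quotient.trans_assoc,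
      Path.Homotopic.Quotient.trans_assoc, A.step_eq_cone hK ω (k + 1) (by omega) hw1,
      A.step_eq_cone hK ω' (k + 1) (by omega) hw2]
    congr 1
    exact (Word.cone_trans _ _).trans (Word.cone_trans _ _).symm
  | succ j hkj ih =>
    intro hj
    have ha : A.apex (ω'.toFun j) (ω'.toFun (j + 1)) = A.apex (ω.toFun j) (ω.toFun (j + 1)) := by
      rw [h.eq j (by omega), h.eq (j + 1) (by omega)]
    have hl' := A.linked_word_succ ω' j (by omega)
    rw [ha] at hl'
    have hs : A.step ω' j (by omega) =
        Word.cone (A.apex (ω.toFun j) (ω.toFun (j + 1))) _ _ hl' := by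
      unfold step
      congr 1
    have hag : ∀ j (hj : j ≤ n), k + 2 ≤ j → ∀ i ≤ n,
        (A.word ω j hj).toFun i = (A.word ω' j hj).toFun i :=
      fun j hj hkj i _ => by rw [A.word_eq_of_differ h hj hkj]
    rw [moves_succ, moves_succ, ← Path.Homotopic.Quotient.trans_assoc, ← ih (by omega),
      Path.Homotopic.Quotient.trans_assoc, Path.Homotopic.Quotient.trans_assoc, hs,
      Word.cone_eq_of_agree (hag j _ hkj) _
        (Word.Linked.of_agree (S := {(A.apex (ω.toFun j) (ω.toFun (j + 1))).1}) (hag j _ hkj)),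
      Word.cone_eq_of_agree (hag (j + 1) hj (by omega)) _
        (Word.Linked.of_agree (S := {(A.apex (ω.toFun j) (ω.toFun (j + 1))).1})
          (hag (j + 1) hj (by omega))), Word.cone_trans]
    congr 1
    exact Word.cone_trans _ _

theorem change_trans_normalize (hK : K.IsConic 8) (h : Differ ω ω' k) (ω₀ : K.Word n x y) :
    (change h).trans (A.normalize ω₀ ω') = A.normalize ω₀ ω := by
  rw [normalize, normalize, ← Path.Homotopic.Quotient.trans_assoc,
    ← A.moves_trans_change_of_ge hK h x n h.lt, Path.Homotopic.Quotient.trans_assoc,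
    Word.cone_trans]

end Fan

end SComplex

namespace SComplex

variable {V : Type*} {K : SComplex V}

theorem mem_faces_of_ne_zero {a : V → ℝ} (ha : a ∈ K.realization) {S : Finset V}
    (hS : S.Nonempty) (h : ∀ v ∈ S, a v ≠ 0) : S ∈ K.faces := by
  obtain ⟨σ, hσ, -, h', -⟩ := ha
  refine K.down_closed hσ (fun v hv => ?_) hS
  by_contra hv'
  exact h v hv (h' v hv')

variable {n : ℕ} {x y : K.vertexSet}

/-- Each vertex of the sequence has non-zero weight along the part of the path that its
hat function covers. -/
def Close (n : ℕ) (f : ℕ → V) (q : Path (pt x) (pt y)) : Prop :=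
  ∀ i ≤ n, ∀ t : unitInterval, |(n : ℝ) * t - i| ≤ 1 → (q t : V → ℝ) (f i) ≠ 0

theorem Close.mem_faces {q : Path (pt x) (pt y)} {m : ℕ} (hm : m ≤ n) (hn : 0 < n) {S : Finset V}
    (hS : S.Nonempty) (h : ∀ v ∈ S, ∃ f : ℕ → V, Close n f q ∧
      ∃ i ≤ n, f i = v ∧ i ≤ m + 1 ∧ m ≤ i + 1) : S ∈ K.faces := by
  have hn' : (0 : ℝ) < n := by exact_mod_cast hn
  have hmn : (m : ℝ) ≤ n := by exact_mod_cast hm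
  refine mem_faces_of_ne_zero (q ⟨m / n, by positivity, (div_le_one hn').2 hmn⟩).2 hS
    fun v hv => ?_
  obtain ⟨f, hf, i, hi, rfl, h1, h2⟩ := h v hv
  refine hf i hi _ ?_
  have h1' : (i : ℝ) ≤ m + 1 := by exact_mod_cast h1
  have h2' : (m : ℝ) ≤ i + 1 := by exact_mod_cast h2
  rw [mul_div_cancel₀ _ hn'.ne', abs_le]
  constructor <;> linarith

/-- A sequence of vertices close to a path is a word. -/
def Close.word {q : Path (pt x) (pt y)} {f : ℕ → V} (h : Close n f q) (h0 : f 0 = x)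
    (hle : ∀ i, n ≤ i → f i = y) : K.Word n x y where
  toFun := f
  adj i hi := Close.mem_faces hi.le (by omega) ⟨f i, by simp⟩ (by
    intro v hv
    rw [mem_insert, mem_singleton] at hv
    rcases hv with rfl | rfl
    · exact ⟨f, h, i, hi.le, rfl, by omega, by omega⟩
    · exact ⟨f, h, i + 1, hi, rfl, by omega, by omega⟩)
  map_zero := h0
  map_of_le := hle

/-- The word following `ω'` up to the index `m` and `ω` afterwards. -/
def splice {q : Path (pt x) (pt y)} {ω ω' : K.Word n x y} (h : Close n ω.toFun q)
    (h' : Close n ω'.toFun q) (m : ℕ) : K.Word n x y :=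
  Close.word (f := fun i => if i ≤ m then ω'.toFun i else ω.toFun i) (q := q)
    (fun i hi t ht => by
      dsimp only
      split_ifs
      · exact h' i hi t ht
      · exact h i hi t ht)
    (by simp [ω'.map_zero])
    (fun i hi => by simp [ω.map_of_le i hi, ω'.map_of_le i hi])

theorem splice_apply {q : Path (pt x) (pt y)} {ω ω' : K.Word n x y} (h : Close n ω.toFun q)
    (h' : Close n ω'.toFun q) (m i : ℕ) :
    (splice h h' m).toFun i = if i ≤ m then ω'.toFun i else ω.toFun i := rfl

theorem splice_zero {q : Path (pt x) (pt y)} {ω ω' : K.Word n x y} (h : Close n ω.toFun q)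
    (h' : Close n ω'.toFun q) : splice h h' 0 = ω := by
  ext i
  rw [splice_apply]
  split_ifs with hi
  · rw [Nat.le_zero.1 hi, ω.map_zero, ω'.map_zero]
  · rfl

theorem splice_of_le {q : Path (pt x) (pt y)} {ω ω' : K.Word n x y} (h : Close n ω.toFun q)
    (h' : Close n ω'.toFun q) {m : ℕ} (hm : n ≤ m + 1) : splice h h' m = ω' := by
  ext i
  rw [splice_apply]
  split_ifs with hi
  · rfl
  · rw [ω.map_of_le i (by omega), ω'.map_of_le i (by omega)]

theorem close_splice {q : Path (pt x) (pt y)} {ω ω' : K.Word n x y} (h : Close n ω.toFun q)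
    (h' : Close n ω'.toFun q) (m : ℕ) : Close n (splice h h' m).toFun q := fun i hi t ht => by
  rw [splice_apply]
  split_ifs
  · exact h' i hi t ht
  · exact h i hi t ht

theorem differ_splice {q : Path (pt x) (pt y)} {ω ω' : K.Word n x y} (h : Close n ω.toFun q)
    (h' : Close n ω'.toFun q) {k : ℕ} (hk : k + 1 < n) :
    Fan.Differ (splice h h' k) (splice h h' (k + 1)) k where
  lt := hk
  eq i hi := by
    rw [splice_apply, splice_apply]
    by_cases h1 : i ≤ k
    · rw [if_pos h1, if_pos (by omega)]
    · rw [if_neg h1, if_neg (by omega)]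
  left_mem := by
    refine Close.mem_faces (n := n) (q := q) (m := k) (by omega) (by omega) ⟨_, mem_insert_self _ _⟩
      fun v hv => ?_
    simp only [mem_insert, mem_singleton] at hv
    rcases hv with rfl | rfl | rfl
    · exact ⟨_, close_splice h h' k, k, by omega, rfl, by omega, by omega⟩
    · exact ⟨_, close_splice h h' k, k + 1, by omega, rfl, by omega, by omega⟩
    · exact ⟨_, close_splice h h' (k + 1), k + 1, by omega, rfl, by omega, by omega⟩
  right_mem := by
    refine Close.mem_faces (n := n) (q := q) (m := k + 1) (by omega) (by omega) ⟨_, mem_insert_self _ _⟩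
      fun v hv => ?_
    simp only [mem_insert, mem_singleton] at hv
    rcases hv with rfl | rfl | rfl
    · exact ⟨_, close_splice h h' k, k + 1, by omega, rfl, by omega, by omega⟩
    · exact ⟨_, close_splice h h' (k + 1), k + 1, by omega, rfl, by omega, by omega⟩
    · exact ⟨_, close_splice h h' k, k + 2, by omega, rfl, by omega, by omega⟩

variable [NeZero n]

theorem Close.subordinate {q : Path (pt x) (pt y)} {ω : K.Word n x y} (h : Close n ω.toFun q) :
    Subordinate ω.path q := by
  intro t v hv
  obtain ⟨i, hi, h0, h1⟩ := exists_index (NeZero.pos n) t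
  have hv' : v ∈ ({ω.toFun i, ω.toFun (i + 1)} : Finset V) := by
    by_contra hv'
    exact hv (interp_apply_eq_zero hi _ h0 h1 subset_rfl hv')
  rw [mem_insert, mem_singleton] at hv'
  rcases hv' with rfl | rfl
  · exact h i hi.le t (by rw [abs_le]; constructor <;> linarith)
  · exact h (i + 1) hi t (by push_cast; rw [abs_le]; constructor <;> linarith)

theorem shrink_trans_change {q : Path (pt x) (pt y)} {ω ω' : K.Word n x y}
    (h : Close n ω.toFun q) (h' : Close n ω'.toFun q) {k : ℕ} (hd : Fan.Differ ω ω' k) :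
    (shrink q ω.path h.subordinate).trans (Fan.change hd) =
      shrink q ω'.path h'.subordinate := by
  refine shrink_trans_cellClass _ _ _ _ fun t => ?_
  by_cases h1 : (n : ℝ) * t ≤ k
  · exact Or.inl (Word.path_eq_of_le (fun i hi => hd.eq i (by omega)) h1)
  by_cases h2 : ((k + 2 : ℕ) : ℝ) ≤ n * t
  · exact Or.inl (Word.path_eq_of_ge (fun i hi _ => hd.eq i (by omega)) h2)
  refine Or.inr ?_
  push_cast at h2
  rw [ContinuousMap.const_apply, support_pt, Set.singleton_subset_iff]
  exact h (k + 1) hd.lt.le t (by push_cast; rw [abs_le]; constructor <;> linarith)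

namespace Fan

variable (A : K.Fan x)

/-- The class of the deformation of a path to a fixed word through a close word. -/
noncomputable def retract (ω₀ : K.Word n x y) {q : Path (pt x) (pt y)} {ω : K.Word n x y}
    (h : Close n ω.toFun q) : Path.Homotopic.Quotient q (A.word ω₀ n le_rfl).path :=
  (shrink q ω.path h.subordinate).trans (A.normalize ω₀ ω)

theorem retract_eq (hK : K.IsConic 8) (ω₀ : K.Word n x y) {q : Path (pt x) (pt y)}
    {ω ω' : K.Word n x y} (h : Close n ω.toFun q) (h' : Close n ω'.toFun q) :
    A.retract ω₀ h = A.retract ω₀ h' := by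
  have key : ∀ k < n, A.retract ω₀ (close_splice h h' k) = A.retract ω₀ (close_splice h h' 0) := by
    intro k
    induction k with
    | zero => exact fun _ => rfl
    | succ k ih =>
      intro hk
      rw [← ih (by omega), retract, retract,
        ← A.change_trans_normalize hK (differ_splice h h' hk) ω₀,
        ← Path.Homotopic.Quotient.trans_assoc,
        shrink_trans_change (close_splice h h' k) (close_splice h h' (k + 1))]
  have hn := NeZero.pos n
  have := key (n - 1) (by omega)
  simp only [splice_zero, splice_of_le h h' (show n ≤ n - 1 + 1 by omega)] at this
  exact this.symm

end Fan

end SComplex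

namespace SComplex

variable {V : Type*} {K : SComplex V} {x y : K.vertexSet}

theorem exists_ne_zero (a : K.space) : ∃ v, (a : V → ℝ) v ≠ 0 := by
  obtain ⟨σ, -, -, -, h⟩ := a.2
  by_contra! h'
  rw [Finset.sum_eq_zero fun v _ => h' v] at h
  exact zero_ne_one h

/-- A compact family of paths is, at every sufficiently fine scale, locally close to words. -/
theorem exists_close {T : Type*} [PseudoMetricSpace T] [CompactSpace T]
    {Γ : T → Path (pt x) (pt y)} (hΓ : Continuous Γ) :
    ∃ N : ℕ, ∀ n ≥ N, ∀ s, ∃ ω : K.Word n x y, ∀ᶠ s' in nhds s, Close n ω.toFun (Γ s') := by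
  let U : V → Set (T × unitInterval) := fun v =>
    {z | (Γ z.1 z.2 : V → ℝ) v ≠ 0} ∩ ({z | z.2 ≠ 0 ∨ v = x} ∩ {z | z.2 ≠ 1 ∨ v = y})
  have hU : ∀ v, IsOpen (U v) := by
    intro v
    have h1 : Continuous fun z : T × unitInterval => (Γ z.1 z.2 : V → ℝ) v :=
      (continuous_coord v).comp (by fun_prop)
    have h2 : ∀ (c : unitInterval) (P : Prop),
        IsOpen {z : T × unitInterval | z.2 ≠ c ∨ P} := by
      intro c P
      by_cases hP : P
      · simp [hP]
      · simpa [hP] using isOpen_ne_fun continuous_snd continuous_const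
    exact (isOpen_ne_fun h1 continuous_const).inter ((h2 _ _).inter (h2 _ _))
  have hcover : Set.univ ⊆ ⋃ v, U v := by
    rintro ⟨s, t⟩ -
    rw [Set.mem_iUnion]
    by_cases h0 : t = 0
    · subst h0
      exact ⟨x, by simp [U, pt_coe]⟩
    by_cases h1 : t = 1
    · subst h1
      exact ⟨y, by simp [U, pt_coe]⟩
    obtain ⟨v, hv⟩ := exists_ne_zero (Γ s t)
    exact ⟨v, hv, Or.inl h0, Or.inl h1⟩
  obtain ⟨δ, hδ, hball⟩ := lebesgue_number_lemma_of_metric isCompact_univ hU hcover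
  obtain ⟨M, hM⟩ := exists_nat_one_div_lt hδ
  refine ⟨M + 1, fun n hn s => ?_⟩
  have hn0 : (0 : ℝ) < n := by exact_mod_cast (by omega : 0 < n)
  have hnδ : 1 / (n : ℝ) < δ := lt_of_le_of_lt
    (one_div_le_one_div_of_le (by positivity) (by exact_mod_cast hn)) hM
  let τ : ℕ → unitInterval := fun i => Set.projIcc 0 1 zero_le_one ((i : ℝ) / n)
  choose f hf using fun i => hball (s, τ i) (Set.mem_univ _)
  have hmem : ∀ i, (s, τ i) ∈ U (f i) := fun i => hf i (Metric.mem_ball_self hδ)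
  have hτ0 : τ 0 = 0 := by simp [τ, Set.projIcc_left]
  have hτ1 : ∀ i, n ≤ i → τ i = 1 := fun i hi =>
    Set.projIcc_of_right_le _ ((one_le_div hn0).2 (by exact_mod_cast hi))
  have hclose : ∀ s' ∈ Metric.ball s δ, Close n f (Γ s') := by
    intro s' hs' i hi t ht
    refine (hf i (show (s', t) ∈ Metric.ball (s, τ i) δ from ?_)).1
    rw [Metric.mem_ball, Prod.dist_eq, max_lt_iff]
    refine ⟨hs', ?_⟩
    have hi' : (i : ℝ) / n ∈ Set.Icc (0 : ℝ) 1 :=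
      ⟨by positivity, (div_le_one hn0).2 (by exact_mod_cast hi)⟩
    have hτ : (τ i : ℝ) = i / n := by simp only [τ]; rw [Set.projIcc_of_mem _ hi']
    change dist t (τ i) < δ
    rw [Subtype.dist_eq, Real.dist_eq, hτ]
    refine lt_of_le_of_lt ?_ hnδ
    rw [le_div_iff₀ hn0]
    calc |(t : ℝ) - i / n| * n = |(n : ℝ) * t - i| := by
          conv_lhs => rw [← abs_of_pos hn0, ← abs_mul]
          rw [abs_of_pos hn0]
          congr 1
          field_simp
      _ ≤ 1 := ht
  exact ⟨(hclose s (Metric.mem_ball_self hδ)).word ((hmem 0).2.1.resolve_left (by simp [hτ0]))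
    (fun i hi => (hmem i).2.2.resolve_left (by simp [hτ1 i hi])),
    Filter.eventually_of_mem (Metric.ball_mem_nhds s hδ) hclose⟩

namespace Fan

variable (A : K.Fan x) {n : ℕ} [NeZero n]

theorem mk_subpath_trans_retract (ω₀ : K.Word n x y) {q q' : Path (pt x) (pt y)}
    (γ : Path q q') {ω : K.Word n x y} {s s' : unitInterval}
    (h : ∀ r ∈ Set.uIcc s s', Close n ω.toFun (γ r)) :
    (Path.Homotopic.Quotient.mk (γ.subpath s s')).trans (A.retract ω₀ (h s' Set.right_mem_uIcc)) =
      A.retract ω₀ (h s Set.left_mem_uIcc) := by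
  rw [retract, retract, ← Path.Homotopic.Quotient.trans_assoc,
    trans_shrink (γ.subpath s s') (fun r => ?_) (h s Set.left_mem_uIcc).subordinate]
  have : γ.subpath s s' r ∈ Set.range (γ.subpath s s') := ⟨r, rfl⟩
  rw [Path.range_subpath] at this
  obtain ⟨r', hr', h'⟩ := this
  rw [← h']
  exact (h r' hr').subordinate

theorem mk_eq_refl (A : K.Fan x) (hK : K.IsConic 8) (q : Path (pt x) (pt y)) (γ : Path q q) :
    Path.Homotopic.Quotient.mk γ = .refl q := by
  obtain ⟨N, hN⟩ := exists_close γ.continuous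
  choose ω hω using hN (N + 1) (by omega)
  let Φ : unitInterval → Path.Homotopic.Quotient (γ 0) (A.word (ω 0) (N + 1) le_rfl).path :=
    fun s => (Path.Homotopic.Quotient.mk (γ.subpath 0 s)).trans
      (A.retract (ω 0) (hω s).self_of_nhds)
  have hΦ : IsLocallyConstant Φ := by
    rw [IsLocallyConstant.iff_eventually_eq]
    intro s
    obtain ⟨ε, hε, hball⟩ := Metric.eventually_nhds_iff_ball.1 (hω s)
    filter_upwards [Metric.ball_mem_nhds s hε] with s' hs'
    have h : ∀ r ∈ Set.uIcc s s', Close (N + 1) (ω s).toFun (γ r) := by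
      intro r hr
      refine hball r ?_
      have h1 : |(s' : ℝ) - s| < ε := hs'
      change |(r : ℝ) - s| < ε
      refine lt_of_le_of_lt (Set.abs_sub_left_of_mem_uIcc ?_) h1
      rw [Set.mem_uIcc] at hr ⊢
      exact hr
    simp only [Φ]
    rw [A.retract_eq hK (ω 0) (hω s').self_of_nhds (h s' Set.right_mem_uIcc),
      A.retract_eq hK (ω 0) (hω s).self_of_nhds (h s Set.left_mem_uIcc),
      ← A.mk_subpath_trans_retract (ω 0) γ h, ← Path.Homotopic.Quotient.trans_assoc]
    congr 1
    rw [← Path.Homotopic.Quotient.mk_trans, Path.Homotopic.Quotient.eq]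
    exact ⟨(Path.Homotopy.subpathTransSubpath γ 0 s s').symm⟩
  have h01 := hΦ.apply_eq_of_preconnectedSpace 0 1
  simp only [Φ, Path.subpath_self, Path.Homotopic.Quotient.mk_refl,
    Path.Homotopic.Quotient.refl_trans] at h01
  have key : ∀ (a b : Path (pt x) (pt y)) (ha : a = q) (hb : b = q) (δ : Path a b)
      (_ : δ = γ.cast ha hb) (h0 : Close (N + 1) (ω 0).toFun a)
      (h1 : Close (N + 1) (ω 1).toFun b)
      (_ : A.retract (ω 0) h0 = (Path.Homotopic.Quotient.mk δ).trans (A.retract (ω 0) h1)),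
      Path.Homotopic.Quotient.mk γ = .refl q := by
    rintro _ _ rfl rfl _ rfl h0 h1 h
    rw [Path.cast_rfl_rfl, A.retract_eq hK (ω 0) h1 h0] at h
    have := congrArg (fun R => R.trans (A.retract (ω 0) h0).symm) h
    simpa using this.symm
  exact key _ _ γ.source γ.target _ γ.subpath_zero_one _ _ h01

theorem joined (A : K.Fan x) (p q : Path (pt x) (pt y)) : Joined p q := by
  obtain ⟨N, hN⟩ := exists_close (T := Unit) (Γ := fun _ => p) continuous_const
  obtain ⟨N', hN'⟩ := exists_close (T := Unit) (Γ := fun _ => q) continuous_const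
  obtain ⟨ω, hω⟩ := hN (N + N' + 1) (by omega) ()
  obtain ⟨ω', hω'⟩ := hN' (N + N' + 1) (by omega) ()
  obtain ⟨γ, -⟩ := Path.Homotopic.Quotient.mk_surjective (A.retract ω hω.self_of_nhds)
  obtain ⟨γ', -⟩ := Path.Homotopic.Quotient.mk_surjective (A.retract ω hω'.self_of_nhds)
  exact ⟨γ.trans γ'.symm⟩

end Fan

end SComplex

section Spheres

theorem homotopic_of_surjective {A S X : Type*} [TopologicalSpace A] [TopologicalSpace S]
    [TopologicalSpace X] [CompactSpace A] [T2Space S] {q : A → S} (hq : Continuous q)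
    (hsurj : Function.Surjective q) (F : C(unitInterval × A, X)) {f g : C(S, X)}
    (hF : ∀ s a b, q a = q b → F (s, a) = F (s, b)) (hf : ∀ a, F (0, a) = f (q a))
    (hg : ∀ a, F (1, a) = g (q a)) : f.Homotopic g := by
  have : CompactSpace S := hsurj.compactSpace hq
  let Q : C(unitInterval × A, unitInterval × S) := ⟨Prod.map id q, continuous_id.prodMap hq⟩
  have hQ : Topology.IsQuotientMap Q :=
    Topology.IsQuotientMap.of_surjective_continuous
      (Function.Surjective.prodMap Function.surjective_id hsurj) Q.continuous
  have hfac : Function.FactorsThrough F Q := by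
    rintro ⟨s, a⟩ ⟨s', b⟩ h
    obtain ⟨rfl, h⟩ := Prod.ext_iff.1 h
    exact hF s a b h
  have hG : ∀ s a, hQ.lift F hfac (s, q a) = F (s, a) := fun s a =>
    DFunLike.congr_fun (hQ.lift_comp F hfac) (s, a)
  exact ⟨{ toContinuousMap := hQ.lift F hfac
           map_zero_left := hsurj.forall.2 fun a => (hG 0 a).trans (hf a)
           map_one_left := hsurj.forall.2 fun a => (hG 1 a).trans (hg a) }⟩

open Real

theorem exists_polar (a b : ℝ) : ∃ θ : unitInterval,
    √(a ^ 2 + b ^ 2) * cos (2 * π * θ) = a ∧ √(a ^ 2 + b ^ 2) * sin (2 * π * θ) = b := by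
  have hn : ‖(⟨a, b⟩ : ℂ)‖ = √(a ^ 2 + b ^ 2) := by
    rw [Complex.norm_eq_sqrt_sq_add_sq]
  have h1 := Complex.norm_mul_cos_arg ⟨a, b⟩
  have h2 := Complex.norm_mul_sin_arg ⟨a, b⟩
  rw [hn] at h1 h2
  have hpi := Real.pi_pos
  have hlt := Complex.neg_pi_lt_arg ⟨a, b⟩
  have hle := Complex.arg_le_pi ⟨a, b⟩
  by_cases h : 0 ≤ Complex.arg ⟨a, b⟩
  · refine ⟨⟨Complex.arg ⟨a, b⟩ / (2 * π), by positivity, ?_⟩, ?_⟩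
    · rw [div_le_one (by positivity)]
      linarith
    · have : 2 * π * (Complex.arg ⟨a, b⟩ / (2 * π)) = Complex.arg ⟨a, b⟩ := by field_simp
      simp only [this]
      exact ⟨h1, h2⟩
  · refine ⟨⟨Complex.arg ⟨a, b⟩ / (2 * π) + 1, ?_, ?_⟩, ?_⟩
    · have : -1 ≤ Complex.arg ⟨a, b⟩ / (2 * π) := by
        rw [le_div_iff₀ (by positivity)]
        linarith
      linarith
    · have : Complex.arg ⟨a, b⟩ / (2 * π) ≤ 0 :=
        div_nonpos_of_nonpos_of_nonneg (by linarith) (by positivity)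
      linarith
    · have : 2 * π * (Complex.arg ⟨a, b⟩ / (2 * π) + 1) = Complex.arg ⟨a, b⟩ + 2 * π := by
        field_simp
      simp only [this, Real.cos_add_two_pi, Real.sin_add_two_pi]
      exact ⟨h1, h2⟩

theorem eq_or_endpoints {θ θ' : unitInterval} (hc : cos (2 * π * θ) = cos (2 * π * θ'))
    (hs : sin (2 * π * θ) = sin (2 * π * θ')) :
    θ = θ' ∨ (θ = 0 ∧ θ' = 1) ∨ (θ = 1 ∧ θ' = 0) := by
  obtain ⟨k, hk⟩ := Real.Angle.angle_eq_iff_two_pi_dvd_sub.1 (Real.Angle.cos_sin_inj hc hs)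
  have hk' : (θ : ℝ) - θ' = k :=
    mul_left_cancel₀ Real.two_pi_pos.ne' (by linarith)
  obtain ⟨h1, h2⟩ := θ.2
  obtain ⟨h3, h4⟩ := θ'.2
  have hk1 : (-1 : ℤ) ≤ k := by exact_mod_cast (by push_cast; linarith : ((-1 : ℤ) : ℝ) ≤ k)
  have hk2 : k ≤ (1 : ℤ) := by exact_mod_cast (by push_cast; linarith : (k : ℝ) ≤ (1 : ℤ))
  obtain rfl | rfl | rfl : k = -1 ∨ k = 0 ∨ k = 1 := by omega
  · refine Or.inr (Or.inl ⟨Subtype.ext ?_, Subtype.ext ?_⟩) <;> push_cast at hk' ⊢ <;> linarith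
  · exact Or.inl (Subtype.ext (by push_cast at hk'; linarith))
  · refine Or.inr (Or.inr ⟨Subtype.ext ?_, Subtype.ext ?_⟩) <;> push_cast at hk' ⊢ <;> linarith

variable {X : Type*} [TopologicalSpace X]

theorem nullhomotopic_of_joined [Nonempty X] (h : ∀ a b : X, Joined a b)
    (f : C(Metric.sphere (0 : EuclideanSpace ℝ (Fin 1)) 1, X)) : f.Nullhomotopic := by
  have hfin : Finite (Metric.sphere (0 : EuclideanSpace ℝ (Fin 1)) 1) := by
    refine Finite.of_injective (β := ({1, -1} : Set ℝ)) (fun z => ⟨z.1 0, ?_⟩) fun z w hzw => ?_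
    · have := mem_sphere_zero_iff_norm.1 z.2
      rw [EuclideanSpace.norm_eq, Fin.sum_univ_one, Real.sqrt_sq (norm_nonneg _),
        Real.norm_eq_abs] at this
      rcases abs_eq (zero_le_one) |>.1 this with h | h <;> simp [h]
    · refine Subtype.ext (PiLp.ext fun i => ?_)
      rw [Fin.eq_zero i]
      exact congrArg Subtype.val hzw
  obtain ⟨b⟩ := ‹Nonempty X›
  exact ⟨b, ⟨{ toFun := fun z => (h (f z.2) b).somePath z.1
               continuous_toFun := continuous_prod_of_discrete_right.2 fun z =>
                 (h (f z) b).somePath.continuous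
               map_zero_left := by simp
               map_one_left := by simp }⟩⟩

/-- The parametrization of the circle by the unit interval. -/
noncomputable def circlePoint (θ : unitInterval) :
    Metric.sphere (0 : EuclideanSpace ℝ (Fin 2)) 1 :=
  ⟨!₂[cos (2 * π * θ), sin (2 * π * θ)], by
    simp [EuclideanSpace.norm_eq, Fin.sum_univ_two]⟩

theorem continuous_circlePoint : Continuous circlePoint := by
  refine Continuous.subtype_mk ((PiLp.continuous_toLp 2 _).comp (continuous_pi fun i => ?_)) _
  fin_cases i <;> simp <;> fun_prop

theorem circlePoint_surjective : Function.Surjective circlePoint := by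
  intro z
  have h := mem_sphere_zero_iff_norm.1 z.2
  rw [EuclideanSpace.norm_eq, Fin.sum_univ_two] at h
  simp only [Real.norm_eq_abs, sq_abs] at h
  obtain ⟨θ, h1, h2⟩ := exists_polar (z.1 0) (z.1 1)
  rw [h, one_mul] at h1 h2
  refine ⟨θ, Subtype.ext (PiLp.ext fun i => ?_)⟩
  fin_cases i
  · exact h1
  · exact h2

theorem circlePoint_zero_eq_one : circlePoint 0 = circlePoint 1 := by
  simp [circlePoint]

theorem nullhomotopic_of_loops_joined (f : C(Metric.sphere (0 : EuclideanSpace ℝ (Fin 2)) 1, X))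
    (h : ∀ p q : Path (f (circlePoint 0)) (f (circlePoint 0)), Joined p q) : f.Nullhomotopic := by
  let p : Path (f (circlePoint 0)) (f (circlePoint 0)) :=
    { toFun := fun θ => f (circlePoint θ)
      continuous_toFun := f.continuous.comp continuous_circlePoint
      source' := rfl
      target' := by rw [circlePoint_zero_eq_one] }
  obtain ⟨γ⟩ := h p (Path.refl _)
  refine ⟨f (circlePoint 0), homotopic_of_surjective continuous_circlePoint circlePoint_surjective
    ⟨fun z => γ z.1 z.2, by fun_prop⟩ (fun s a b hab => ?_) (fun a => ?_) (fun a => ?_)⟩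
  · have h0 := congrArg (fun z => z.1 0) hab
    have h1 := congrArg (fun z => z.1 1) hab
    rcases eq_or_endpoints (by simpa [circlePoint] using h0) (by simpa [circlePoint] using h1) with
      rfl | ⟨rfl, rfl⟩ | ⟨rfl, rfl⟩ <;> simp
  · simp [p]
  · simp

/-- The parametrization of the sphere by longitude and colatitude. -/
noncomputable def spherePoint (z : unitInterval × unitInterval) :
    Metric.sphere (0 : EuclideanSpace ℝ (Fin 3)) 1 :=
  ⟨!₂[sin (π * z.2) * cos (2 * π * z.1), sin (π * z.2) * sin (2 * π * z.1), cos (π * z.2)], by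
    rw [mem_sphere_zero_iff_norm, EuclideanSpace.norm_eq, Real.sqrt_eq_one, Fin.sum_univ_three]
    simp only [Real.norm_eq_abs, sq_abs]
    simp
    nlinarith [Real.sin_sq_add_cos_sq (π * z.2), Real.sin_sq_add_cos_sq (2 * π * z.1)]⟩

theorem continuous_spherePoint : Continuous spherePoint := by
  refine Continuous.subtype_mk ((PiLp.continuous_toLp 2 _).comp (continuous_pi fun i => ?_)) _
  fin_cases i <;> simp <;> fun_prop

/-- The colatitude of a point of the sphere. -/
noncomputable def colatitude (z : Metric.sphere (0 : EuclideanSpace ℝ (Fin 3)) 1) :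
    unitInterval :=
  ⟨arccos (z.1 2) / π, div_nonneg (Real.arccos_nonneg _) Real.pi_pos.le,
    (div_le_one Real.pi_pos).2 (Real.arccos_le_pi _)⟩

theorem continuous_colatitude : Continuous colatitude := by
  unfold colatitude
  fun_prop

theorem colatitude_spherePoint (z : unitInterval × unitInterval) :
    colatitude (spherePoint z) = z.2 := by
  have hpi := Real.pi_pos
  refine Subtype.ext ?_
  change arccos (cos (π * z.2)) / π = z.2
  rw [Real.arccos_cos (mul_nonneg hpi.le z.2.2.1) (mul_le_of_le_one_right hpi.le z.2.2.2)]
  field_simp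

theorem spherePoint_surjective : Function.Surjective spherePoint := by
  intro z
  have h := mem_sphere_zero_iff_norm.1 z.2
  rw [EuclideanSpace.norm_eq, Real.sqrt_eq_one, Fin.sum_univ_three] at h
  simp only [Real.norm_eq_abs, sq_abs] at h
  obtain ⟨θ, h1, h2⟩ := exists_polar (z.1 0) (z.1 1)
  have hc : π * (colatitude z : ℝ) = arccos (z.1 2) := by
    have hpi := Real.pi_pos
    change π * (arccos (z.1 2) / π) = _
    field_simp
  have hs : sin (π * (colatitude z : ℝ)) = √(z.1 0 ^ 2 + z.1 1 ^ 2) := by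
    rw [hc, Real.sin_arccos]
    congr 1
    linarith
  refine ⟨(θ, colatitude z), Subtype.ext (PiLp.ext fun i => ?_)⟩
  fin_cases i
  · change sin (π * (colatitude z : ℝ)) * cos (2 * π * θ) = _
    rw [hs, h1]
    rfl
  · change sin (π * (colatitude z : ℝ)) * sin (2 * π * θ) = _
    rw [hs, h2]
    rfl
  · change cos (π * (colatitude z : ℝ)) = _
    rw [hc, Real.cos_arccos]
    · rfl
    · nlinarith [sq_nonneg (z.1 0), sq_nonneg (z.1 1)]
    · nlinarith [sq_nonneg (z.1 0), sq_nonneg (z.1 1)]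

theorem spherePoint_pole_zero (θ : unitInterval) : spherePoint (θ, 0) = spherePoint (0, 0) := by
  simp [spherePoint]

theorem spherePoint_pole_one (θ : unitInterval) : spherePoint (θ, 1) = spherePoint (0, 1) := by
  simp [spherePoint]

theorem spherePoint_zero_eq_one (t : unitInterval) : spherePoint (0, t) = spherePoint (1, t) := by
  simp [spherePoint]

theorem eq_of_spherePoint_eq {z w : unitInterval × unitInterval}
    (h : spherePoint z = spherePoint w) : z.2 = w.2 ∧ (z.2 = 0 ∨ z.2 = 1 ∨ z.1 = w.1 ∨
      (z.1 = 0 ∧ w.1 = 1) ∨ (z.1 = 1 ∧ w.1 = 0)) := by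
  have ht : z.2 = w.2 := by rw [← colatitude_spherePoint z, h, colatitude_spherePoint]
  refine ⟨ht, ?_⟩
  by_cases h0 : z.2 = 0
  · exact Or.inl h0
  by_cases h1 : z.2 = 1
  · exact Or.inr (Or.inl h1)
  have hpi := Real.pi_pos
  have hpos : 0 < sin (π * (z.2 : ℝ)) := by
    refine Real.sin_pos_of_pos_of_lt_pi (mul_pos hpi (unitInterval.pos_iff_ne_zero.2 h0)) ?_
    have : (z.2 : ℝ) < 1 := unitInterval.lt_one_iff_ne_one.2 h1
    nlinarith
  have e0 : sin (π * (z.2 : ℝ)) * cos (2 * π * z.1) = sin (π * (w.2 : ℝ)) * cos (2 * π * w.1) :=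
    congrArg (fun z => z.1 0) h
  have e1 : sin (π * (z.2 : ℝ)) * sin (2 * π * z.1) = sin (π * (w.2 : ℝ)) * sin (2 * π * w.1) :=
    congrArg (fun z => z.1 1) h
  rw [← ht] at e0 e1
  exact Or.inr (Or.inr (eq_or_endpoints (mul_left_cancel₀ hpos.ne' e0)
    (mul_left_cancel₀ hpos.ne' e1)))

theorem nullhomotopic_of_path_loops (f : C(Metric.sphere (0 : EuclideanSpace ℝ (Fin 3)) 1, X))
    (h : ∀ (p : Path (f (spherePoint (0, 0))) (f (spherePoint (0, 1)))) (γ : Path p p),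
      γ.Homotopic (Path.refl p)) : f.Nullhomotopic := by
  let m (θ : unitInterval) : Path (f (spherePoint (0, 0))) (f (spherePoint (0, 1))) :=
    { toFun := fun t => f (spherePoint (θ, t))
      continuous_toFun := f.continuous.comp (continuous_spherePoint.comp (by fun_prop))
      source' := by rw [spherePoint_pole_zero]
      target' := by rw [spherePoint_pole_one] }
  let γ : Path (m 0) (m 0) :=
    { toFun := m
      continuous_toFun := Path.continuous_uncurry_iff.1 (f.continuous.comp continuous_spherePoint)
      source' := rfl
      target' := Path.ext (funext fun t => congrArg f (spherePoint_zero_eq_one t).symm) }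
  obtain ⟨H⟩ := h _ γ
  let g : C(Metric.sphere (0 : EuclideanSpace ℝ (Fin 3)) 1, X) :=
    (m 0 : C(unitInterval, X)).comp ⟨colatitude, continuous_colatitude⟩
  have : ContractibleSpace unitInterval :=
    (convex_Icc (0 : ℝ) 1).contractibleSpace ⟨0, by simp⟩
  have hg : g.Nullhomotopic := ((id_nullhomotopic unitInterval).comp_right
    (m 0 : C(unitInterval, X))).comp_left ⟨colatitude, continuous_colatitude⟩
  obtain ⟨b, hb⟩ := hg
  refine ⟨b, ContinuousMap.Homotopic.trans ?_ hb⟩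
  refine homotopic_of_surjective continuous_spherePoint spherePoint_surjective
    ⟨fun z => H (z.1, z.2.1) z.2.2, by fun_prop⟩ (fun s z w hzw => ?_) (fun z => ?_) (fun z => ?_)
  · obtain ⟨ht, hz⟩ := eq_of_spherePoint_eq hzw
    obtain ⟨θ, t⟩ := z
    obtain ⟨θ', t'⟩ := w
    simp only at ht hz
    subst ht
    rcases hz with rfl | rfl | rfl | ⟨rfl, rfl⟩ | ⟨rfl, rfl⟩ <;> simp
  · simp [γ, m]
  · simp [g, colatitude_spherePoint]

end Spheres

namespace SComplex

variable {V : Type*} {K : SComplex V}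

theorem nonempty_vertexSet (hK : K.IsConic 8) : Nonempty K.vertexSet := by
  obtain ⟨u, -⟩ := IsConic.exists_cones (r := 8) hK [] (by simp) ∅ (by simp) (by simp)
  exact ⟨u⟩

theorem joined_pt (hK : K.IsConic 8) (x y : K.vertexSet) : Joined (pt x) (pt y) := by
  obtain ⟨u, hu⟩ := IsConic.exists_cones (r := 8) hK [x.1, y.1] (by simp) {{x.1}, {y.1}}
    (by rintro _ (rfl | rfl); exacts [x.2, y.2]) (by rintro _ (rfl | rfl) <;> simp)
  let ω : K.Word 2 x y :=
    { toFun := fun i => match i with | 0 => x | 1 => u | _ => y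
      adj := fun i hi => by
        obtain rfl | rfl : i = 0 ∨ i = 1 := by omega
        · rw [Finset.pair_comm]
          exact hu _ (Or.inl rfl)
        · exact hu _ (Or.inr rfl)
      map_zero := rfl
      map_of_le := fun i hi => match i, hi with | i + 2, _ => rfl }
  exact ⟨ω.path⟩

/-- Any point can be moved to a vertex by a deformation of the realization fixing all vertices. -/
theorem exists_push (z : K.space) : ∃ φ : C(K.space, K.space),
    (ContinuousMap.id K.space).Homotopic φ ∧ (∃ v, φ z = pt v) ∧ ∀ w, φ (pt w) = pt w := by
  obtain ⟨v, hv⟩ := exists_ne_zero z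
  have hz : 0 < (z : V → ℝ) v := lt_of_le_of_ne (realization_nonneg z.2 v) hv.symm
  have hvK : v ∈ K.vertexSet :=
    mem_faces_of_ne_zero z.2 (singleton_nonempty v) (by simpa using hv)
  let μ : K.space → ℝ := fun a => min 1 ((a : V → ℝ) v / (z : V → ℝ) v)
  have hμ : Continuous μ := continuous_const.min ((continuous_coord v).div_const _)
  have hμ0 : ∀ a, 0 ≤ μ a := fun a =>
    le_min zero_le_one (div_nonneg (realization_nonneg a.2 v) hz.le)
  have hμ1 : ∀ a, μ a ≤ 1 := fun a => min_le_left _ _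
  let G : unitInterval × K.space → V → ℝ := fun b w =>
    (1 - b.1 * μ b.2) * (b.2 : V → ℝ) w + b.1 * μ b.2 * (Pi.single v 1 : V → ℝ) w
  have hG : ∀ b, G b ∈ K.realization := by
    rintro ⟨s, a⟩
    have h0 : 0 ≤ (s : ℝ) * μ a := mul_nonneg s.2.1 (hμ0 a)
    have h1 : (s : ℝ) * μ a ≤ 1 := mul_le_one₀ s.2.2 (hμ0 a) (hμ1 a)
    obtain ⟨σ, hσ, hpos, hsupp, hsum⟩ := a.2
    have hvσ : v ∉ σ → μ a = 0 := fun hv' => by simp [μ, hsupp v hv']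
    refine ⟨σ, hσ, fun w => ?_, fun w hw => ?_, ?_⟩
    · have : 0 ≤ (Pi.single v 1 : V → ℝ) w := by
        rw [Pi.single_apply]; split_ifs <;> norm_num
      exact add_nonneg (mul_nonneg (by linarith) (hpos w)) (mul_nonneg h0 this)
    · simp only [G, hsupp w hw, mul_zero, zero_add]
      by_cases hwv : w = v
      · rw [hvσ (hwv ▸ hw)]
        simp
      · simp [hwv]
    · simp only [G]
      rw [Finset.sum_add_distrib, ← Finset.mul_sum, ← Finset.mul_sum, hsum,
        Finset.sum_pi_single']
      by_cases hv' : v ∈ σ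
      · simp [hv']
      · simp [hvσ hv']
  have hGc : Continuous fun b => (⟨G b, hG b⟩ : K.space) := by
    refine Continuous.subtype_mk (continuous_pi fun w => ?_) _
    have hw := (continuous_coord (K := K) w).comp (continuous_snd (X := unitInterval))
    have hμ' : Continuous fun b : unitInterval × K.space => (b.1 : ℝ) * μ b.2 :=
      (continuous_subtype_val.comp continuous_fst).mul (hμ.comp continuous_snd)
    exact ((continuous_const.sub hμ').mul hw).add (hμ'.mul continuous_const)
  refine ⟨⟨fun a => ⟨G (1, a), hG _⟩, hGc.comp (by fun_prop)⟩,
    ⟨{ toFun := fun b => ⟨G b, hG b⟩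
       continuous_toFun := hGc
       map_zero_left := fun a => Subtype.ext (funext fun w => by simp [G])
       map_one_left := fun a => rfl }⟩,
    ⟨⟨v, hvK⟩, Subtype.ext (funext fun w => ?_)⟩, fun w => Subtype.ext (funext fun w' => ?_)⟩
  · simp [G, μ, hz.ne', pt_coe]
  · by_cases hwv : v = w.1
    · simp only [ContinuousMap.coe_mk, G, pt_coe, hwv]
      ring
    · have : μ (pt w) = 0 := by simp [μ, pt_coe, hwv]
      simp [G, this]

theorem joined_space (hK : K.IsConic 8) (a b : K.space) : Joined a b := by
  have key : ∀ a : K.space, ∃ v, Joined a (pt v) := fun a => by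
    obtain ⟨φ, ⟨H⟩, ⟨v, hv⟩, -⟩ := exists_push a
    exact ⟨v, ⟨(H.evalAt a).cast rfl hv.symm⟩⟩
  obtain ⟨v, hv⟩ := key a
  obtain ⟨w, hw⟩ := key b
  exact (hv.trans (joined_pt hK v w)).trans hw.symm

/-- Two points can be moved to vertices simultaneously. -/
theorem exists_push_two (a b : K.space) : ∃ φ : C(K.space, K.space),
    (ContinuousMap.id K.space).Homotopic φ ∧ (∃ v, φ a = pt v) ∧ ∃ w, φ b = pt w := by
  obtain ⟨φ, hφ, ⟨v, hv⟩, -⟩ := exists_push a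
  obtain ⟨ψ, hψ, ⟨w, hw⟩, hψ'⟩ := exists_push (φ b)
  exact ⟨ψ.comp φ, hψ.comp hφ, ⟨v, by rw [ContinuousMap.comp_apply, hv, hψ']⟩, w, hw⟩

theorem nullhomotopic_of_push {S : Type*} [TopologicalSpace S] {f : C(S, K.space)}
    {φ : C(K.space, K.space)} (hφ : (ContinuousMap.id K.space).Homotopic φ)
    (h : (φ.comp f).Nullhomotopic) : f.Nullhomotopic :=
  h.imp fun _ hb => (hφ.comp (ContinuousMap.Homotopic.refl f)).trans hb

end SComplex

/-- Every `8`-conic simplicial complex is `2`-connected. -/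
theorem eight_conic_implies_two_connected {V : Type*} (K : SComplex V)
    (hK : K.IsConic 8) :
    NConnected 2 K.space := by
  obtain ⟨v₀⟩ := SComplex.nonempty_vertexSet hK
  have : Nonempty K.space := ⟨SComplex.pt v₀⟩
  refine ⟨this, fun k hk f => ?_⟩
  obtain rfl | rfl | rfl : k = 0 ∨ k = 1 ∨ k = 2 := by omega
  · exact nullhomotopic_of_joined (SComplex.joined_space hK) f
  · obtain ⟨φ, hφ, ⟨v, hv⟩, -⟩ := SComplex.exists_push (f (circlePoint 0))
    refine SComplex.nullhomotopic_of_push hφ (nullhomotopic_of_loops_joined (φ.comp f) ?_)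
    rw [ContinuousMap.comp_apply, hv]
    obtain ⟨A⟩ := SComplex.IsConic.nonempty_fan hK v
    exact A.joined
  · obtain ⟨φ, hφ, ⟨v, hv⟩, w, hw⟩ := SComplex.exists_push_two (f (spherePoint (0, 0)))
      (f (spherePoint (0, 1)))
    refine SComplex.nullhomotopic_of_push hφ (nullhomotopic_of_path_loops (φ.comp f) ?_)
    rw [ContinuousMap.comp_apply, ContinuousMap.comp_apply, hv, hw]
    obtain ⟨A⟩ := SComplex.IsConic.nonempty_fan hK v
    exact fun p γ => Path.Homotopic.Quotient.exact (A.mk_eq_refl hK p γ)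
end

section
/- For every integer n ≥ 0 there exists an infinite simplicial complex K which is (2n+1)-ample but whose geometric realization is not n-connected. In particular, 3-ampleness does not imply simple connectivity. -/
open Finset
open scoped Classical

section Brouwer

open Set MeasureTheory Metric Topology

/-- The determinant of `1 + A` is a universal affine combination of the determinants of
`1 + tᵢ A` for sufficiently many distinct nodes `tᵢ`. -/
theorem exists_det_one_add_eq_sum {E : Type*} [NormedAddCommGroup E] [NormedSpace ℝ E]
    [FiniteDimensional ℝ E] {t : ℕ → ℝ} (ht : Function.Injective t) :
    ∃ (N : Finset ℕ) (w : ℕ → ℝ), ∑ i ∈ N, w i = 1 ∧ ∀ A : E →L[ℝ] E,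
      (ContinuousLinearMap.id ℝ E + A).det =
        ∑ i ∈ N, w i * (ContinuousLinearMap.id ℝ E + t i • A).det := by
  let N := Finset.range (Module.finrank ℝ E + 1)
  have hinj : Set.InjOn t N := ht.injOn
  have hN : N.Nonempty := ⟨0, by simp [N]⟩
  refine ⟨N, fun i ↦ (Lagrange.basis N t i).eval 1, ?_, fun A ↦ ?_⟩
  · rw [← Polynomial.eval_finsetSum, Lagrange.sum_basis hinj hN, Polynomial.eval_one]
  let b := Module.finBasis ℝ E
  let M := LinearMap.toMatrix b b (A : E →ₗ[ℝ] E)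
  let p : Polynomial ℝ :=
    ((Polynomial.X : Polynomial ℝ) • M.map Polynomial.C + (1 : Matrix _ _ ℝ).map Polynomial.C).det
  have hp : ∀ s : ℝ, p.eval s = (ContinuousLinearMap.id ℝ E + s • A).det := by
    intro s
    have h : LinearMap.toMatrix b b
        ((ContinuousLinearMap.id ℝ E + s • A : E →L[ℝ] E) : E →ₗ[ℝ] E) = s • M + 1 := by
      rw [add_comm]
      simp [M]
    rw [ContinuousLinearMap.det, ← LinearMap.det_toMatrix b, h]
    change Polynomial.evalRingHom s (Matrix.det _) = _
    rw [RingHom.map_det]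
    congr 1
    ext i j
    by_cases hij : i = j <;> simp [hij, mul_comm s]
  have hdeg : p.degree < (N.card : WithBot ℕ) := by
    refine lt_of_le_of_lt Polynomial.degree_le_natDegree ?_
    have := Polynomial.natDegree_det_X_add_C_le M 1
    simp only [Fintype.card_fin] at this
    rw [Nat.cast_lt]
    simp only [N, Finset.card_range]
    exact Nat.lt_succ_of_le this
  have key := congrArg (Polynomial.eval 1) (Lagrange.eq_interpolate hinj hdeg)
  rw [hp 1, one_smul, Lagrange.interpolate_apply, Polynomial.eval_finsetSum] at key
  rw [key]
  refine Finset.sum_congr rfl fun i _ ↦ ?_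
  rw [Polynomial.eval_mul, Polynomial.eval_C, hp, mul_comm]

/-- There is no `C¹` map of the ball to its boundary sphere fixing the sphere pointwise. -/
theorem not_contDiff_retraction_sphere {E : Type*} [NormedAddCommGroup E] [InnerProductSpace ℝ E]
    [FiniteDimensional ℝ E] {R : ℝ} (hR : 0 < R) {r : E → E} (hr : ContDiff ℝ 1 r)
    (hnorm : ∀ x, ‖r x‖ = R) (hfix : ∀ x, ‖x‖ = R → r x = x) : False := by
  borelize E
  let u : E → E := fun x ↦ r x - x
  have hu : ContDiff ℝ 1 u := hr.sub contDiff_id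
  have hu' : Continuous (fderiv ℝ u) := hu.continuous_fderiv one_ne_zero
  have hud : Differentiable ℝ u := hu.differentiable one_ne_zero
  obtain ⟨C, hC⟩ := (isCompact_closedBall (0 : E) R).exists_bound_of_continuousOn
    (hu'.continuousOn)
  have hC0 : 0 ≤ C := (norm_nonneg _).trans (hC 0 (by simp [hR.le]))
  have hlip : ∀ x ∈ closedBall (0 : E) R, ∀ y ∈ closedBall (0 : E) R,
      ‖u x - u y‖ ≤ C * ‖x - y‖ := fun x hx y hy ↦
    (convex_closedBall (0 : E) R).norm_image_sub_le_of_norm_fderiv_le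
      (fun z _ ↦ hud z) hC hy hx
  obtain ⟨δ, hδ, hδdet⟩ : ∃ δ > 0, ∀ A : E →L[ℝ] E, ‖A‖ < δ →
      0 < (ContinuousLinearMap.id ℝ E + A).det := by
    have hcont : Continuous fun A : E →L[ℝ] E ↦ (ContinuousLinearMap.id ℝ E + A).det :=
      ContinuousLinearMap.continuous_det.comp (continuous_const.add continuous_id)
    have h0 : (0 : ℝ) < (ContinuousLinearMap.id ℝ E + (0 : E →L[ℝ] E)).det := by
      simp [ContinuousLinearMap.det]
    obtain ⟨δ, hδ, h⟩ := Metric.eventually_nhds_iff.1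
      (hcont.continuousAt.eventually (lt_mem_nhds h0))
    exact ⟨δ, hδ, fun A hA ↦ h (by simpa using hA)⟩
  have hderiv : ∀ (t : ℝ) (x : E), HasStrictFDerivAt (fun x ↦ x + t • u x)
      (ContinuousLinearMap.id ℝ E + t • fderiv ℝ u x) x := fun t x ↦
    (hasStrictFDerivAt_id x).add
      (((hu.contDiffAt (x := x)).hasStrictFDerivAt one_ne_zero).const_smul t)
  have hvol : ∀ t : ℝ, 0 ≤ t → t < 1 → t * C < 1 → t * C < δ →
      ∫ x in ball (0 : E) R, (ContinuousLinearMap.id ℝ E + t • fderiv ℝ u x).det =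
        volume.real (ball (0 : E) R) := by
    intro t ht0 ht1 htC htδ
    set g : E → E := fun x ↦ x + t • u x with hg
    have hgc : Continuous g := continuous_id.add (hu.continuous.const_smul t)
    have hpos : ∀ x ∈ closedBall (0 : E) R,
        0 < (ContinuousLinearMap.id ℝ E + t • fderiv ℝ u x).det := by
      intro x hx
      refine hδdet _ (lt_of_le_of_lt ?_ htδ)
      rw [norm_smul, Real.norm_of_nonneg ht0]
      exact mul_le_mul_of_nonneg_left (hC x hx) ht0
    have hinj : InjOn g (closedBall (0 : E) R) := by
      intro x hx y hy hxy
      have h1 : x - y = t • (u y - u x) := by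
        simp only [hg] at hxy
        rw [smul_sub, sub_eq_sub_iff_add_eq_add, hxy, add_comm]
      have h2 : ‖x - y‖ ≤ t * C * ‖x - y‖ := by
        calc ‖x - y‖ = t * ‖u x - u y‖ := by
              rw [h1, norm_smul, Real.norm_of_nonneg ht0, norm_sub_rev]
          _ ≤ t * (C * ‖x - y‖) := mul_le_mul_of_nonneg_left (hlip x hx y hy) ht0
          _ = _ := by ring
      have h3 : ‖x - y‖ = 0 := by nlinarith [norm_nonneg (x - y)]
      exact sub_eq_zero.1 (norm_eq_zero.1 h3)
    have hmaps : MapsTo g (ball (0 : E) R) (ball (0 : E) R) := by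
      intro x hx
      rw [mem_ball_zero_iff] at hx ⊢
      have : g x = (1 - t) • x + t • r x := by simp only [hg, u]; module
      calc ‖g x‖ ≤ ‖(1 - t) • x‖ + ‖t • r x‖ := this ▸ norm_add_le _ _
        _ = (1 - t) * ‖x‖ + t * R := by
          rw [norm_smul, norm_smul, Real.norm_of_nonneg ht0,
            Real.norm_of_nonneg (by linarith), hnorm]
        _ < R := by nlinarith
    have hopen : IsOpen (g '' ball (0 : E) R) := by
      rw [isOpen_iff_mem_nhds]
      rintro _ ⟨x, hx, rfl⟩
      have hd := hderiv t x
      rw [← ContinuousLinearMap.coe_toContinuousLinearEquivOfDetNeZero _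
        (hpos x (ball_subset_closedBall hx)).ne'] at hd
      rw [← hd.map_nhds_eq_of_equiv]
      exact Filter.image_mem_map (isOpen_ball.mem_nhds hx)
    have hclosed : IsClosed (g '' closedBall (0 : E) R) :=
      ((isCompact_closedBall _ _).image hgc).isClosed
    have himage : g '' ball (0 : E) R = ball (0 : E) R := by
      refine Subset.antisymm hmaps.image_subset ?_
      have hsub : ball (0 : E) R ∩ g '' closedBall (0 : E) R ⊆ g '' ball (0 : E) R := by
        rintro _ ⟨hy, x, hx, rfl⟩
        refine ⟨x, ?_, rfl⟩
        rw [mem_closedBall_zero_iff] at hx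
        rw [mem_ball_zero_iff] at hy ⊢
        refine lt_of_le_of_ne hx fun hxR ↦ ?_
        simp [hg, u, hfix x hxR, hxR] at hy
      have hconn : IsPreconnected (ball (0 : E) R) := (convex_ball _ _).isPreconnected
      refine hconn.subset_left_of_subset_union hopen hclosed.isOpen_compl ?_ ?_ ?_
      · exact disjoint_compl_right.mono_left (image_mono ball_subset_closedBall)
      · intro y hy
        by_cases h : y ∈ g '' closedBall (0 : E) R
        · exact Or.inl (hsub ⟨hy, h⟩)
        · exact Or.inr h
      · exact ⟨g 0, hmaps (by simp [hR]), mem_image_of_mem g (by simp [hR])⟩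
    have hcv := integral_image_eq_integral_abs_det_fderiv_smul volume
      (measurableSet_ball (x := (0 : E)) (ε := R))
      (fun x _ ↦ (hderiv t x).hasFDerivAt.hasFDerivWithinAt)
      (hinj.mono ball_subset_closedBall) (fun _ ↦ (1 : ℝ))
    change ∫ _ in g '' ball (0 : E) R, (1 : ℝ) = _ at hcv
    rw [himage] at hcv
    simp only [integral_const, smul_eq_mul, mul_one, measureReal_restrict_apply_univ] at hcv
    rw [hcv]
    refine setIntegral_congr_fun measurableSet_ball fun x hx ↦ ?_
    exact (abs_of_pos (hpos x (ball_subset_closedBall hx))).symm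
  let t : ℕ → ℝ := fun i ↦ min 1 δ / ((C + 1) * (i + 2))
  have htinj : Function.Injective t := by
    intro i j hij
    have hm : min 1 δ ≠ 0 := (lt_min one_pos hδ).ne'
    simp only [t] at hij
    have hi : (i : ℝ) + 2 ≠ 0 := by positivity
    have hj : (j : ℝ) + 2 ≠ 0 := by positivity
    have hC1 : C + 1 ≠ 0 := by positivity
    field_simp at hij
    exact_mod_cast (add_right_cancel hij).symm
  obtain ⟨N, w, hw, hdet⟩ := exists_det_one_add_eq_sum (E := E) htinj
  have hint : ∀ s : ℝ, IntegrableOn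
      (fun x ↦ (ContinuousLinearMap.id ℝ E + s • fderiv ℝ u x).det) (ball (0 : E) R) := by
    intro s
    have : Continuous fun x ↦ (ContinuousLinearMap.id ℝ E + s • fderiv ℝ u x).det :=
      ContinuousLinearMap.continuous_det.comp (continuous_const.add (hu'.const_smul s))
    exact (this.continuousOn.integrableOn_compact (isCompact_closedBall (0 : E) R)).mono_set
      ball_subset_closedBall
  have hsum : ∫ x in ball (0 : E) R, (ContinuousLinearMap.id ℝ E + fderiv ℝ u x).det =
      volume.real (ball (0 : E) R) := by
    rw [funext fun x ↦ hdet (fderiv ℝ u x),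
      integral_finsetSum _ fun i _ ↦ (hint (t i)).const_mul (w i)]
    simp_rw [integral_const_mul]
    rw [← one_mul (volume.real _), ← hw, Finset.sum_mul]
    refine Finset.sum_congr rfl fun i _ ↦ ?_
    have hden : (0 : ℝ) < (C + 1) * (i + 2) := by positivity
    have hmin : 0 < min 1 δ := lt_min one_pos hδ
    have hi : (0 : ℝ) ≤ i := Nat.cast_nonneg i
    have hCt : t i * C < min 1 δ := by
      simp only [t]
      rw [div_mul_eq_mul_div, div_lt_iff₀ hden]
      refine mul_lt_mul_of_pos_left ?_ hmin
      nlinarith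
    rw [hvol (t i) (by positivity) ?_ (hCt.trans_le (min_le_left _ _))
      (hCt.trans_le (min_le_right _ _))]
    simp only [t]
    rw [div_lt_one hden]
    have := min_le_left 1 δ
    nlinarith
  have hzero : ∀ x, (ContinuousLinearMap.id ℝ E + fderiv ℝ u x).det = 0 := by
    intro x
    have hrd : DifferentiableAt ℝ r x := hr.differentiable one_ne_zero x
    have h1 : ContinuousLinearMap.id ℝ E + fderiv ℝ u x = fderiv ℝ r x := by
      have : fderiv ℝ u x = fderiv ℝ r x - ContinuousLinearMap.id ℝ E :=
        (hrd.hasFDerivAt.sub (hasFDerivAt_id x)).fderiv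
      rw [this]; abel
    rw [h1]
    by_contra hne
    obtain ⟨v, hv⟩ :=
      ((fderiv ℝ r x).toContinuousLinearEquivOfDetNeZero hne).surjective (r x)
    have h2 : HasFDerivAt (fun y ↦ inner ℝ (r y) (r y)) _ x :=
      hrd.hasFDerivAt.inner ℝ hrd.hasFDerivAt
    have h3 : (fun y ↦ inner ℝ (r y) (r y)) = fun _ ↦ R ^ 2 := by
      ext y; rw [real_inner_self_eq_norm_sq, hnorm]
    rw [h3] at h2
    have h4 := congrArg (fun A ↦ A v) (h2.unique (hasFDerivAt_const _ _))
    have hv' : fderiv ℝ r x v = r x := hv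
    simp [hv', hnorm, hR.ne'] at h4
  have hball : 0 < volume.real (ball (0 : E) R) :=
    ENNReal.toReal_pos (measure_ball_pos _ _ hR).ne' measure_ball_lt_top.ne
  rw [← hsum, funext hzero, integral_zero] at hball
  exact hball.false

open scoped Manifold in
/-- A continuous self-map which is the identity outside the unit ball takes a value in the
open unit ball. -/
theorem exists_norm_lt_one_of_eq_id_outside {E : Type*} [NormedAddCommGroup E]
    [InnerProductSpace ℝ E] [FiniteDimensional ℝ E] {F : E → E} (hF : Continuous F)
    (hfix : ∀ x, 1 ≤ ‖x‖ → F x = x) : ∃ x, ‖F x‖ < 1 := by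
  by_contra! hnorm
  let T : E → Set E := fun x ↦ if ‖x‖ < 2 then ball (F x) 1 else {x}
  have hT : ∀ x, Convex ℝ (T x) := by
    intro x
    by_cases hx : ‖x‖ < 2
    · simpa only [T, hx, if_true] using convex_ball (F x) 1
    · simpa only [T, hx, if_false] using convex_singleton x
  obtain ⟨G, hG⟩ := exists_contMDiffMap_forall_mem_convex_of_local (n := (1 : ℕ∞)) 𝓘(ℝ, E) hT <| by
    intro x
    by_cases hx : 1 < ‖x‖
    · refine ⟨{y | 1 < ‖y‖}, (isOpen_lt continuous_const continuous_norm).mem_nhds hx, id,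
        contMDiffOn_id, fun y hy ↦ ?_⟩
      have := hfix y (le_of_lt hy)
      simp only [T, this, id]
      split_ifs <;> simp
    · have hopen : IsOpen {y : E | ‖y‖ < 2 ∧ dist (F x) (F y) < 1} :=
        (isOpen_lt continuous_norm continuous_const).inter
          (isOpen_lt (continuous_const.dist hF) continuous_const)
      refine ⟨_, hopen.mem_nhds ⟨by linarith, by simp⟩, fun _ ↦ F x, contMDiffOn_const,
        fun y hy ↦ ?_⟩
      simp [T, hy.1, hy.2]
  have hGc : ContDiff ℝ 1 G := G.contMDiff.contDiff
  have hGfix : ∀ x, 2 ≤ ‖x‖ → G x = x := by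
    intro x hx
    simpa only [T, mem_singleton_iff, not_lt.2 hx, if_false] using hG x
  have hGne : ∀ x, G x ≠ 0 := by
    intro x h0
    by_cases hx : ‖x‖ < 2
    · have h := hG x
      simp only [T, mem_ball, hx, if_true, h0, dist_zero_left] at h
      exact (hnorm x).not_gt h
    · have := hGfix x (not_lt.1 hx)
      rw [← this, h0, norm_zero] at hx
      norm_num at hx
  refine not_contDiff_retraction_sphere (R := 2) two_pos (r := fun x ↦ (2 * ‖G x‖⁻¹) • G x)
    ((contDiff_const.mul ((hGc.norm ℝ hGne).inv fun x ↦ norm_ne_zero_iff.2 (hGne x))).smul hGc)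
    (fun x ↦ ?_) (fun x hx ↦ ?_)
  · have := norm_ne_zero_iff.2 (hGne x)
    rw [norm_smul, norm_mul, norm_inv, norm_norm]
    field_simp
    simp
  · simp [hGfix x hx.ge, hx]

/-- The unit sphere of a finite-dimensional Euclidean space is not contractible. -/
theorem not_nullhomotopic_id_sphere {E : Type*} [NormedAddCommGroup E]
    [InnerProductSpace ℝ E] [FiniteDimensional ℝ E] :
    ¬ (ContinuousMap.id (sphere (0 : E) 1)).Nullhomotopic := by
  rintro ⟨p, ⟨H⟩⟩
  let ν : E → sphere (0 : E) 1 := fun x ↦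
    if h : x = 0 then p else ⟨‖x‖⁻¹ • x, by simp [norm_smul, h]⟩
  have hν : ∀ x, x ≠ 0 → (ν x : E) = ‖x‖⁻¹ • x := fun x hx ↦ by simp [ν, hx]
  have hνc : ∀ x, x ≠ 0 → ContinuousAt ν x := by
    intro x hx
    rw [Topology.IsInducing.subtypeVal.continuousAt_iff]
    have h : ContinuousAt (fun y : E ↦ ‖y‖⁻¹ • y) x :=
      (continuousAt_id.norm.inv₀ (norm_ne_zero_iff.2 hx)).smul continuousAt_id
    refine h.congr ?_
    filter_upwards [isOpen_ne.mem_nhds hx] with y hy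
    exact (hν y hy).symm
  let s : E → unitInterval := fun x ↦ projIcc 0 1 zero_le_one (2 - 2 * ‖x‖)
  have hs : Continuous s :=
    continuous_projIcc.comp (continuous_const.sub (continuous_const.mul continuous_norm))
  let F : E → E := fun x ↦ max 1 ‖x‖ • (H (s x, ν x) : E)
  have hF : Continuous F := by
    rw [continuous_iff_continuousAt]
    intro x
    by_cases hx : x = 0
    · have : ∀ᶠ y in 𝓝 x, F y = p := by
        rw [hx]
        filter_upwards [ball_mem_nhds (0 : E) (by norm_num : (0 : ℝ) < 1 / 2)] with y hy
        rw [mem_ball_zero_iff] at hy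
        have h1 : s y = 1 := projIcc_of_right_le _ (by linarith)
        have h2 : max 1 ‖y‖ = 1 := max_eq_left (by linarith)
        simp [F, h1, h2]
      exact continuousAt_const.congr (this.mono fun _ h ↦ h.symm)
    · exact (continuousAt_const.max continuousAt_id.norm).smul
        (continuous_subtype_val.continuousAt.comp
          (H.continuous.continuousAt.comp (hs.continuousAt.prodMk (hνc x hx))))
  obtain ⟨x, hx⟩ := exists_norm_lt_one_of_eq_id_outside hF fun x hx ↦ by
    have h0 : x ≠ 0 := by rintro rfl; norm_num at hx
    have h1 : s x = 0 := projIcc_of_le_left _ (by linarith)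
    have h2 : max 1 ‖x‖ = ‖x‖ := max_eq_right hx
    simp [F, h1, h2, hν x h0, smul_smul, h0]
  have h1 : ‖(H (s x, ν x) : E)‖ = 1 := norm_eq_of_mem_sphere _
  simp only [F, norm_smul, h1, mul_one, Real.norm_eq_abs] at hx
  exact absurd hx (not_lt.2 ((le_max_left _ _).trans (le_abs_self _)))

end Brouwer

namespace SComplex

section Realization

variable {V : Type*} {K : SComplex V}

/-- The linear extension to the realization of a real function on the vertices. -/
noncomputable def linearExtension (K : SComplex V) (c : V → ℝ) (y : K.space) : ℝ :=
  ∑ᶠ v, y.1 v * c v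

theorem linearExtension_eq_sum (c : V → ℝ) (y : K.space) {σ : Finset V}
    (hσ : ∀ v, v ∉ σ → y.1 v = 0) : K.linearExtension c y = ∑ v ∈ σ, y.1 v * c v := by
  refine finsum_eq_sum_of_support_subset _ fun v hv ↦ ?_
  by_contra h
  exact hv (by simp [hσ v h])

theorem continuous_linearExtension {c : V → ℝ} (hc : ∀ v, |c v| ≤ 1) :
    Continuous (K.linearExtension c) := by
  rw [continuous_iff_continuousAt]
  intro y₀
  obtain ⟨σ₀, -, -, hσ₀, hsum₀⟩ := y₀.2
  have hbound : ∀ y : K.space, dist (K.linearExtension c y) (K.linearExtension c y₀) ≤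
      ∑ v ∈ σ₀, |y.1 v - y₀.1 v| + (1 - ∑ v ∈ σ₀, y.1 v) := by
    intro y
    obtain ⟨σ, -, hnn, hσ, hsum⟩ := y.2
    have hT : ∀ v, v ∉ σ ∪ σ₀ → y.1 v = 0 := fun v hv ↦
      hσ v fun h ↦ hv (Finset.mem_union_left _ h)
    have hT₀ : ∀ v, v ∉ σ ∪ σ₀ → y₀.1 v = 0 := fun v hv ↦
      hσ₀ v fun h ↦ hv (Finset.mem_union_right _ h)
    have hone : ∑ v ∈ σ ∪ σ₀, y.1 v = 1 := by
      rw [← hsum]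
      exact (Finset.sum_subset Finset.subset_union_left fun v _ hv ↦ hσ v hv).symm
    rw [linearExtension_eq_sum c y hT, linearExtension_eq_sum c y₀ hT₀, Real.dist_eq,
      ← Finset.sum_sub_distrib, ← hone,
      ← Finset.sum_sdiff (Finset.subset_union_right (s₁ := σ) (s₂ := σ₀)) (f := fun v ↦ y.1 v),
      add_sub_cancel_right]
    calc |∑ v ∈ σ ∪ σ₀, (y.1 v * c v - y₀.1 v * c v)|
        ≤ ∑ v ∈ σ ∪ σ₀, |y.1 v - y₀.1 v| := by
          refine (Finset.abs_sum_le_sum_abs _ _).trans (Finset.sum_le_sum fun v _ ↦ ?_)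
          rw [← sub_mul, abs_mul]
          exact mul_le_of_le_one_right (abs_nonneg _) (hc v)
      _ = ∑ v ∈ (σ ∪ σ₀) \ σ₀, |y.1 v - y₀.1 v| + ∑ v ∈ σ₀, |y.1 v - y₀.1 v| :=
          (Finset.sum_sdiff Finset.subset_union_right).symm
      _ = ∑ v ∈ σ₀, |y.1 v - y₀.1 v| + ∑ v ∈ (σ ∪ σ₀) \ σ₀, y.1 v := by
          rw [add_comm]
          congr 1
          refine Finset.sum_congr rfl fun v hv ↦ ?_
          rw [hσ₀ v (Finset.mem_sdiff.1 hv).2, sub_zero, abs_of_nonneg (hnn v)]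
  have hcoord : ∀ v, Continuous fun y : K.space ↦ y.1 v := fun v ↦
    (continuous_apply v).comp continuous_subtype_val
  have hcont : Continuous fun y : K.space ↦
      ∑ v ∈ σ₀, |y.1 v - y₀.1 v| + (1 - ∑ v ∈ σ₀, y.1 v) :=
    (continuous_finsetSum _ fun v _ ↦ ((hcoord v).sub continuous_const).abs).add
      (continuous_const.sub (continuous_finsetSum _ fun v _ ↦ hcoord v))
  refine tendsto_iff_dist_tendsto_zero.2
    (squeeze_zero (fun _ ↦ dist_nonneg) hbound ?_)
  simpa [hsum₀] using hcont.tendsto y₀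

end Realization

section Coloured

variable {V : Type*} {ι : Type*}

/-- The complex on `V` whose simplices carry no two antipodal colours `(i, true)`, `(i, false)`
and in which the link of `v` meets the vertices of level below that of `v` in sets prescribed
by `D v`. -/
def coloured (lvl : V → ℕ) (D : V → Set (Finset V)) (col : V → ι × Bool) : SComplex V where
  faces := {s | s.Nonempty ∧ (∀ a ∈ s, ∀ b ∈ s, (col a).1 = (col b).1 → col a = col b) ∧
    ∀ m ∈ s, ∀ τ ⊆ s, τ.Nonempty → (∀ x ∈ τ, lvl x < lvl m) → τ ∈ D m}
  not_empty_mem := fun h ↦ Finset.not_nonempty_empty h.1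
  down_closed := fun hs hts ht ↦ ⟨ht, fun a ha b hb ↦ hs.2.1 a (hts ha) b (hts hb),
    fun m hm τ hτ ↦ hs.2.2 m (hts hm) τ (hτ.trans hts)⟩

variable {lvl : V → ℕ} {D : V → Set (Finset V)} {col : V → ι × Bool}

theorem vertexSet_coloured : (coloured lvl D col).vertexSet = Set.univ := by
  refine Set.eq_univ_of_forall fun v ↦ ⟨Finset.singleton_nonempty v, ?_, ?_⟩
  · intro a ha b hb _
    rw [Finset.mem_singleton.1 ha, Finset.mem_singleton.1 hb]
  · intro m hm τ hτ ⟨x, hx⟩ hlt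
    have := hlt x hx
    rw [Finset.mem_singleton.1 hm, Finset.mem_singleton.1 (hτ hx)] at this
    exact absurd this (lt_irrefl _)

/-- If all finite prescriptions are realized at arbitrarily high levels in every colour, then
`coloured lvl D col` is `r`-ample for all `r` smaller than the number of colours. -/
theorem isAmple_coloured [Fintype ι] [Nonempty V] {r : ℕ} (hr : r < Fintype.card (ι × Bool))
    (h : ∀ (L : Finset (Finset V)) (c : ι × Bool) (N : ℕ),
      ∃ v, N < lvl v ∧ D v = ↑L ∧ col v = c) :
    (coloured lvl D col).IsAmple r := by
  set K := coloured lvl D col with hK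
  have hvert : ∀ v, v ∈ K.vertexSet := fun v ↦ vertexSet_coloured ▸ Set.mem_univ v
  refine ⟨⟨_, hvert (Classical.arbitrary V)⟩, fun U _ hU L hLK hLU ↦ ?_⟩
  have hsub : ∀ τ ∈ L.faces, τ ⊆ U := fun τ hτ x hx ↦
    hLU (L.down_closed hτ (Finset.singleton_subset_iff.2 hx) (Finset.singleton_nonempty x))
  obtain ⟨c, hc⟩ : ∃ c, c ∉ U.image fun v ↦ ((col v).1, !(col v).2) := by
    by_contra! hall
    have : Finset.univ ⊆ U.image fun v ↦ ((col v).1, !(col v).2) := fun c _ ↦ hall c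
    have := (Finset.card_le_card this).trans Finset.card_image_le
    rw [Finset.card_univ] at this
    omega
  have hcol : ∀ x ∈ U, (col x).1 = c.1 → col x = c := by
    intro x hx h1
    by_contra hne
    refine hc (Finset.mem_image.2 ⟨x, hx, Prod.ext h1 ?_⟩)
    have h2 : (col x).2 ≠ c.2 := fun h2 ↦ hne (Prod.ext h1 h2)
    revert h2
    cases (col x).2 <;> cases c.2 <;> simp
  obtain ⟨v, hv, hDv, hcv⟩ := h (U.powerset.filter (· ∈ L.faces)) c (U.sup lvl)
  have hlt : ∀ x ∈ U, lvl x < lvl v := fun x hx ↦ (Finset.le_sup hx).trans_lt hv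
  have hD : ∀ τ, τ ∈ D v ↔ τ ∈ L.faces := by
    intro τ
    rw [hDv]
    simpa using hsub τ
  refine ⟨v, hvert v, Set.ext fun τ ↦ ⟨?_, fun hτ ↦ ?_⟩⟩
  · rintro ⟨⟨hτK, -, hins⟩, hτU⟩
    exact (hD τ).1 (hins.2.2 v (Finset.mem_insert_self _ _) τ (Finset.subset_insert _ _) hτK.1
      fun x hx ↦ hlt x (hτU hx))
  · have hτU := hsub τ hτ
    have hτK := hLK hτ
    refine ⟨⟨hτK, fun hvτ ↦ lt_irrefl _ (hlt v (hτU hvτ)), Finset.insert_nonempty _ _, ?_, ?_⟩,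
      hτU⟩
    · intro a ha b hb hab
      rcases Finset.mem_insert.1 ha with rfl | ha' <;>
        rcases Finset.mem_insert.1 hb with rfl | hb'
      · rfl
      · rw [hcv, hcol b (hτU hb') (hcv ▸ hab.symm)]
      · rw [hcv, hcol a (hτU ha') (hcv ▸ hab)]
      · exact hτK.2.1 a ha' b hb' hab
    · intro m hm ρ hρ hne hρm
      have hvρ : v ∉ ρ := by
        intro hvρ
        have h1 := hρm v hvρ
        rcases Finset.mem_insert.1 hm with rfl | hm
        · exact lt_irrefl _ h1
        · exact lt_asymm h1 (hlt m (hτU hm))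
      have hρτ : ρ ⊆ τ := (Finset.subset_insert_iff_of_notMem hvρ).1 hρ
      rcases Finset.mem_insert.1 hm with rfl | hm
      · exact (hD ρ).2 (L.down_closed hτ hρτ hne)
      · exact hτK.2.2 m hm ρ hρτ hne hρm

/-- The `i`-th coordinate of a signed unit vector. -/
noncomputable def signCoord (i : ι) (c : ι × Bool) : ℝ :=
  if c.1 = i then (if c.2 then 1 else -1) else 0

theorem abs_signCoord_le_one (i : ι) (c : ι × Bool) : |signCoord i c| ≤ 1 := by
  unfold signCoord
  split_ifs <;> simp

theorem exists_linearExtension_signCoord_ne_zero (y : (coloured lvl D col).space) :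
    ∃ i, (coloured lvl D col).linearExtension (fun v ↦ signCoord i (col v)) y ≠ 0 := by
  obtain ⟨σ, hσK, hnn, hσ, hsum⟩ := y.2
  obtain ⟨v, hv, hyv⟩ : ∃ v ∈ σ, y.1 v ≠ 0 :=
    Finset.exists_ne_zero_of_sum_ne_zero (by rw [hsum]; exact one_ne_zero)
  refine ⟨(col v).1, fun h0 ↦ ?_⟩
  rw [linearExtension_eq_sum _ y hσ] at h0
  have hsq : signCoord (col v).1 (col v) * signCoord (col v).1 (col v) = 1 := by
    unfold signCoord
    split_ifs <;> simp_all
  have hpos : 0 < ∑ w ∈ σ, y.1 w * signCoord (col v).1 (col w) * signCoord (col v).1 (col v) := by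
    refine Finset.sum_pos' (fun w hw ↦ ?_) ⟨v, hv, ?_⟩
    · by_cases hcw : (col w).1 = (col v).1
      · rw [hσK.2.1 w hw v hv hcw, mul_assoc, hsq, mul_one]
        exact hnn w
      · simp [signCoord, hcw]
    · rw [mul_assoc, hsq, mul_one]
      exact lt_of_le_of_ne (hnn v) hyv.symm
  rw [← Finset.sum_mul, h0, zero_mul] at hpos
  exact hpos.false

/-- The piecewise linear map to the cross-polytope induced by the colouring. -/
noncomputable def colourMap (lvl : V → ℕ) (D : V → Set (Finset V)) (col : V → ι × Bool)
    (y : (coloured lvl D col).space) : EuclideanSpace ℝ ι :=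
  WithLp.toLp 2 fun i ↦ (coloured lvl D col).linearExtension (fun v ↦ signCoord i (col v)) y

theorem continuous_colourMap : Continuous (colourMap lvl D col) :=
  (PiLp.continuous_toLp 2 _).comp <| continuous_pi fun i ↦
    continuous_linearExtension fun v ↦ abs_signCoord_le_one i (col v)

theorem colourMap_ne_zero (y : (coloured lvl D col).space) : colourMap lvl D col y ≠ 0 := by
  intro h
  obtain ⟨i, hi⟩ := exists_linearExtension_signCoord_ne_zero y
  exact hi (congrArg (fun z : EuclideanSpace ℝ ι ↦ z i) h)

/-- The radial projection of `colourMap` to the unit sphere. -/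
noncomputable def sphereMap [Fintype ι] (lvl : V → ℕ) (D : V → Set (Finset V))
    (col : V → ι × Bool) :
    C((coloured lvl D col).space, Metric.sphere (0 : EuclideanSpace ℝ ι) 1) where
  toFun y := ⟨‖colourMap lvl D col y‖⁻¹ • colourMap lvl D col y,
    mem_sphere_zero_iff_norm.2 (norm_smul_inv_norm (𝕜 := ℝ) (colourMap_ne_zero y))⟩
  continuous_toFun := Continuous.subtype_mk
    ((continuous_colourMap.norm.inv₀ fun y ↦ norm_ne_zero_iff.2 (colourMap_ne_zero y)).smul
      continuous_colourMap) _

/-- If the complex contains the boundary of the cross-polytope, coloured bijectively, then the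
unit sphere is a retract of its realization. -/
theorem exists_sphereMap_comp_eq_id [Fintype ι] [Nonempty ι]
    {a : ι × Bool → V} (hcol : ∀ c, col (a c) = c) (hD : ∀ c, D (a c) = Set.univ) :
    ∃ f : C(Metric.sphere (0 : EuclideanSpace ℝ ι) 1, (coloured lvl D col).space),
      (sphereMap lvl D col).comp f = ContinuousMap.id _ := by
  let ℓ : Metric.sphere (0 : EuclideanSpace ℝ ι) 1 → ℝ := fun x ↦ ∑ i, |x.1 i|
  have hcoord : ∀ i, Continuous fun x : Metric.sphere (0 : EuclideanSpace ℝ ι) 1 ↦ x.1 i :=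
    fun i ↦ (EuclideanSpace.proj (𝕜 := ℝ) i).continuous.comp continuous_subtype_val
  have hℓc : Continuous ℓ := continuous_finsetSum _ fun i _ ↦ (hcoord i).abs
  have hℓ : ∀ x, 0 < ℓ x := by
    intro x
    obtain ⟨i, hi⟩ : ∃ i, x.1 i ≠ 0 := by
      by_contra! h
      exact ne_zero_of_mem_unit_sphere x (by ext i; exact h i)
    exact Finset.sum_pos' (fun _ _ ↦ abs_nonneg _) ⟨i, Finset.mem_univ i, abs_pos.2 hi⟩
  have ha : Function.Injective a := Function.LeftInverse.injective hcol
  let s : Metric.sphere (0 : EuclideanSpace ℝ ι) 1 → ι → V := fun x i ↦ a (i, decide (0 ≤ x.1 i))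
  have hs : ∀ x, Function.Injective (s x) := fun x i j hij ↦ congrArg Prod.fst (ha hij)
  let g : Metric.sphere (0 : EuclideanSpace ℝ ι) 1 → V → ℝ := fun x v ↦
    if a (col v) = v then
      (if (col v).2 then max (x.1 (col v).1) 0 else max (-x.1 (col v).1) 0) / ℓ x else 0
  have hgs : ∀ x i, g x (s x i) = |x.1 i| / ℓ x := by
    intro x i
    simp only [g, s, hcol, if_true]
    by_cases h : 0 ≤ x.1 i
    · simp [h, abs_of_nonneg]
    · simp [h, abs_of_neg (not_le.1 h), (not_le.1 h).le]
  have hg0 : ∀ x v, v ∉ Finset.univ.image (s x) → g x v = 0 := by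
    intro x v hv
    by_cases hav : a (col v) = v
    · simp only [g, hav, if_true]
      have hne : (col v).2 ≠ decide (0 ≤ x.1 (col v).1) := by
        intro h
        refine hv (Finset.mem_image.2 ⟨(col v).1, Finset.mem_univ _, ?_⟩)
        simp only [s]
        rw [← h]
        exact hav
      by_cases h : 0 ≤ x.1 (col v).1
      · have h2 : (col v).2 = false := by simpa [h] using hne
        simp [h2, h]
      · have h2 : (col v).2 = true := by simpa [h] using hne
        simp [h2, (not_le.1 h).le]
    · simp [g, hav]
  have hgK : ∀ x, g x ∈ (coloured lvl D col).realization := by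
    intro x
    refine ⟨Finset.univ.image (s x), ⟨Finset.univ_nonempty.image _, ?_, ?_⟩, ?_, hg0 x, ?_⟩
    · intro p hp q hq hpq
      obtain ⟨i, -, rfl⟩ := Finset.mem_image.1 hp
      obtain ⟨j, -, rfl⟩ := Finset.mem_image.1 hq
      simp only [s, hcol] at hpq ⊢
      rw [hpq]
    · intro m hm τ _ _ _
      obtain ⟨i, -, rfl⟩ := Finset.mem_image.1 hm
      simp only [s, hD, Set.mem_univ]
    · intro v
      have := (hℓ x).le
      simp only [g]
      split_ifs <;> positivity
    · rw [Finset.sum_image fun i _ j _ h ↦ hs x h]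
      simp only [hgs]
      rw [← Finset.sum_div]
      exact div_self (hℓ x).ne'
  have hgc : Continuous g := by
    refine continuous_pi fun v ↦ ?_
    simp only [g]
    split_ifs
    · exact ((hcoord _).max continuous_const).div hℓc fun x ↦ (hℓ x).ne'
    · exact ((hcoord _).neg.max continuous_const).div hℓc fun x ↦ (hℓ x).ne'
    · exact continuous_const
  refine ⟨⟨fun x ↦ ⟨g x, hgK x⟩, hgc.subtype_mk hgK⟩, ContinuousMap.ext fun x ↦ Subtype.ext ?_⟩
  have hmap : colourMap lvl D col ⟨g x, hgK x⟩ = (ℓ x)⁻¹ • x.1 := by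
    ext i
    change (coloured lvl D col).linearExtension (fun v ↦ signCoord i (col v)) ⟨g x, hgK x⟩ = _
    rw [linearExtension_eq_sum _ _ (hg0 x), Finset.sum_image fun i _ j _ h ↦ hs x h,
      Finset.sum_eq_single i]
    · change g x (s x i) * _ = _
      rw [hgs]
      by_cases h : 0 ≤ x.1 i
      · simp [s, hcol, signCoord, h, abs_of_nonneg, div_eq_inv_mul]
      · simp [s, hcol, signCoord, h, abs_of_neg (not_le.1 h), div_eq_inv_mul]
    · intro j _ hji
      simp [s, hcol, signCoord, hji]
    · simp
  change ‖colourMap lvl D col ⟨g x, hgK x⟩‖⁻¹ • colourMap lvl D col ⟨g x, hgK x⟩ = x.1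
  have hx : ‖x.1‖ = 1 := norm_eq_of_mem_sphere x
  rw [hmap, norm_smul, hx, mul_one, norm_inv, inv_inv, Real.norm_of_nonneg (hℓ x).le,
    smul_smul, mul_inv_cancel₀ (hℓ x).ne', one_smul]

end Coloured

end SComplex

/-- For every `n ≥ 0` there is an infinite simplicial complex which is
`(2n+1)`-ample but not `n`-connected.  In particular `3`-ampleness does not imply
simple connectivity. -/
theorem exists_ample_not_nconnected (n : ℕ) :
    ∃ (V : Type) (K : SComplex V), K.vertexSet.Infinite ∧
      K.IsAmple (2 * n + 1) ∧ ¬ NConnected n K.space := by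
  let c := Fin (n + 1) × Bool
  let V := c ⊕ ℕ
  obtain ⟨e, he⟩ := exists_surjective_nat (Finset (Finset V) × c × ℕ)
  let lvl : V → ℕ := Sum.elim (fun _ ↦ 0) (fun m ↦ m + 1)
  let D : V → Set (Finset V) := Sum.elim (fun _ ↦ Set.univ) (fun m ↦ ↑(e m).1)
  let col : V → c := Sum.elim id (fun m ↦ (e m).2.1)
  have hreal : ∀ (L : Finset (Finset V)) (k : c) (N : ℕ),
      ∃ v, N < lvl v ∧ D v = ↑L ∧ col v = k := by
    intro L k N
    choose m hm using fun j : ℕ ↦ he (L, k, j)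
    have hinj : Function.Injective m := fun i j hij ↦ by
      have := (hm i).symm.trans (hij ▸ hm j)
      simpa using this
    obtain ⟨_, ⟨j, rfl⟩, hj⟩ := (Set.infinite_range_of_injective hinj).exists_gt N
    refine ⟨Sum.inr (m j), Nat.lt_succ_of_lt hj, ?_, ?_⟩
    · simp [D, hm]
    · simp [col, hm]
  refine ⟨V, SComplex.coloured lvl D col, ?_, ?_, ?_⟩
  · rw [SComplex.vertexSet_coloured]
    exact Set.infinite_univ
  · refine SComplex.isAmple_coloured ?_ hreal
    simp only [Fintype.card_prod, Fintype.card_fin, Fintype.card_bool]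
    omega
  · intro hconn
    obtain ⟨f, hf⟩ := SComplex.exists_sphereMap_comp_eq_id (lvl := lvl) (D := D) (col := col)
      (a := Sum.inl) (fun _ ↦ rfl) (fun _ ↦ rfl)
    have hnull := (hconn.2 n le_rfl f).comp_right (SComplex.sphereMap lvl D col)
    rw [hf] at hnull
    exact not_nullhomotopic_id_sphere hnull
end
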